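/- Suppose the delayed mass-action system is a DeCBMAS and the network is a combination of ℓ subnetworks each of which is a 2d sub-DeCBMAS. If every semilocking set W of the combined network is in Case I or in Case II and satisfies W ∩ S_c = ∅, then the system is persistent. -/

import Mathlib

open Finset Filter

variable {n r : ℕ}

/-- Mass-action monomial `x^y = ∏ j, x j ^ y j`. -/
def mono (x : Fin n → ℝ) (y : Fin n → ℕ) : ℝ := ∏ j, x j ^ y j

/-- A (bounded-domain) solution of the delayed mass-action system whose reactions are
those in the index set `R` (with reactant complexes `y`, product complexes `y'`,
rate constants `k`, delays `τ`, and maximal delay `τm`):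
nonnegative, continuous on `[-τm, ∞)`, and satisfying the delay differential equation
`x'(t) = ∑ i ∈ R, k i (x(t-τ i)^{y i} • y' i - x(t)^{y i} • y i)` for `t > 0`. -/
def IsSolutionOn (y y' : Fin r → Fin n → ℕ) (k τ : Fin r → ℝ) (τm : ℝ)
    (R : Finset (Fin r)) (x : ℝ → Fin n → ℝ) : Prop :=
  (∀ t ∈ Set.Ici (-τm), ∀ j, 0 ≤ x t j) ∧
  ContinuousOn x (Set.Ici (-τm)) ∧
  ∀ t > (0 : ℝ), HasDerivAt x
    (fun j => ∑ i ∈ R, k i * (mono (x (t - τ i)) (y i) * (y' i j : ℝ)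
      - mono (x t) (y i) * (y i j : ℝ))) t

/-- A solution of the full delayed mass-action system. -/
def IsSolution (y y' : Fin r → Fin n → ℕ) (k τ : Fin r → ℝ) (τm : ℝ)
    (x : ℝ → Fin n → ℝ) : Prop :=
  IsSolutionOn y y' k τ τm Finset.univ x

/-- Positive initial condition: `x` is strictly positive on `[-τm, 0]`. -/
def PosInit (τm : ℝ) (x : ℝ → Fin n → ℝ) : Prop :=
  ∀ t ∈ Set.Icc (-τm) 0, ∀ j, 0 < x t j

/-- The solution is bounded on `[-τm, ∞)`. -/
def BoundedSol (τm : ℝ) (x : ℝ → Fin n → ℝ) : Prop :=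
  ∃ M : ℝ, ∀ t ∈ Set.Ici (-τm), ‖x t‖ ≤ M

/-- The (sub)system consisting of the reactions in `R` is complex balanced:
there is a positive state `xb` at which, for every complex `η`, the inflow and
outflow rates of `η` coincide. -/
def ComplexBalancedOn (y y' : Fin r → Fin n → ℕ) (k : Fin r → ℝ)
    (R : Finset (Fin r)) : Prop :=
  ∃ xb : Fin n → ℝ, (∀ j, 0 < xb j) ∧ ∀ η : Fin n → ℕ,
    ∑ i ∈ R.filter (fun i => y i = η), k i * mono xb (y i)
      = ∑ i ∈ R.filter (fun i => y' i = η), k i * mono xb (y i)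

/-- `W` is a semilocking set for the reactions in `R`. -/
def Semilocking (y y' : Fin r → Fin n → ℕ) (R : Finset (Fin r)) (W : Set (Fin n)) : Prop :=
  W.Nonempty ∧ ∀ i ∈ R, (∃ j ∈ W, y' i j ≠ 0) → ∃ j ∈ W, y i j ≠ 0

/-- Stoichiometric subspace spanned by the reaction vectors of the reactions in `R`. -/
def stoichOn (y y' : Fin r → Fin n → ℕ) (R : Finset (Fin r)) : Submodule ℝ (Fin n → ℝ) :=
  Submodule.span ℝ {v | ∃ i ∈ R, v = fun j => (y' i j : ℝ) - (y i j : ℝ)}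

/-- `W` is vertex-type w.r.t. the subspace `V`: the only `v ∈ V` vanishing on `W` is `0`. -/
def VertexType (V : Submodule ℝ (Fin n → ℝ)) (W : Set (Fin n)) : Prop :=
  ∀ v ∈ V, (∀ j ∈ W, v j = 0) → v = 0

/-- `W` is facet-type w.r.t. the subspace `V`: the projection of `V` onto the
coordinates outside `W` has dimension `dim V - 1`. -/
def FacetType (V : Submodule ℝ (Fin n → ℝ)) (W : Set (Fin n)) : Prop :=
  Module.finrank ℝ
      (V.map (LinearMap.funLeft ℝ ℝ (Subtype.val : {j : Fin n // j ∉ W} → Fin n)))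
    = Module.finrank ℝ V - 1

/-- The network is a combination of subnetworks with species sets `Sp p` and with
reaction `i` assigned to subnetwork `grp i`. -/
def IsCombination {l : ℕ} (y y' : Fin r → Fin n → ℕ) (Sp : Fin l → Set (Fin n))
    (grp : Fin r → Fin l) : Prop :=
  (∀ j, ∃ p, j ∈ Sp p) ∧ ∀ i j, (y i j ≠ 0 ∨ y' i j ≠ 0) → j ∈ Sp (grp i)

/-- The reaction index set of subnetwork `p`. -/
def Rgrp {l : ℕ} (grp : Fin r → Fin l) (p : Fin l) : Finset (Fin r) :=
  Finset.univ.filter (fun i => grp i = p)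

/-- The set `S_c` of intersecting species. -/
def interSpecies {l : ℕ} (Sp : Fin l → Set (Fin n)) : Set (Fin n) :=
  {j | ∃ p q, p ≠ q ∧ j ∈ Sp p ∧ j ∈ Sp q}

/-- `W^{cn}`: species outside `W` lying in some subnetwork `p'` with `W ∩ S^(p') = ∅`. -/
def Wcn {l : ℕ} (Sp : Fin l → Set (Fin n)) (W : Set (Fin n)) : Set (Fin n) :=
  {j | j ∉ W ∧ ∃ p, W ∩ Sp p = ∅ ∧ j ∈ Sp p}

/-- `W^{tf}`: completely unrestricted species outside `W`: they occur in some reaction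
all of whose species lie outside `W`. -/
def Wtf (y y' : Fin r → Fin n → ℕ) (W : Set (Fin n)) : Set (Fin n) :=
  {j | j ∉ W ∧ ∃ i, (y i j ≠ 0 ∨ y' i j ≠ 0) ∧
    ∀ j', (y i j' ≠ 0 ∨ y' i j' ≠ 0) → j' ∉ W}

/-- `W^{tr}`: totally restricted species outside `W`: every stoichiometric vector
vanishing on `W` also vanishes at `j`. -/
def Wtr (y y' : Fin r → Fin n → ℕ) (W : Set (Fin n)) : Set (Fin n) :=
  {j | j ∉ W ∧ ∀ v ∈ stoichOn y y' Finset.univ, (∀ j' ∈ W, v j' = 0) → v j = 0}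

/-- `θ` (a function on `[-τm,0]`) is an ω-limit point of the solution `x`. -/
def OmegaLimitPt (τm : ℝ) (x θ : ℝ → Fin n → ℝ) : Prop :=
  ContinuousOn θ (Set.Icc (-τm) 0) ∧ (∀ s ∈ Set.Icc (-τm) 0, ∀ j, 0 ≤ θ s j) ∧
  ∃ tN : ℕ → ℝ, Tendsto tN atTop atTop ∧
    ∀ ε > (0 : ℝ), ∃ N₀, ∀ N ≥ N₀, ∀ s ∈ Set.Icc (-τm) 0, ‖x (tN N + s) - θ s‖ < ε

/-- `θ` lies on the boundary `L_W`: it vanishes identically on the coordinates of `W`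
and is nowhere zero on the coordinates outside `W`. -/
def OnBoundary (τm : ℝ) (W : Set (Fin n)) (θ : ℝ → Fin n → ℝ) : Prop :=
  (∀ s ∈ Set.Icc (-τm) 0, ∀ j ∈ W, θ s j = 0) ∧
  ∀ s ∈ Set.Icc (-τm) 0, ∀ j ∉ W, θ s j ≠ 0

/-- Persistence of the delayed mass-action system: every bounded solution with
positive initial condition has `liminf_{t→∞} x_j(t) > 0` for every species `j`. -/
def Persistent (y y' : Fin r → Fin n → ℕ) (k τ : Fin r → ℝ) (τm : ℝ) : Prop :=
  ∀ x : ℝ → Fin n → ℝ, IsSolution y y' k τ τm x → PosInit τm x → BoundedSol τm x →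
    ∀ j, 0 < liminf (fun t => x t j) atTop


section
noncomputable def ff (a b : ℝ) : ℝ := a * Real.log a - a * Real.log b - a + b

lemma ff_lower {a b : ℝ} (ha : 0 ≤ a) (hb : 0 < b) : (√a - √b) ^ 2 ≤ ff a b := by
  unfold ff
  rcases ha.eq_or_lt with rfl | ha
  · simp [Real.sq_sqrt hb.le]
  have h1 : Real.log (√b / √a) ≤ √b / √a - 1 := Real.log_le_sub_one_of_pos (by positivity)
  rw [Real.log_div (by positivity) (by positivity), Real.log_sqrt hb.le, Real.log_sqrt ha.le] at h1
  have h2 : a * (√b / √a) = √a * √b := by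
    have : a = √a * √a := (Real.mul_self_sqrt ha.le).symm
    have h3 : √a ≠ 0 := by positivity
    field_simp
    nlinarith [Real.mul_self_sqrt ha.le]
  have h4 := mul_le_mul_of_nonneg_left h1 ha.le
  nlinarith [Real.mul_self_sqrt ha.le, Real.mul_self_sqrt hb.le]

lemma ff_nonneg {a b : ℝ} (ha : 0 ≤ a) (hb : 0 < b) : 0 ≤ ff a b :=
  (sq_nonneg _).trans (ff_lower ha hb)

lemma ff_sq {a b B : ℝ} (ha : 0 ≤ a) (hb : 0 < b) (haB : a ≤ B) (hbB : b ≤ B) :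
    (a - b) ^ 2 ≤ 4 * B * ff a b := by
  have h := ff_lower ha hb
  have h1 : (a - b) ^ 2 = (√a - √b) ^ 2 * (√a + √b) ^ 2 := by
    rw [← mul_pow]
    congr 1
    nlinarith [Real.mul_self_sqrt ha, Real.mul_self_sqrt hb.le]
  have h2 : (√a + √b) ^ 2 ≤ 4 * B := by
    nlinarith [Real.mul_self_sqrt ha, Real.mul_self_sqrt hb.le, sq_nonneg (√a - √b)]
  have h3 : 0 ≤ (√a + √b) ^ 2 := sq_nonneg _
  rw [h1]
  have h0 : 0 ≤ (√a - √b) ^ 2 := sq_nonneg _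
  nlinarith [mul_le_mul h h2 h3 (h0.trans h)]

lemma ff_upper {a b : ℝ} (ha : 0 ≤ a) (hb : 0 < b) : ff a b ≤ (a - b) ^ 2 / b := by
  unfold ff
  rcases ha.eq_or_lt with rfl | ha
  · simp; field_simp; rfl
  have h1 : Real.log (a / b) ≤ a / b - 1 := Real.log_le_sub_one_of_pos (by positivity)
  rw [Real.log_div (by positivity) (by positivity)] at h1
  have h4 := mul_le_mul_of_nonneg_left h1 ha.le
  have : (a - b) ^ 2 / b = a * (a / b - 1) - a + b := by field_simp; ring
  rw [this]; linarith

lemma ff_eq_zero {a b : ℝ} (ha : 0 ≤ a) (hb : 0 < b) (h : ff a b ≤ 0) : a = b := by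
  have h1 := ff_sq ha hb (le_max_left a b) (le_max_right a b)
  have h2 : 0 < max a b := lt_max_of_lt_right hb
  have : (a - b) ^ 2 ≤ 0 := h1.trans (by nlinarith)
  nlinarith [sq_nonneg (a - b), pow_eq_zero_iff (n := 2) (a := a - b) (by norm_num)]

noncomputable def YY (xb u : Fin n → ℝ) (η : Fin n → ℕ) : ℝ := mono (fun j => u j / xb j) η

noncomputable def kap (k : Fin r → ℝ) (xb : Fin n → ℝ) (y : Fin r → Fin n → ℕ) (i : Fin r) : ℝ :=
  k i * mono xb (y i)

lemma mono_pos {u : Fin n → ℝ} (hu : ∀ j, 0 < u j) (η) : 0 < mono u η :=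
  Finset.prod_pos fun j _ => pow_pos (hu j) _

lemma mono_nonneg {u : Fin n → ℝ} (hu : ∀ j, 0 ≤ u j) (η) : 0 ≤ mono u η :=
  Finset.prod_nonneg fun j _ => pow_nonneg (hu j) _

lemma continuous_mono (η : Fin n → ℕ) : Continuous (fun u : Fin n → ℝ => mono u η) := by
  unfold mono; fun_prop

lemma continuous_YY (xb : Fin n → ℝ) (η : Fin n → ℕ) : Continuous (fun u => YY xb u η) := by
  unfold YY mono; fun_prop

lemma mono_eq {xb u : Fin n → ℝ} (hxb : ∀ j, 0 < xb j) (η) :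
    mono u η = mono xb η * YY xb u η := by
  unfold YY mono
  rw [← Finset.prod_mul_distrib]
  refine Finset.prod_congr rfl fun j _ => ?_
  rw [← mul_pow]; congr 1
  have := (hxb j).ne'
  field_simp

lemma kap_mul {xb u : Fin n → ℝ} (hxb : ∀ j, 0 < xb j) (k : Fin r → ℝ) (y) (i) :
    k i * mono u (y i) = kap k xb y i * YY xb u (y i) := by
  rw [mono_eq hxb, kap]; ring

lemma YY_pos {xb u : Fin n → ℝ} (hxb : ∀ j, 0 < xb j) (hu : ∀ j, 0 < u j) (η) : 0 < YY xb u η :=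
  mono_pos (fun j => div_pos (hu j) (hxb j)) η

lemma YY_nonneg {xb u : Fin n → ℝ} (hxb : ∀ j, 0 < xb j) (hu : ∀ j, 0 ≤ u j) (η) :
    0 ≤ YY xb u η :=
  mono_nonneg (fun j => div_nonneg (hu j) (hxb j).le) η

lemma log_YY {xb u : Fin n → ℝ} (hxb : ∀ j, 0 < xb j) (η) (hu : ∀ j, η j ≠ 0 → 0 < u j) :
    Real.log (YY xb u η) = ∑ j, Real.log (u j / xb j) * η j := by
  unfold YY mono
  rw [Real.log_prod]
  · refine Finset.sum_congr rfl fun j _ => ?_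
    rw [Real.log_pow]; ring
  · intro j _
    by_cases h : η j = 0
    · simp [h]
    · exact pow_ne_zero _ (div_pos (hu j h) (hxb j)).ne'

lemma YY_eq_zero {xb u : Fin n → ℝ} (hxb : ∀ j, 0 < xb j) (η) :
    YY xb u η = 0 ↔ ∃ j, u j = 0 ∧ η j ≠ 0 := by
  unfold YY mono
  rw [Finset.prod_eq_zero_iff]
  constructor
  · rintro ⟨j, _, h⟩
    refine ⟨j, ?_, ?_⟩
    · have := eq_zero_of_pow_eq_zero h
      rcases div_eq_zero_iff.1 this with h | h
      · exact h
      · exact absurd h (hxb j).ne'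
    · intro h0; simp [h0] at h
  · rintro ⟨j, h, h'⟩
    exact ⟨j, mem_univ _, by simp [h, h']⟩

structure Ctx (y y' : Fin r → Fin n → ℕ) (k τ : Fin r → ℝ) (τm : ℝ) (xb : Fin n → ℝ)
    (x : ℝ → Fin n → ℝ) (M : ℝ) : Prop where
  hk : ∀ i, 0 < k i
  hτ : ∀ i, 0 ≤ τ i
  hτm : ∀ i, τ i ≤ τm
  hτm0 : 0 ≤ τm
  xbpos : ∀ j, 0 < xb j
  bal : ∀ φ : (Fin n → ℕ) → ℝ,
    ∑ i, kap k xb y i * φ (y' i) = ∑ i, kap k xb y i * φ (y i)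
  cont : Continuous x
  pos : ∀ t j, 0 < x t j
  bdd : ∀ t j, x t j ≤ M
  der : ∀ t > (0 : ℝ), ∀ j, HasDerivAt (fun s => x s j)
    (∑ i, k i * (mono (x (t - τ i)) (y i) * (y' i j : ℝ) - mono (x t) (y i) * (y i j : ℝ))) t

lemma kap_pos {k : Fin r → ℝ} {xb : Fin n → ℝ} (hk : ∀ i, 0 < k i) (hxb : ∀ j, 0 < xb j) (y) (i) :
    0 < kap k xb y i := mul_pos (hk i) (mono_pos hxb _)

lemma bal_of_CB {y y' : Fin r → Fin n → ℕ} {k : Fin r → ℝ} {xb : Fin n → ℝ}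
    (h : ∀ η : Fin n → ℕ,
    ∑ i ∈ univ.filter (fun i => y i = η), k i * mono xb (y i)
      = ∑ i ∈ univ.filter (fun i => y' i = η), k i * mono xb (y i)) (φ : (Fin n → ℕ) → ℝ) :
    ∑ i, kap k xb y i * φ (y' i) = ∑ i, kap k xb y i * φ (y i) := by
  classical
  set S : Finset (Fin n → ℕ) := univ.image y ∪ univ.image y'
  have h1 : ∀ z : Fin r → Fin n → ℕ, (∀ i, z i ∈ S) →
      ∑ i, kap k xb y i * φ (z i) = ∑ η ∈ S, (∑ i ∈ univ.filter (fun i => z i = η),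
        k i * mono xb (y i)) * φ η := by
    intro z hz
    rw [← Finset.sum_fiberwise_of_maps_to (s := univ) (t := S) (g := z) (fun i _ => hz i)]
    refine Finset.sum_congr rfl fun η _ => ?_
    rw [Finset.sum_mul]
    refine Finset.sum_congr rfl fun i hi => ?_
    rw [(Finset.mem_filter.1 hi).2, kap]
  rw [h1 y' (fun i => by simp [S]), h1 y (fun i => by simp [S])]
  exact Finset.sum_congr rfl fun η _ => by rw [h η]

-- local entropies
noncomputable def gg (a : ℝ) : ℝ := a * Real.log a - a + 1

lemma continuous_gg : Continuous gg := by
  unfold gg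
  exact ((Real.continuous_mul_log).sub continuous_id).add continuous_const

lemma gg_nonneg {a : ℝ} (ha : 0 ≤ a) : 0 ≤ gg a := by
  have := ff_nonneg ha one_pos
  simp [ff] at this; unfold gg; linarith

-- v_j(a) = xb * gg (a / xb)
noncomputable def Fl (τ : Fin r → ℝ) (x : ℝ → Fin n → ℝ) (φ : (Fin n → ℝ) → ℝ) (i : Fin r) (t : ℝ) : ℝ :=
  ∫ s in (t - τ i)..t, φ (x s)

lemma Fl_hasDerivAt {x : ℝ → Fin n → ℝ} (hx : Continuous x) {φ : (Fin n → ℝ) → ℝ}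
    (hφ : Continuous φ) (τ : Fin r → ℝ) (i) (t : ℝ) :
    HasDerivAt (Fl τ x φ i) (φ (x t) - φ (x (t - τ i))) t := by
  have hc : Continuous fun s => φ (x s) := hφ.comp hx
  have h0 : Fl τ x φ i = fun t => (∫ s in (0:ℝ)..t, φ (x s)) - ∫ s in (0:ℝ)..(t - τ i), φ (x s) := by
    funext t
    rw [Fl, intervalIntegral.integral_interval_sub_left (hc.intervalIntegrable _ _) (hc.intervalIntegrable _ _)]
  rw [h0]
  have h1 : ∀ t, HasDerivAt (fun t => ∫ s in (0:ℝ)..t, φ (x s)) (φ (x t)) t := fun t =>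
    intervalIntegral.integral_hasDerivAt_right (hc.intervalIntegrable _ _)
      (hc.stronglyMeasurableAtFilter _ _) hc.continuousAt
  have h2 := (h1 (t - τ i)).comp t ((hasDerivAt_id t).sub_const (τ i))
  exact ((h1 t).sub h2).congr_deriv (by simp)

noncomputable def VV (y : Fin r → Fin n → ℕ) (k τ : Fin r → ℝ) (xb : Fin n → ℝ) (x : ℝ → Fin n → ℝ)
    (t : ℝ) : ℝ :=
  ∑ j, xb j * gg (x t j / xb j) + ∑ i, kap k xb y i * Fl τ x (fun u => gg (YY xb u (y i))) i t

noncomputable def DD (y y' : Fin r → Fin n → ℕ) (k τ : Fin r → ℝ) (xb : Fin n → ℝ) (x : ℝ → Fin n → ℝ)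
    (t : ℝ) : ℝ :=
  ∑ i, kap k xb y i * ff (YY xb (x (t - τ i)) (y i)) (YY xb (x t) (y' i))

variable {y y' : Fin r → Fin n → ℕ} {k τ : Fin r → ℝ} {τm : ℝ} {xb : Fin n → ℝ}
    {x : ℝ → Fin n → ℝ} {M : ℝ}

lemma Ctx.kp (H : Ctx y y' k τ τm xb x M) (i) : 0 < kap k xb y i := kap_pos H.hk H.xbpos y i

lemma hasDerivAt_gg {a : ℝ} (ha : 0 < a) : HasDerivAt gg (Real.log a) a := by
  have := ((Real.hasDerivAt_mul_log ha.ne').sub (hasDerivAt_id a)).add_const 1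
  exact this.congr_deriv (by simp)

lemma Ctx.V_deriv (H : Ctx y y' k τ τm xb x M) {t : ℝ} (ht : 0 < t) :
    HasDerivAt (VV y k τ xb x) (-(DD y y' k τ xb x t)) t := by
  have hYp : ∀ s η, 0 < YY xb (x s) η := fun s η => YY_pos H.xbpos (H.pos s) η
  have h1 : ∀ j, HasDerivAt (fun s => xb j * gg (x s j / xb j))
      (Real.log (x t j / xb j) * ∑ i, k i * (mono (x (t - τ i)) (y i) * (y' i j : ℝ)
        - mono (x t) (y i) * (y i j : ℝ))) t := by
    intro j
    have h2 := (hasDerivAt_gg (div_pos (H.pos t j) (H.xbpos j))).comp t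
      ((H.der t ht j).div_const (xb j))
    have h3 := h2.const_mul (xb j)
    refine h3.congr_deriv ?_
    have := (H.xbpos j).ne'
    rw [mul_div_assoc', mul_div_assoc', mul_comm (xb j), mul_div_assoc, div_self this, mul_one]
  have h2 : ∀ i, HasDerivAt (fun s => kap k xb y i * Fl τ x (fun u => gg (YY xb u (y i))) i s)
      (kap k xb y i * (gg (YY xb (x t) (y i)) - gg (YY xb (x (t - τ i)) (y i)))) t := fun i =>
    (Fl_hasDerivAt H.cont (continuous_gg.comp (continuous_YY xb (y i))) τ i t).const_mul _
  have h3 := (HasDerivAt.fun_sum (fun j (_ : j ∈ univ) => h1 j)).add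
    (HasDerivAt.fun_sum (fun i (_ : i ∈ univ) => h2 i))
  refine h3.congr_deriv ?_
  have e1 : ∑ j, Real.log (x t j / xb j) * ∑ i, k i * (mono (x (t - τ i)) (y i) * (y' i j : ℝ)
        - mono (x t) (y i) * (y i j : ℝ)) = ∑ i, kap k xb y i *
        (YY xb (x (t - τ i)) (y i) * Real.log (YY xb (x t) (y' i))
          - YY xb (x t) (y i) * Real.log (YY xb (x t) (y i))) := by
    simp_rw [Finset.mul_sum]
    rw [Finset.sum_comm]
    refine Finset.sum_congr rfl fun i _ => ?_
    rw [log_YY H.xbpos _ (fun j _ => H.pos t j), log_YY H.xbpos _ (fun j _ => H.pos t j)]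
    rw [Finset.mul_sum, Finset.mul_sum, ← Finset.sum_sub_distrib, Finset.mul_sum]
    refine Finset.sum_congr rfl fun j _ => ?_
    have a1 := kap_mul (u := x (t - τ i)) H.xbpos k y i
    have a2 := kap_mul (u := x t) H.xbpos k y i
    linear_combination (Real.log (x t j / xb j) * y' i j) * a1 - (Real.log (x t j / xb j) * y i j) * a2
  have e2 := H.bal (fun η => YY xb (x t) η)
  rw [e1, DD, ← Finset.sum_add_distrib, ← Finset.sum_neg_distrib]
  rw [← sub_eq_zero, ← Finset.sum_sub_distrib]
  rw [← sub_eq_zero, ← Finset.sum_sub_distrib] at e2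
  rw [← e2]
  refine Finset.sum_congr rfl fun i _ => ?_
  simp only [gg, ff]
  ring

lemma Ctx.V_nonneg (H : Ctx y y' k τ τm xb x M) (t : ℝ) : 0 ≤ VV y k τ xb x t := by
  refine add_nonneg (Finset.sum_nonneg fun j _ => mul_nonneg (H.xbpos j).le
    (gg_nonneg (div_pos (H.pos t j) (H.xbpos j)).le)) (Finset.sum_nonneg fun i _ =>
      mul_nonneg (H.kp i).le ?_)
  refine intervalIntegral.integral_nonneg (by linarith [H.hτ i]) fun s _ => ?_
  exact gg_nonneg (YY_pos H.xbpos (H.pos s) _).le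

lemma Ctx.V_cont (H : Ctx y y' k τ τm xb x M) : Continuous (VV y k τ xb x) := by
  unfold VV
  refine (continuous_finsetSum _ fun j _ => ?_).add (continuous_finsetSum _ fun i _ => ?_)
  · refine continuous_const.mul (continuous_gg.comp ?_)
    exact ((continuous_apply j).comp H.cont).div_const _
  · refine continuous_const.mul ?_
    exact continuous_iff_continuousAt.2 fun t =>
      (Fl_hasDerivAt H.cont (continuous_gg.comp (continuous_YY xb (y i))) τ i t).continuousAt

lemma Ctx.M_nonneg (H : Ctx y y' k τ τm xb x M) (j : Fin n) : 0 < M :=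
  (H.pos 0 j).trans_le (H.bdd 0 j)

lemma Ctx.Y_bdd (H : Ctx y y' k τ τm xb x M) : ∃ B : ℝ, 0 < B ∧ ∀ i t,
    YY xb (x t) (y i) ≤ B ∧ YY xb (x t) (y' i) ≤ B := by
  have h : ∀ η : Fin n → ℕ, ∀ t, YY xb (x t) η ≤ ∏ j, (M / xb j) ^ η j := by
    intro η t
    unfold YY mono
    refine Finset.prod_le_prod (fun j _ => pow_nonneg (div_pos (H.pos t j) (H.xbpos j)).le _) fun j _ => ?_
    exact pow_le_pow_left₀ (div_pos (H.pos t j) (H.xbpos j)).le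
      (div_le_div_of_nonneg_right (H.bdd t j) (H.xbpos j).le) _
  have hp : ∀ η : Fin n → ℕ, 0 ≤ ∏ j, (M / xb j) ^ η j := fun η =>
    Finset.prod_nonneg fun j _ => pow_nonneg (div_pos (H.M_nonneg j) (H.xbpos j)).le _
  refine ⟨∑ i, (∏ j, (M / xb j) ^ y i j) + ∑ i, (∏ j, (M / xb j) ^ y' i j) + 1, ?_, fun i t => ⟨?_, ?_⟩⟩
  · have := Finset.sum_nonneg fun i (_ : i ∈ univ) => hp (y i)
    have := Finset.sum_nonneg fun i (_ : i ∈ univ) => hp (y' i)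
    linarith
  · have h1 := Finset.single_le_sum (fun i (_ : i ∈ univ) => hp (y i)) (mem_univ i)
    have := Finset.sum_nonneg fun i (_ : i ∈ univ) => hp (y' i)
    linarith [h (y i) t]
  · have h1 := Finset.single_le_sum (fun i (_ : i ∈ univ) => hp (y' i)) (mem_univ i)
    have := Finset.sum_nonneg fun i (_ : i ∈ univ) => hp (y i)
    linarith [h (y' i) t]

/-- the derivative in terms of imbalances -/
lemma Ctx.der' (H : Ctx y y' k τ τm xb x M) {t : ℝ} (ht : 0 < t) (j) :
    HasDerivAt (fun s => x s j) (∑ i, kap k xb y i * (YY xb (x (t - τ i)) (y i)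
      - YY xb (x t) (y' i)) * (y' i j : ℝ)) t := by
  refine (H.der t ht j).congr_deriv ?_
  have e2 := H.bal (fun η => YY xb (x t) η * (η j : ℝ))
  rw [← sub_eq_zero, ← Finset.sum_sub_distrib] at e2 ⊢
  rw [← e2]
  refine Finset.sum_congr rfl fun i _ => ?_
  have a1 := kap_mul (u := x (t - τ i)) H.xbpos k y i
  have a2 := kap_mul (u := x t) H.xbpos k y i
  linear_combination (y' i j : ℝ) * a1 - (y i j : ℝ) * a2

lemma Ctx.DD_nonneg (H : Ctx y y' k τ τm xb x M) (t : ℝ) : 0 ≤ DD y y' k τ xb x t :=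
  Finset.sum_nonneg fun i _ => mul_nonneg (H.kp i).le
    (ff_nonneg (YY_pos H.xbpos (H.pos _) _).le (YY_pos H.xbpos (H.pos _) _))

lemma Ctx.delta_sq (H : Ctx y y' k τ τm xb x M) : ∃ A : ℝ, 0 < A ∧ ∀ t i,
    (YY xb (x (t - τ i)) (y i) - YY xb (x t) (y' i)) ^ 2 ≤ A * DD y y' k τ xb x t := by
  obtain ⟨B, hB, hb⟩ := H.Y_bdd
  have hpos : ∀ i, 0 < 1 / kap k xb y i := fun i => one_div_pos.2 (H.kp i)
  refine ⟨4 * B * (∑ i, 1 / kap k xb y i + 1), ?_, fun t i => ?_⟩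
  · have := Finset.sum_nonneg fun i (_ : i ∈ univ) => (hpos i).le
    positivity
  · have h1 := ff_sq (YY_pos H.xbpos (H.pos (t - τ i)) (y i)).le (YY_pos H.xbpos (H.pos t) (y' i))
      (hb i (t - τ i)).1 (hb i t).2
    have hf := ff_nonneg (YY_pos H.xbpos (H.pos (t - τ i)) (y i)).le (YY_pos H.xbpos (H.pos t) (y' i))
    have h2 : kap k xb y i * ff (YY xb (x (t - τ i)) (y i)) (YY xb (x t) (y' i)) ≤ DD y y' k τ xb x t :=
      Finset.single_le_sum (f := fun i => kap k xb y i * ff (YY xb (x (t - τ i)) (y i)) (YY xb (x t) (y' i)))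
        (fun i _ => mul_nonneg (H.kp i).le
        (ff_nonneg (YY_pos H.xbpos (H.pos (t - τ i)) (y i)).le (YY_pos H.xbpos (H.pos t) (y' i)))) (mem_univ i)
    have h3 : 1 / kap k xb y i ≤ ∑ i, 1 / kap k xb y i + 1 := by
      have := Finset.single_le_sum (fun i (_ : i ∈ univ) => (hpos i).le) (mem_univ i)
      linarith
    have h4 : ff (YY xb (x (t - τ i)) (y i)) (YY xb (x t) (y' i)) ≤ 1 / kap k xb y i * DD y y' k τ xb x t := by
      rw [one_div, inv_mul_eq_div, le_div_iff₀ (H.kp i)]; linarith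
    have h5 := mul_le_mul_of_nonneg_right h3 (H.DD_nonneg t)
    calc _ ≤ _ := h1
      _ ≤ 4 * B * ((∑ i, 1 / kap k xb y i + 1) * DD y y' k τ xb x t) :=
        mul_le_mul_of_nonneg_left (h4.trans h5) (by positivity)
      _ = _ := by ring
end

section
variable {y y' : Fin r → Fin n → ℕ} {k τ : Fin r → ℝ} {τm : ℝ} {xb : Fin n → ℝ}
    {x : ℝ → Fin n → ℝ} {M : ℝ}

lemma Ctx.dx_sq (H : Ctx y y' k τ τm xb x M) : ∃ A : ℝ, 0 < A ∧ ∀ t > 0, ∀ j, ∃ d,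
    HasDerivAt (fun s => x s j) d t ∧ d ^ 2 ≤ A * DD y y' k τ xb x t := by
  obtain ⟨A, hA, hd⟩ := H.delta_sq
  set c : Fin n → ℝ := fun j => ∑ i, (kap k xb y i * (y' i j : ℝ)) ^ 2 with hc
  have hc0 : ∀ j, 0 ≤ c j := fun j => Finset.sum_nonneg fun i _ => sq_nonneg _
  have hC : 0 ≤ ∑ j, c j := Finset.sum_nonneg fun j _ => hc0 j
  refine ⟨(∑ j, c j + 1) * (r + 1) * A, by positivity, fun t ht j => ⟨_, H.der' ht j, ?_⟩⟩
  have h1 : (∑ i, kap k xb y i * (YY xb (x (t - τ i)) (y i)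
      - YY xb (x t) (y' i)) * (y' i j : ℝ)) ^ 2 ≤ c j * ∑ i, (YY xb (x (t - τ i)) (y i)
      - YY xb (x t) (y' i)) ^ 2 := by
    have := Finset.sum_mul_sq_le_sq_mul_sq univ (fun i => kap k xb y i * (y' i j : ℝ))
      (fun i => YY xb (x (t - τ i)) (y i) - YY xb (x t) (y' i))
    refine le_trans (le_of_eq ?_) this
    congr 1
    exact Finset.sum_congr rfl fun i _ => by ring
  have h2 : ∑ i, (YY xb (x (t - τ i)) (y i) - YY xb (x t) (y' i)) ^ 2
      ≤ (r : ℝ) * (A * DD y y' k τ xb x t) := by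
    have := Finset.sum_le_card_nsmul univ (fun i => (YY xb (x (t - τ i)) (y i) - YY xb (x t) (y' i)) ^ 2)
      _ (fun i _ => hd t i)
    simpa using this
  have h3 : c j ≤ ∑ j, c j + 1 := by
    have := Finset.single_le_sum (fun j (_ : j ∈ univ) => hc0 j) (mem_univ j)
    linarith
  have hD := H.DD_nonneg t
  calc _ ≤ _ := h1
    _ ≤ (∑ j, c j + 1) * ((r : ℝ) * (A * DD y y' k τ xb x t)) :=
      mul_le_mul h3 h2 (Finset.sum_nonneg fun i _ => sq_nonneg _) (by positivity)
    _ ≤ (∑ j, c j + 1) * (((r : ℝ) + 1) * (A * DD y y' k τ xb x t)) := by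
      gcongr; linarith
    _ = _ := by ring

lemma Ctx.incr (H : Ctx y y' k τ τm xb x M) : ∃ A : ℝ, 0 < A ∧ ∀ s t, 0 < s → s ≤ t → ∀ j,
    (x t j - x s j) ^ 2 ≤ A * (t - s) * (VV y k τ xb x s - VV y k τ xb x t) := by
  obtain ⟨A, hA, hd⟩ := H.dx_sq
  refine ⟨A, hA, fun s t hs hst j => ?_⟩
  set V := VV y k τ xb x
  have key : ∀ σ : ℝ, σ ^ 2 = 1 → ∀ l > 0, σ * (x t j - x s j) ≤ l * (t - s) + A * (V s - V t) / (4 * l) := by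
    intro σ hσ l hl
    have hanti : AntitoneOn (fun u => σ * x u j - l * u + A * V u / (4 * l)) (Set.Icc s t) := by
      have hder : ∀ u ∈ Set.Icc s t, ∃ e, e ≤ 0 ∧
          HasDerivAt (fun u => σ * x u j - l * u + A * V u / (4 * l)) e u := by
        intro u hu
        obtain ⟨d, hd1, hd2⟩ := hd u (hs.trans_le hu.1) j
        refine ⟨_, ?_, ((hd1.const_mul σ).sub ((hasDerivAt_id u).const_mul l)).add
          (((H.V_deriv (hs.trans_le hu.1)).const_mul A).div_const (4 * l))⟩
        have h3 : d ^ 2 / (4 * l) ≤ A * DD y y' k τ xb x u / (4 * l) := by gcongr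
        have h4 : σ * d - l * 1 - d ^ 2 / (4 * l) ≤ 0 := by
          have : σ * d - l * 1 - d ^ 2 / (4 * l) = - (2 * l * σ - d) ^ 2 / (4 * l) := by
            field_simp
            linear_combination 4 * l ^ 2 * hσ
          rw [this, neg_div]
          have : 0 ≤ (2 * l * σ - d) ^ 2 / (4 * l) := by positivity
          linarith
        rw [mul_neg, neg_div]
        linarith
      refine antitoneOn_of_deriv_nonpos (convex_Icc s t) ?_ ?_ ?_
      · intro u hu
        obtain ⟨e, _, h⟩ := hder u hu
        exact h.continuousAt.continuousWithinAt
      · intro u hu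
        obtain ⟨e, _, h⟩ := hder u (interior_subset hu)
        exact h.differentiableAt.differentiableWithinAt
      · intro u hu
        obtain ⟨e, h0, h⟩ := hder u (interior_subset hu)
        rw [h.deriv]; exact h0
    have h := hanti (Set.left_mem_Icc.2 hst) (Set.right_mem_Icc.2 hst) hst
    simp only at h
    have : A * (V s - V t) / (4 * l) = A * V s / (4 * l) - A * V t / (4 * l) := by ring
    rw [this]; linarith
  rcases hst.eq_or_lt with rfl | hlt
  · simp
  have hP : 0 < t - s := by linarith
  have habs : ∀ l > 0, |x t j - x s j| ≤ l * (t - s) + A * (V s - V t) / (4 * l) := by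
    intro l hl
    rcases abs_choice (x t j - x s j) with h | h <;> rw [h]
    · have := key 1 (by norm_num) l hl; linarith
    · have := key (-1) (by norm_num) l hl; linarith
  set a := |x t j - x s j|
  have ha : 0 ≤ a := abs_nonneg _
  rw [← sq_abs]
  change a ^ 2 ≤ _
  rcases ha.eq_or_lt with h0 | h0
  · have hV : V t ≤ V s := by
      have : AntitoneOn V (Set.Icc s t) := by
        refine antitoneOn_of_deriv_nonpos (convex_Icc s t) H.V_cont.continuousOn ?_ ?_
        · intro u hu
          exact (H.V_deriv (hs.trans_le (interior_subset hu).1)).differentiableAt.differentiableWithinAt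
        · intro u hu
          rw [(H.V_deriv (hs.trans_le (interior_subset hu).1)).deriv]
          linarith [H.DD_nonneg u]
      exact this (Set.left_mem_Icc.2 hst) (Set.right_mem_Icc.2 hst) hst
    rw [← h0]
    have : 0 ≤ V s - V t := by linarith
    simp only [ne_eq, OfNat.ofNat_ne_zero, not_false_eq_true, zero_pow]
    positivity
  · have h := habs (a / (2 * (t - s))) (by positivity)
    have e1 : a / (2 * (t - s)) * (t - s) = a / 2 := by field_simp
    have e2 : A * (V s - V t) / (4 * (a / (2 * (t - s)))) = A * (t - s) * (V s - V t) / (2 * a) := by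
      field_simp; ring
    rw [e1, e2] at h
    have h2 : a / 2 ≤ A * (t - s) * (V s - V t) / (2 * a) := by linarith
    rw [le_div_iff₀ (by positivity)] at h2
    nlinarith

lemma Ctx.V_anti (H : Ctx y y' k τ τm xb x M) {s t : ℝ} (hs : 0 < s) (hst : s ≤ t) :
    VV y k τ xb x t ≤ VV y k τ xb x s := by
  have : AntitoneOn (VV y k τ xb x) (Set.Icc s t) := by
    refine antitoneOn_of_deriv_nonpos (convex_Icc s t) H.V_cont.continuousOn ?_ ?_
    · intro u hu
      exact (H.V_deriv (hs.trans_le (interior_subset hu).1)).differentiableAt.differentiableWithinAt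
    · intro u hu
      rw [(H.V_deriv (hs.trans_le (interior_subset hu).1)).deriv]
      linarith [H.DD_nonneg u]
  exact this (Set.left_mem_Icc.2 hst) (Set.right_mem_Icc.2 hst) hst

lemma Ctx.V_lim (H : Ctx y y' k τ τm xb x M) : ∃ v, Tendsto (VV y k τ xb x) atTop (nhds v) ∧
    ∀ t > 0, v ≤ VV y k τ xb x t := by
  set V := VV y k τ xb x
  have hA : Antitone (fun t => V (max t 1)) := fun a b hab =>
    H.V_anti (lt_max_of_lt_right one_pos) (max_le_max_right 1 hab)
  have hB : BddBelow (Set.range fun t => V (max t 1)) := ⟨0, by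
    rintro _ ⟨t, rfl⟩; exact H.V_nonneg _⟩
  have ht := tendsto_atTop_ciInf hA hB
  have h2 : Tendsto V atTop (nhds (⨅ t, V (max t 1))) := by
    refine ht.congr' ?_
    filter_upwards [eventually_ge_atTop 1] with t ht
    rw [max_eq_left ht]
  refine ⟨_, h2, fun t ht => ?_⟩
  refine le_of_tendsto h2 ?_
  filter_upwards [eventually_ge_atTop t] with s hs
  exact H.V_anti ht hs

lemma Ctx.V_diff (H : Ctx y y' k τ τm xb x M) (T : ℝ) :
    Tendsto (fun t => VV y k τ xb x (t - T) - VV y k τ xb x t) atTop (nhds 0) := by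
  obtain ⟨v, hv, _⟩ := H.V_lim
  have : Tendsto (fun t : ℝ => t - T) atTop atTop := tendsto_atTop_add_const_right _ _ tendsto_id
  simpa using (hv.comp this).sub hv

lemma Ctx.window (H : Ctx y y' k τ τm xb x M) {T : ℝ} (hT : 0 ≤ T) {ε : ℝ} (hε : 0 < ε) :
    ∀ᶠ t in atTop, ∀ s ∈ Set.Icc (t - T) t, ∀ j, |x s j - x t j| < ε := by
  obtain ⟨A, hA, h⟩ := H.incr
  have h1 := (H.V_diff T).const_mul (A * T)
  rw [mul_zero] at h1
  have h2 : ∀ᶠ t in atTop, A * T * (VV y k τ xb x (t - T) - VV y k τ xb x t) < ε ^ 2 :=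
    h1.eventually_lt_const (by positivity)
  filter_upwards [h2, eventually_gt_atTop T] with t ht htT s hs j
  have hs0 : 0 < s := by linarith [hs.1]
  have h3 := h s t hs0 hs.2 j
  have hV1 := H.V_anti (s := t - T) (t := s) (by linarith) hs.1
  have hV2 := H.V_anti hs0 hs.2
  have h4 : A * (t - s) * (VV y k τ xb x s - VV y k τ xb x t) ≤
      A * T * (VV y k τ xb x (t - T) - VV y k τ xb x t) := by
    refine mul_le_mul ?_ (by linarith) (by linarith) (by positivity)
    gcongr; linarith [hs.1]
  rw [abs_sub_comm]
  exact abs_lt_of_sq_lt_sq (by linarith) hε.le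

def Om (x : ℝ → Fin n → ℝ) (θ : Fin n → ℝ) : Prop :=
  ∃ T : ℕ → ℝ, Tendsto T atTop atTop ∧ Tendsto (fun N => x (T N)) atTop (nhds θ)

lemma Ctx.window_seq (H : Ctx y y' k τ τm xb x M) {θ : Fin n → ℝ} {T S : ℕ → ℝ}
    (hT : Tendsto T atTop atTop) (hx : Tendsto (fun N => x (T N)) atTop (nhds θ)) {c : ℝ} (hc : 0 ≤ c)
    (hS : ∀ N, S N ∈ Set.Icc (T N - c) (T N)) : Tendsto (fun N => x (S N)) atTop (nhds θ) := by
  rw [tendsto_pi_nhds] at hx ⊢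
  intro j
  have h0 : Tendsto (fun N => x (S N) j - x (T N) j) atTop (nhds 0) := by
    rw [Metric.tendsto_nhds]
    intro ε hε
    filter_upwards [hT.eventually (H.window hc hε)] with N hN
    rw [Real.dist_0_eq_abs]
    exact hN _ (hS N) j
  simpa using h0.add (hx j)

lemma Ctx.Fl_lim (H : Ctx y y' k τ τm xb x M) {θ : Fin n → ℝ} {T : ℕ → ℝ}
    (hT : Tendsto T atTop atTop) (hx : Tendsto (fun N => x (T N)) atTop (nhds θ))
    {φ : (Fin n → ℝ) → ℝ} (hφ : Continuous φ) (i : Fin r) :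
    Tendsto (fun N => Fl τ x φ i (T N)) atTop (nhds (τ i * φ θ)) := by
  rw [Metric.tendsto_nhds]
  intro ε hε
  have hε' : 0 < ε / (τ i + 1) := div_pos hε (by linarith [H.hτ i])
  obtain ⟨δ, hδ, hd⟩ := Metric.continuousAt_iff.1 (hφ.continuousAt (x := θ)) _ hε'
  rw [Metric.tendsto_nhds] at hx
  filter_upwards [hT.eventually (H.window (H.hτ i) (half_pos hδ)), hx _ (half_pos hδ)] with N h1 h2
  have hc : Continuous fun s => φ (x s) := hφ.comp H.cont
  have e : Fl τ x φ i (T N) - τ i * φ θ = ∫ s in (T N - τ i)..T N, (φ (x s) - φ θ) := by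
    rw [intervalIntegral.integral_sub (hc.intervalIntegrable _ _) (by simp)]
    simp [Fl]
  rw [Real.dist_eq, e]
  have h3 : ∀ s ∈ Set.uIoc (T N - τ i) (T N), ‖φ (x s) - φ θ‖ ≤ ε / (τ i + 1) := by
    intro s hs
    rw [Set.uIoc_of_le (by linarith [H.hτ i])] at hs
    have h4 : dist (x s) (x (T N)) < δ / 2 := by
      rw [dist_pi_lt_iff (half_pos hδ)]
      intro j
      rw [Real.dist_eq]
      exact h1 s ⟨hs.1.le, hs.2⟩ j
    have h5 : dist (x s) θ < δ := by
      have := dist_triangle (x s) (x (T N)) θ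
      linarith
    have := (hd h5).le
    rwa [Real.dist_eq] at this
  have h4 := intervalIntegral.norm_integral_le_of_norm_le_const h3
  rw [Real.norm_eq_abs] at h4
  refine h4.trans_lt ?_
  have e2 : |T N - (T N - τ i)| = τ i := by rw [sub_sub_cancel, abs_of_nonneg (H.hτ i)]
  rw [e2, div_mul_eq_mul_div, div_lt_iff₀ (by linarith [H.hτ i])]
  nlinarith [H.hτ i]

lemma Ctx.Om_nonneg (H : Ctx y y' k τ τm xb x M) {θ : Fin n → ℝ} (h : Om x θ) (j) : 0 ≤ θ j := by
  obtain ⟨T, _, h⟩ := h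
  exact ge_of_tendsto' (tendsto_pi_nhds.1 h j) fun N => (H.pos _ j).le

lemma Ctx.Om_eq (H : Ctx y y' k τ τm xb x M) {θ : Fin n → ℝ} (h : Om x θ) (i) :
    YY xb θ (y i) = YY xb θ (y' i) := by
  obtain ⟨T, hT, hx⟩ := h
  obtain ⟨A, hA, hd⟩ := H.delta_sq
  have hmv : ∀ t : ℝ, ∃ s, s ∈ Set.Icc (t - 1) t ∧ (1 < t → DD y y' k τ xb x s =
      VV y k τ xb x (t - 1) - VV y k τ xb x t) := by
    intro t
    by_cases ht : 1 < t
    · obtain ⟨s, hs, he⟩ := exists_hasDerivAt_eq_slope (VV y k τ xb x) (fun u => -(DD y y' k τ xb x u))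
        (show t - 1 < t by linarith) H.V_cont.continuousOn (fun u hu => H.V_deriv (by linarith [hu.1]))
      refine ⟨s, ⟨hs.1.le, hs.2.le⟩, fun _ => ?_⟩
      simp at he
      linarith
    · exact ⟨t, ⟨by linarith, le_rfl⟩, fun h => absurd h ht⟩
  choose S hS hSD using hmv
  have h1 : Tendsto (fun N => x (S (T N))) atTop (nhds θ) :=
    H.window_seq hT hx zero_le_one fun N => hS _
  have h2 : Tendsto (fun N => x (S (T N) - τ i)) atTop (nhds θ) :=
    H.window_seq hT hx (c := 1 + τ i) (by linarith [H.hτ i]) fun N =>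
      ⟨by linarith [(hS (T N)).1], by linarith [(hS (T N)).2, H.hτ i]⟩
  have h3 := ((((continuous_YY xb (y i)).tendsto θ).comp h2).sub
    (((continuous_YY xb (y' i)).tendsto θ).comp h1)).pow 2
  have h4 := ((H.V_diff 1).comp hT).const_mul A
  rw [mul_zero] at h4
  have h5 := le_of_tendsto_of_tendsto h3 h4 (by
    filter_upwards [hT.eventually_gt_atTop 1] with N hN
    have := hd (S (T N)) i
    rw [hSD _ hN] at this
    exact this)
  have : YY xb θ (y i) - YY xb θ (y' i) = 0 := by
    apply pow_eq_zero_iff (n := 2) (by norm_num) |>.1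
    exact le_antisymm h5 (sq_nonneg _)
  linarith

noncomputable def Vst (y : Fin r → Fin n → ℕ) (k τ : Fin r → ℝ) (xb θ : Fin n → ℝ) : ℝ :=
  ∑ j, xb j * gg (θ j / xb j) + ∑ i, kap k xb y i * (τ i * gg (YY xb θ (y i)))

lemma Ctx.Om_V (H : Ctx y y' k τ τm xb x M) {θ : Fin n → ℝ} (h : Om x θ) {v : ℝ}
    (hv : Tendsto (VV y k τ xb x) atTop (nhds v)) : Vst y k τ xb θ = v := by
  obtain ⟨T, hT, hx⟩ := h
  refine tendsto_nhds_unique ?_ (hv.comp hT)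
  refine Tendsto.add (tendsto_finsetSum _ fun j _ => ?_) (tendsto_finsetSum _ fun i _ => ?_)
  · refine Tendsto.const_mul _ ((continuous_gg.tendsto _).comp ?_)
    exact (tendsto_pi_nhds.1 hx j).div_const _
  · exact (H.Fl_lim hT hx (continuous_gg.comp (continuous_YY xb (y i))) i).const_mul _

noncomputable def zz (y y' : Fin r → Fin n → ℕ) (k τ : Fin r → ℝ) (xb : Fin n → ℝ) (x : ℝ → Fin n → ℝ)
    (t : ℝ) (j : Fin n) : ℝ :=
  x t j + ∑ i, kap k xb y i * Fl τ x (fun u => YY xb u (y i)) i t * (y' i j : ℝ)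

noncomputable def FF (y y' : Fin r → Fin n → ℕ) (k τ : Fin r → ℝ) (xb θ : Fin n → ℝ) (j : Fin n) : ℝ :=
  θ j + ∑ i, kap k xb y i * (τ i * YY xb θ (y i)) * (y' i j : ℝ)

lemma Ctx.z_deriv (H : Ctx y y' k τ τm xb x M) {t : ℝ} (ht : 0 < t) (j) :
    HasDerivAt (fun s => zz y y' k τ xb x s j)
      (∑ i, kap k xb y i * YY xb (x t) (y i) * ((y' i j : ℝ) - y i j)) t := by
  have h := (H.der t ht j).add (HasDerivAt.fun_sum (u := univ) fun i _ =>
    ((Fl_hasDerivAt H.cont (continuous_YY xb (y i)) τ i t).const_mul (kap k xb y i)).mul_const (y' i j : ℝ))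
  refine h.congr_deriv ?_
  rw [← Finset.sum_add_distrib]
  refine Finset.sum_congr rfl fun i _ => ?_
  have a1 := kap_mul (u := x (t - τ i)) H.xbpos k y i
  have a2 := kap_mul (u := x t) H.xbpos k y i
  linear_combination (y' i j : ℝ) * a1 - (y i j : ℝ) * a2

lemma Ctx.z_lim (H : Ctx y y' k τ τm xb x M) {θ : Fin n → ℝ} {T : ℕ → ℝ}
    (hT : Tendsto T atTop atTop) (hx : Tendsto (fun N => x (T N)) atTop (nhds θ)) (j) :
    Tendsto (fun N => zz y y' k τ xb x (T N) j) atTop (nhds (FF y y' k τ xb θ j)) := by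
  refine (tendsto_pi_nhds.1 hx j).add (tendsto_finsetSum _ fun i _ => ?_)
  exact ((H.Fl_lim hT hx (continuous_YY xb (y i)) i).const_mul _).mul_const _

lemma Ctx.Fl_nonneg (H : Ctx y y' k τ τm xb x M) (i : Fin r) (t : ℝ) (η) :
    0 ≤ Fl τ x (fun u => YY xb u η) i t :=
  intervalIntegral.integral_nonneg (by linarith [H.hτ i]) fun s _ =>
    (YY_pos H.xbpos (H.pos s) _).le

lemma Ctx.z_ge (H : Ctx y y' k τ τm xb x M) (t : ℝ) (j) : x t j ≤ zz y y' k τ xb x t j := by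
  have : 0 ≤ ∑ i, kap k xb y i * Fl τ x (fun u => YY xb u (y i)) i t * (y' i j : ℝ) :=
    Finset.sum_nonneg fun i _ => mul_nonneg (mul_nonneg (H.kp i).le (H.Fl_nonneg i t _)) (Nat.cast_nonneg _)
  unfold zz; linarith

lemma Ctx.z_pos (H : Ctx y y' k τ τm xb x M) (t : ℝ) (j) : 0 < zz y y' k τ xb x t j :=
  (H.pos t j).trans_le (H.z_ge t j)

noncomputable def JJ (y : Fin r → Fin n → ℕ) (xb : Fin n → ℝ) (x : ℝ → Fin n → ℝ) (s t : ℝ) (i : Fin r) : ℝ :=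
  ∫ u in s..t, YY xb (x u) (y i)

lemma Ctx.Yc (H : Ctx y y' k τ τm xb x M) (η) : Continuous fun u => YY xb (x u) η :=
  (continuous_YY xb η).comp H.cont

lemma Ctx.z_diff (H : Ctx y y' k τ τm xb x M) {s t : ℝ} (hs : 0 < s) (ht : 0 < t) (j) :
    zz y y' k τ xb x t j - zz y y' k τ xb x s j =
      ∑ i, kap k xb y i * JJ y xb x s t i * ((y' i j : ℝ) - y i j) := by
  have hc : ∀ i, Continuous fun u => kap k xb y i * YY xb (x u) (y i) * ((y' i j : ℝ) - y i j) :=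
    fun i => (continuous_const.mul (H.Yc _)).mul continuous_const
  rw [← intervalIntegral.integral_eq_sub_of_hasDerivAt (f := fun s => zz y y' k τ xb x s j)
    (fun u hu => H.z_deriv ?_ j) ((continuous_finsetSum _ fun i _ => hc i).intervalIntegrable _ _)]
  · rw [intervalIntegral.integral_finsetSum fun i _ => (hc i).intervalIntegrable _ _]
    refine Finset.sum_congr rfl fun i _ => ?_
    rw [intervalIntegral.integral_mul_const, intervalIntegral.integral_const_mul, JJ]
  · have := hu.1
    exact (lt_min hs ht).trans_le this

lemma Ctx.L8 (H : Ctx y y' k τ τm xb x M) {θ θ' : Fin n → ℝ} (h : Om x θ) (h' : Om x θ')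
    (hz : ∀ j, θ j = 0 → θ' j = 0)
    (hμ : 0 ≤ ∑ j, Real.log (θ j / xb j) * (FF y y' k τ xb θ' j - FF y y' k τ xb θ j)) : θ' = θ := by
  obtain ⟨v, hv, _⟩ := H.V_lim
  have hV : Vst y k τ xb θ' - Vst y k τ xb θ = 0 := by rw [H.Om_V h hv, H.Om_V h' hv, sub_self]
  set μ : Fin n → ℝ := fun j => Real.log (θ j / xb j) with hμd
  set a : Fin n → ℝ := fun j => xb j * gg (θ' j / xb j) - xb j * gg (θ j / xb j) - μ j * (θ' j - θ j) with ha
  set b : Fin r → ℝ := fun i => kap k xb y i * (τ i * gg (YY xb θ' (y i))) -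
    kap k xb y i * (τ i * gg (YY xb θ (y i))) -
    kap k xb y i * (τ i * (YY xb θ' (y i) - YY xb θ (y i))) * ∑ j, μ j * y' i j with hb
  have ha1 : ∀ j, θ j ≠ 0 → a j = ff (θ' j) (θ j) := by
    intro j hj
    have h1 := (H.xbpos j)
    have h2 : 0 < θ j := lt_of_le_of_ne (H.Om_nonneg h j) (Ne.symm hj)
    rcases (H.Om_nonneg h' j).eq_or_lt with h3 | h3
    · simp only [a, μ, ← h3, gg, ff]
      rw [Real.log_div h2.ne' h1.ne']
      simp
      field_simp
      ring
    · simp only [a, μ, gg, ff]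
      rw [Real.log_div h2.ne' h1.ne', Real.log_div h3.ne' h1.ne']
      field_simp
      ring
  have ha0 : ∀ j, 0 ≤ a j := by
    intro j
    by_cases hj : θ j = 0
    · simp [a, hj, hz j hj]
    · rw [ha1 j hj]
      exact ff_nonneg (H.Om_nonneg h' j) (lt_of_le_of_ne (H.Om_nonneg h j) (Ne.symm hj))
  have hb0 : ∀ i, 0 ≤ b i := by
    intro i
    by_cases hi : YY xb θ (y i) = 0
    · have : YY xb θ' (y i) = 0 := by
        rw [YY_eq_zero H.xbpos] at hi ⊢
        obtain ⟨j, h1, h2⟩ := hi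
        exact ⟨j, hz j h1, h2⟩
      simp [b, hi, this]
    · have h1 : 0 < YY xb θ (y i) := lt_of_le_of_ne (YY_nonneg H.xbpos (H.Om_nonneg h) _) (Ne.symm hi)
      have h2 : ∑ j, μ j * y' i j = Real.log (YY xb θ (y i)) := by
        have hi' := hi
        rw [H.Om_eq h i] at hi' ⊢
        rw [log_YY H.xbpos]
        intro j hj
        refine lt_of_le_of_ne (H.Om_nonneg h j) fun h0 => hi' ?_
        rw [YY_eq_zero H.xbpos]
        exact ⟨j, h0.symm, hj⟩
      have h3 : b i = kap k xb y i * (τ i * ff (YY xb θ' (y i)) (YY xb θ (y i))) := by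
        simp only [b, h2, gg, ff]; ring
      rw [h3]
      exact mul_nonneg (H.kp i).le (mul_nonneg (H.hτ i) (ff_nonneg (YY_nonneg H.xbpos (H.Om_nonneg h') _) h1))
  have hsum : ∑ j, a j + ∑ i, b i = - ∑ j, μ j * (FF y y' k τ xb θ' j - FF y y' k τ xb θ j) := by
    have e1 : ∑ j, μ j * (FF y y' k τ xb θ' j - FF y y' k τ xb θ j) = ∑ j, μ j * (θ' j - θ j) +
        ∑ i, kap k xb y i * (τ i * (YY xb θ' (y i) - YY xb θ (y i))) * ∑ j, μ j * y' i j := by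
      simp_rw [Finset.mul_sum]
      rw [Finset.sum_comm (s := univ (α := Fin r)), ← Finset.sum_add_distrib]
      refine Finset.sum_congr rfl fun j _ => ?_
      unfold FF
      rw [show ∀ p q u v : ℝ, (p + q - (u + v)) = (p - u) + (q - v) by intros; ring,
        ← Finset.sum_sub_distrib, mul_add, Finset.mul_sum]
      congr 1
      exact Finset.sum_congr rfl fun i _ => by ring
    rw [e1]
    simp only [a, b, Finset.sum_sub_distrib]
    unfold Vst at hV
    linear_combination hV
  have hA : ∑ j, a j ≤ 0 := by
    have := Finset.sum_nonneg fun i (_ : i ∈ univ) => hb0 i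
    linarith
  funext j
  by_cases hj : θ j = 0
  · rw [hj, hz j hj]
  · have h1 := Finset.single_le_sum (fun j (_ : j ∈ univ) => ha0 j) (mem_univ j)
    rw [ha1 j hj] at h1
    exact ff_eq_zero (H.Om_nonneg h' j) (lt_of_le_of_ne (H.Om_nonneg h j) (Ne.symm hj)) (h1.trans hA)
end

section
variable {y y' : Fin r → Fin n → ℕ} {k τ : Fin r → ℝ} {τm : ℝ} {xb : Fin n → ℝ}
    {x : ℝ → Fin n → ℝ} {M : ℝ}

lemma Ctx.subseq (H : Ctx y y' k τ τm xb x M) (T : ℕ → ℝ) :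
    ∃ θ, ∃ φ : ℕ → ℕ, StrictMono φ ∧ Tendsto (fun N => x (T (φ N))) atTop (nhds θ) := by
  obtain ⟨θ, _, φ, hφ, h⟩ := (isCompact_Icc (a := (fun _ => 0 : Fin n → ℝ)) (b := fun _ => M)).tendsto_subseq
    (x := fun N => x (T N)) (fun N => ⟨fun j => (H.pos _ j).le, fun j => H.bdd _ j⟩)
  exact ⟨θ, φ, hφ, h⟩

lemma Ctx.pos_end (H : Ctx y y' k τ τm xb x M) (h : ∀ θ, Om x θ → ∀ j, 0 < θ j) (j) :
    ∃ c > 0, ∀ᶠ t in atTop, c ≤ x t j := by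
  by_contra hc
  push Not at hc
  have h1 : ∀ N : ℕ, ∃ t : ℝ, (N : ℝ) ≤ t ∧ x t j < 1 / ((N : ℝ) + 1) := by
    intro N
    have := hc (1 / ((N : ℝ) + 1)) (by positivity)
    obtain ⟨t, h1, h2⟩ := (Frequently.and_eventually this (eventually_ge_atTop (N : ℝ))).exists
    exact ⟨t, h2, h1⟩
  choose T hT1 hT2 using h1
  have hT : Tendsto T atTop atTop := tendsto_atTop_mono hT1 tendsto_natCast_atTop_atTop
  obtain ⟨θ, φ, hφ, hx⟩ := H.subseq T
  have h2 := h θ ⟨fun N => T (φ N), hT.comp hφ.tendsto_atTop, hx⟩ j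
  have h3 : θ j ≤ 0 := by
    refine le_of_tendsto_of_tendsto (tendsto_pi_nhds.1 hx j)
      (tendsto_one_div_add_atTop_nhds_zero_nat.comp hφ.tendsto_atTop) ?_
    exact Eventually.of_forall fun N => (hT2 _).le
  linarith

lemma Ctx.touch (H : Ctx y y' k τ τm xb x M) {θ : Fin n → ℝ} (h : Om x θ) (i) :
    (∃ j, θ j = 0 ∧ y i j ≠ 0) ↔ ∃ j, θ j = 0 ∧ y' i j ≠ 0 := by
  rw [← YY_eq_zero H.xbpos, ← YY_eq_zero H.xbpos, H.Om_eq h i]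

lemma Ctx.FF_zero (H : Ctx y y' k τ τm xb x M) {θ : Fin n → ℝ} (h : Om x θ) {j} (hj : θ j = 0) :
    FF y y' k τ xb θ j = 0 := by
  unfold FF
  rw [hj, zero_add]
  refine Finset.sum_eq_zero fun i _ => ?_
  by_cases hi : y' i j = 0
  · simp [hi]
  · have : YY xb θ (y i) = 0 := by
      rw [H.Om_eq h i, YY_eq_zero H.xbpos]; exact ⟨j, hj, hi⟩
    simp [this]

/-- reactions not touching the zero set are orthogonal to μ -/
lemma Ctx.mu_orth (H : Ctx y y' k τ τm xb x M) {θ : Fin n → ℝ} (h : Om x θ) {i}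
    (hi : ∀ j, θ j = 0 → y i j = 0) :
    ∑ j, Real.log (θ j / xb j) * ((y' i j : ℝ) - y i j) = 0 := by
  have h1 : ∀ j, y i j ≠ 0 → 0 < θ j := fun j hj =>
    lt_of_le_of_ne (H.Om_nonneg h j) fun h0 => hj (hi j h0.symm)
  have h2 : ∀ j, y' i j ≠ 0 → 0 < θ j := fun j hj =>
    lt_of_le_of_ne (H.Om_nonneg h j) fun h0 => by
      obtain ⟨j', a, b⟩ := (H.touch h i).2 ⟨j, h0.symm, hj⟩
      exact b (hi j' a)
  simp_rw [mul_sub]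
  rw [Finset.sum_sub_distrib, ← log_YY H.xbpos _ h1, ← log_YY H.xbpos _ h2, H.Om_eq h i, sub_self]

lemma mem_stoich (R : Finset (Fin r)) {i} (hi : i ∈ R) :
    (fun j => (y' i j : ℝ) - y i j) ∈ stoichOn y y' R :=
  Submodule.subset_span ⟨i, hi, rfl⟩

lemma Ctx.z_sub_mem (H : Ctx y y' k τ τm xb x M) {s t : ℝ} (hs : 0 < s) (ht : 0 < t) :
    (fun j => zz y y' k τ xb x t j - zz y y' k τ xb x s j) ∈ stoichOn y y' univ := by
  have : (fun j => zz y y' k τ xb x t j - zz y y' k τ xb x s j) =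
      ∑ i, (kap k xb y i * JJ y xb x s t i) • (fun j => (y' i j : ℝ) - y i j) := by
    funext j
    rw [H.z_diff hs ht, Finset.sum_apply]
    rfl
  rw [this]
  exact Submodule.sum_mem _ fun i _ => Submodule.smul_mem _ _ (mem_stoich univ (mem_univ i))

lemma Ctx.z_FF_mem (H : Ctx y y' k τ τm xb x M) {θ : Fin n → ℝ} (h : Om x θ) {t : ℝ} (ht : 0 < t) :
    (fun j => zz y y' k τ xb x t j - FF y y' k τ xb θ j) ∈ stoichOn y y' univ := by
  obtain ⟨T, hT, hx⟩ := h
  have hcl : IsClosed (stoichOn y y' univ : Set (Fin n → ℝ)) := Submodule.closed_of_finiteDimensional _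
  refine hcl.mem_of_tendsto (f := fun N j => zz y y' k τ xb x t j - zz y y' k τ xb x (T N) j) (b := atTop) ?_ ?_
  · rw [tendsto_pi_nhds]
    exact fun j => tendsto_const_nhds.sub (H.z_lim hT hx j)
  · filter_upwards [hT.eventually_gt_atTop 0] with N hN
    exact H.z_sub_mem hN ht

lemma Ctx.FF_FF_mem (H : Ctx y y' k τ τm xb x M) {θ θ' : Fin n → ℝ} (h : Om x θ) (h' : Om x θ') :
    (fun j => FF y y' k τ xb θ' j - FF y y' k τ xb θ j) ∈ stoichOn y y' univ := by
  have := Submodule.sub_mem _ (H.z_FF_mem h one_pos) (H.z_FF_mem h' one_pos)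
  convert this using 1
  funext j
  simp

lemma sum_stoich_zero {R : Finset (Fin r)} {c : Fin n → ℝ}
    (hc : ∀ i ∈ R, ∑ j, c j * ((y' i j : ℝ) - y i j) = 0) {v : Fin n → ℝ} (hv : v ∈ stoichOn y y' R) :
    ∑ j, c j * v j = 0 := by
  induction hv using Submodule.span_induction with
  | mem v h => obtain ⟨i, hi, rfl⟩ := h; exact hc i hi
  | zero => simp
  | add u v _ _ hu hv => simp only [Pi.add_apply, mul_add, Finset.sum_add_distrib, hu, hv, add_zero]
  | smul a v _ hv =>
    simp only [Pi.smul_apply, smul_eq_mul]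
    simp_rw [mul_left_comm _ a, ← Finset.mul_sum, hv, mul_zero]

lemma Ctx.pos_unique (H : Ctx y y' k τ τm xb x M) {θ θ' : Fin n → ℝ} (h : Om x θ) (h' : Om x θ')
    (hp : ∀ j, 0 < θ j) : θ' = θ := by
  refine H.L8 h h' (fun j hj => absurd hj (hp j).ne') (ge_of_eq ?_)
  refine sum_stoich_zero (c := fun j => Real.log (θ j / xb j)) (fun i _ => ?_) (H.FF_FF_mem h h')
  exact H.mu_orth h fun j hj => absurd hj (hp j).ne'

/-! discrete monotone lemma -/
lemma L10 {Q : Type*} (R : Finset (Fin r)) (κ : Fin r → ℝ) (hκ : ∀ i, 0 ≤ κ i)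
    (hbal : ∀ φ : (Fin n → ℕ) → ℝ, ∑ i ∈ R, κ i * φ (y' i) = ∑ i ∈ R, κ i * φ (y i))
    (cl : (Fin n → ℕ) → Q) (hcl : ∀ i ∈ R, cl (y' i) = cl (y i))
    (Y G : (Fin n → ℕ) → ℝ) (hY : ∀ η, 0 ≤ Y η)
    (hmon : ∀ i ∈ R, ∀ i' ∈ R, cl (y i) = cl (y i') → G (y i) < G (y i') → Y (y i) ≤ Y (y i')) :
    ∑ i ∈ R, κ i * Y (y i) * (G (y' i) - G (y i)) ≤ 0 := by
  classical
  set t : Q → ℝ → ℝ := fun q g =>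
    (((R.filter fun i => cl (y i) = q ∧ G (y i) < g).sup fun i => (Y (y i)).toNNReal : NNReal) : ℝ) with ht
  have tmono : ∀ q, Monotone (t q) := by
    intro q a b hab
    simp only [t, NNReal.coe_le_coe]
    refine Finset.sup_mono fun i hi => ?_
    rw [Finset.mem_filter] at hi ⊢
    exact ⟨hi.1, hi.2.1, hi.2.2.trans_le hab⟩
  have tint : ∀ q a b, IntervalIntegrable (t q) MeasureTheory.volume a b := fun q a b =>
    (tmono q).intervalIntegrable
  have tlow : ∀ i ∈ R, ∀ g, G (y i) < g → Y (y i) ≤ t (cl (y i)) g := by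
    intro i hi g hg
    have : (Y (y i)).toNNReal ≤ (R.filter fun i' => cl (y i') = cl (y i) ∧ G (y i') < g).sup
        fun i => (Y (y i)).toNNReal :=
      Finset.le_sup (f := fun i => (Y (y i)).toNNReal) (Finset.mem_filter.2 ⟨hi, rfl, hg⟩)
    have h2 := NNReal.coe_le_coe.2 this
    rwa [Real.coe_toNNReal _ (hY _)] at h2
  have tup : ∀ i ∈ R, ∀ g, g ≤ G (y i) → t (cl (y i)) g ≤ Y (y i) := by
    intro i hi g hg
    have : (R.filter fun i' => cl (y i') = cl (y i) ∧ G (y i') < g).sup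
        (fun i => (Y (y i)).toNNReal) ≤ (Y (y i)).toNNReal := by
      refine Finset.sup_le fun i' hi' => ?_
      rw [Finset.mem_filter] at hi'
      exact Real.toNNReal_le_toNNReal (hmon i' hi'.1 i hi hi'.2.1 (hi'.2.2.trans_le hg))
    have h2 := NNReal.coe_le_coe.2 this
    rwa [Real.coe_toNNReal _ (hY _)] at h2
  set φ : (Fin n → ℕ) → ℝ := fun η => ∫ g in (0:ℝ)..G η, t (cl η) g with hφ
  have key : ∀ i ∈ R, Y (y i) * (G (y' i) - G (y i)) ≤ φ (y' i) - φ (y i) := by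
    intro i hi
    have e : φ (y' i) - φ (y i) = ∫ g in (G (y i))..(G (y' i)), t (cl (y i)) g := by
      simp only [φ, hcl i hi]
      rw [intervalIntegral.integral_interval_sub_left (tint _ _ _) (tint _ _ _)]
    rw [e]
    rcases le_total (G (y i)) (G (y' i)) with hle | hle
    · have : ∫ g in (G (y i))..(G (y' i)), Y (y i) ≤ ∫ g in (G (y i))..(G (y' i)), t (cl (y i)) g := by
        refine intervalIntegral.integral_mono_on_of_le_Ioo hle (by simp) (tint _ _ _) fun g hg => ?_
        exact tlow i hi g hg.1
      rw [intervalIntegral.integral_const, smul_eq_mul] at this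
      linarith
    · have : ∫ g in (G (y' i))..(G (y i)), t (cl (y i)) g ≤ ∫ g in (G (y' i))..(G (y i)), Y (y i) := by
        refine intervalIntegral.integral_mono_on_of_le_Ioo hle (tint _ _ _) (by simp) fun g hg => ?_
        exact tup i hi g hg.2.le
      rw [intervalIntegral.integral_const, smul_eq_mul] at this
      rw [intervalIntegral.integral_symm]
      linarith
  calc ∑ i ∈ R, κ i * Y (y i) * (G (y' i) - G (y i)) ≤ ∑ i ∈ R, κ i * (φ (y' i) - φ (y i)) := by
        refine Finset.sum_le_sum fun i hi => ?_
        rw [mul_assoc]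
        exact mul_le_mul_of_nonneg_left (key i hi) (hκ i)
    _ = 0 := by
        simp_rw [mul_sub]
        rw [Finset.sum_sub_distrib, hbal φ, sub_self]

lemma evj {xb θ : Fin n → ℝ} (hxb : ∀ j, 0 < xb j) (_hθ : ∀ j, 0 ≤ θ j) (j : Fin n) (v b : ℝ)
    (h1 : θ j ≠ 0 → b < v * Real.log (θ j / xb j)) (h2 : θ j = 0 → v < 0 ∨ (v = 0 ∧ b ≤ 0)) :
    ∀ᶠ u in nhds θ, 0 < u j → b ≤ v * Real.log (u j / xb j) := by
  have hcont : Tendsto (fun u : Fin n → ℝ => u j / xb j) (nhds θ) (nhds (θ j / xb j)) :=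
    ((continuous_apply j).div_const (xb j)).tendsto θ
  by_cases hj : θ j = 0
  · rcases h2 hj with hv | ⟨hv, hb⟩
    · have h3 : ∀ᶠ u : Fin n → ℝ in nhds θ, u j / xb j < Real.exp (b / v) :=
        hcont.eventually_lt_const (by rw [hj, zero_div]; exact Real.exp_pos _)
      filter_upwards [h3] with u hu hpos
      have h4 : Real.log (u j / xb j) ≤ b / v := by
        have := Real.log_le_log (div_pos hpos (hxb j)) hu.le
        rwa [Real.log_exp] at this
      rw [le_div_iff_of_neg hv] at h4
      linarith
    · exact Eventually.of_forall fun u _ => by rw [hv, zero_mul]; exact hb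
  · have h3 : Tendsto (fun u : Fin n → ℝ => v * Real.log (u j / xb j)) (nhds θ)
        (nhds (v * Real.log (θ j / xb j))) :=
      ((Real.continuousAt_log (div_ne_zero hj (hxb j).ne')).tendsto.comp hcont).const_mul v
    filter_upwards [h3.eventually_const_lt (h1 hj)] with u hu _
    exact hu.le

/-- comparison of monomials near θ -/
lemma ev_mono {xb θ : Fin n → ℝ} (hxb : ∀ j, 0 < xb j) (hθ : ∀ j, 0 ≤ θ j) (η η' : Fin n → ℕ)
    (h0 : ∀ j, θ j = 0 → (η' j : ℝ) - η j ≤ 0)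
    (h : (∃ j, θ j = 0 ∧ (η' j : ℝ) - η j < 0) ∨
      0 < ∑ j, Real.log (θ j / xb j) * ((η' j : ℝ) - η j)) :
    ∀ᶠ u in nhds θ, (∀ j, 0 < u j) → YY xb u η ≤ YY xb u η' := by
  classical
  have main : ∃ b : Fin n → ℝ, 0 ≤ ∑ j, b j ∧ ∀ j,
      (θ j ≠ 0 → b j < ((η' j : ℝ) - η j) * Real.log (θ j / xb j)) ∧
      (θ j = 0 → (η' j : ℝ) - η j < 0 ∨ ((η' j : ℝ) - η j = 0 ∧ b j ≤ 0)) := by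
    rcases h with ⟨j0, hj0, hv⟩ | hS
    · set c : Fin n → ℝ := fun j => ((η' j : ℝ) - η j) * Real.log (θ j / xb j) - 1
      refine ⟨fun j => c j + if j = j0 then |∑ j, c j| else 0, ?_, fun j => ⟨fun hj => ?_, fun hj => ?_⟩⟩
      · rw [Finset.sum_add_distrib]
        simp
        linarith [neg_abs_le (∑ j, c j)]
      · have : j ≠ j0 := fun h => hj (h ▸ hj0)
        simp [this, c]
      · by_cases hjj : j = j0
        · left; rw [hjj]; exact hv
        · rcases (h0 j hj).lt_or_eq with h | h
          · exact Or.inl h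
          · refine Or.inr ⟨h, ?_⟩
            simp [c, hjj, h]
    · set S := ∑ j, Real.log (θ j / xb j) * ((η' j : ℝ) - η j) with hSd
      have hn : 0 < n := by
        rcases Nat.eq_zero_or_pos n with h | h
        · subst h; simp at hSd; linarith
        · exact h
      have hn' : (0:ℝ) < n := by exact_mod_cast hn
      refine ⟨fun j => ((η' j : ℝ) - η j) * Real.log (θ j / xb j) - S / n, ?_,
        fun j => ⟨fun hj => ?_, fun hj => ?_⟩⟩
      · rw [Finset.sum_sub_distrib]
        simp only [Finset.sum_const, Finset.card_univ, Fintype.card_fin, nsmul_eq_mul]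
        rw [mul_div_cancel₀ _ hn'.ne', hSd]
        simp [mul_comm]
      · have : 0 < S / n := by positivity
        linarith
      · rcases (h0 j hj).lt_or_eq with h | h
        · exact Or.inl h
        · refine Or.inr ⟨h, ?_⟩
          have : 0 < S / n := by positivity
          simp only [h, zero_mul]; linarith
  obtain ⟨b, hb, hb'⟩ := main
  have hall := eventually_all.2 fun j => evj hxb hθ j _ (b j) (hb' j).1 (hb' j).2
  filter_upwards [hall] with u hu hpos
  rw [← Real.log_le_log_iff (YY_pos hxb hpos _) (YY_pos hxb hpos _),
    log_YY hxb _ (fun j _ => hpos j), log_YY hxb _ (fun j _ => hpos j), ← sub_nonneg, ← Finset.sum_sub_distrib]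
  refine hb.trans (Finset.sum_le_sum fun j _ => ?_)
  have := hu j (hpos j)
  linarith

/-- sign of weighted production near θ -/
lemma Ctx.nearLe (H : Ctx y y' k τ τm xb x M) {θ : Fin n → ℝ} (R : Finset (Fin r))
    (Tch : (Fin n → ℕ) → Prop) (hR : ∀ i, i ∈ R ↔ Tch (y i)) (hR' : ∀ i, i ∈ R ↔ Tch (y' i))
    (P : Submodule ℝ (Fin n → ℝ)) (hP : ∀ i ∈ R, (fun j => (y' i j : ℝ) - y i j) ∈ P)
    (c : Fin n → ℝ)
    (hc : ∀ i ∈ R, ∀ i' ∈ R, (fun j => (y i' j : ℝ) - y i j) ∈ P →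
      0 < ∑ j, c j * ((y i' j : ℝ) - y i j) →
      ∀ᶠ u in nhds θ, (∀ j, 0 < u j) → YY xb u (y i) ≤ YY xb u (y i')) :
    ∀ᶠ u in nhds θ, (∀ j, 0 < u j) →
      ∑ i ∈ R, kap k xb y i * YY xb u (y i) * (∑ j, c j * ((y' i j : ℝ) - y i j)) ≤ 0 := by
  classical
  have hbal : ∀ φ : (Fin n → ℕ) → ℝ, ∑ i ∈ R, kap k xb y i * φ (y' i) = ∑ i ∈ R, kap k xb y i * φ (y i) := by
    intro φ
    have := H.bal (fun η => if Tch η then φ η else 0)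
    simp only [mul_ite, mul_zero, ← Finset.sum_filter] at this
    have e1 : univ.filter (fun i => Tch (y' i)) = R := by ext i; simp [hR' i]
    have e2 : univ.filter (fun i => Tch (y i)) = R := by ext i; simp [hR i]
    rwa [e1, e2] at this
  have hall : ∀ᶠ u in nhds θ, ∀ i i', (i ∈ R ∧ i' ∈ R ∧ (fun j => (y i' j : ℝ) - y i j) ∈ P ∧
      0 < ∑ j, c j * ((y i' j : ℝ) - y i j)) → (∀ j, 0 < u j) → YY xb u (y i) ≤ YY xb u (y i') := by
    refine eventually_all.2 fun i => eventually_all.2 fun i' => ?_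
    by_cases hh : (i ∈ R ∧ i' ∈ R ∧ (fun j => (y i' j : ℝ) - y i j) ∈ P ∧
      0 < ∑ j, c j * ((y i' j : ℝ) - y i j))
    · filter_upwards [hc i hh.1 i' hh.2.1 hh.2.2.1 hh.2.2.2] with u hu _
      exact hu
    · exact Eventually.of_forall fun u h => absurd h hh
  filter_upwards [hall] with u hu hpos
  have := L10 (y := y) (y' := y') R (kap k xb y) (fun i => (H.kp i).le) hbal
    (fun η => P.mkQ (fun j => (η j : ℝ))) (fun i hi => by
      rw [← sub_eq_zero, ← map_sub, Submodule.mkQ_apply, Submodule.Quotient.mk_eq_zero]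
      exact hP i hi) (fun η => YY xb u η) (fun η => ∑ j, c j * (η j : ℝ))
      (fun η => (YY_pos H.xbpos hpos η).le) (fun i hi i' hi' h1 h2 => by
        refine hu i i' ⟨hi, hi', ?_, ?_⟩ hpos
        · rw [eq_comm, ← sub_eq_zero, ← map_sub, Submodule.mkQ_apply, Submodule.Quotient.mk_eq_zero] at h1
          exact h1
        · simp_rw [mul_sub]
          rw [Finset.sum_sub_distrib]
          linarith)
  refine le_trans (le_of_eq (Finset.sum_congr rfl fun i _ => ?_)) this
  simp_rw [mul_sub]
  rw [Finset.sum_sub_distrib]; ring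
end

section
variable {y y' : Fin r → Fin n → ℕ} {k τ : Fin r → ℝ} {τm : ℝ} {xb : Fin n → ℝ}
    {x : ℝ → Fin n → ℝ} {M : ℝ}

lemma Ctx.z_weight (H : Ctx y y' k τ τm xb x M) (c : Fin n → ℝ) {s t : ℝ} (hs : 0 < s) (hst : s ≤ t)
    (h : ∀ u ∈ Set.Icc s t, ∑ i, kap k xb y i * YY xb (x u) (y i) *
      (∑ j, c j * ((y' i j : ℝ) - y i j)) ≤ 0) :
    ∑ j, c j * (zz y y' k τ xb x t j - zz y y' k τ xb x s j) ≤ 0 := by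
  have hc : ∀ i, Continuous fun u => kap k xb y i * YY xb (x u) (y i) * (∑ j, c j * ((y' i j : ℝ) - y i j)) :=
    fun i => (continuous_const.mul (H.Yc _)).mul continuous_const
  have e : ∑ j, c j * (zz y y' k τ xb x t j - zz y y' k τ xb x s j) =
      ∫ u in s..t, ∑ i, kap k xb y i * YY xb (x u) (y i) * (∑ j, c j * ((y' i j : ℝ) - y i j)) := by
    rw [intervalIntegral.integral_finsetSum fun i _ => (hc i).intervalIntegrable _ _]
    simp_rw [H.z_diff hs (hs.trans_le hst), Finset.mul_sum (s := univ (α := Fin r))]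
    rw [Finset.sum_comm]
    refine Finset.sum_congr rfl fun i _ => ?_
    rw [intervalIntegral.integral_mul_const, intervalIntegral.integral_const_mul, Finset.mul_sum]
    refine Finset.sum_congr rfl fun j _ => ?_
    rw [JJ]; ring
  rw [e]
  have h2 : 0 ≤ ∫ u in s..t, -(∑ i, kap k xb y i * YY xb (x u) (y i) * (∑ j, c j * ((y' i j : ℝ) - y i j))) :=
    intervalIntegral.integral_nonneg hst fun u hu => by linarith [h u hu]
  rw [intervalIntegral.integral_neg] at h2
  linarith

lemma Ctx.stable (H : Ctx y y' k τ τm xb x M) {θ : Fin n → ℝ} (h : Om x θ)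
    (hmin : ∀ θ', Om x θ' → (∀ j, θ' j = 0 → θ j = 0) → ∀ j, θ j = 0 → θ' j = 0)
    (K : Fin n → ℝ) (hK0 : ∀ j, θ j ≠ 0 → K j = 0)
    (hK : ∀ᶠ u in nhds θ, (∀ j, 0 < u j) → ∑ i, kap k xb y i * YY xb u (y i) *
      (∑ j, (Real.log (θ j / xb j) - K j) * ((y' i j : ℝ) - y i j)) ≤ 0) :
    Tendsto x atTop (nhds θ) := by
  have hpos : ∀ᶠ u in nhds θ, ∀ j, u j = 0 → θ j = 0 := by
    refine eventually_all.2 fun j => ?_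
    by_cases hj : θ j = 0
    · exact Eventually.of_forall fun _ _ => hj
    · filter_upwards [(continuous_apply j).continuousAt.eventually_ne hj] with u hu h0
      exact absurd h0 hu
  obtain ⟨r0, hr0, hball⟩ := Metric.eventually_nhds_iff.1 (hK.and hpos)
  rw [Metric.tendsto_nhds]
  intro ε hε
  by_contra hcon
  set r1 := min (r0 / 2) ε with hr1
  have hr1p : 0 < r1 := lt_min (by linarith) hε
  have hr1r : r1 < r0 := (min_le_left _ _).trans_lt (by linarith)
  have hfar : ∀ N : ℝ, ∃ o, N ≤ o ∧ r1 ≤ dist (x o) θ := by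
    intro N
    obtain ⟨o, h1, h2⟩ := (Frequently.and_eventually (not_eventually.1 hcon) (eventually_ge_atTop N)).exists
    exact ⟨o, h2, (min_le_right _ _).trans (not_lt.1 h1)⟩
  obtain ⟨T, hT, hTx⟩ := h
  have hTx' := Metric.tendsto_nhds.1 hTx
  have hsel : ∀ N : ℕ, ∃ s t : ℝ, (N : ℝ) + 1 ≤ s ∧ s ≤ t ∧ dist (x s) θ = r1 ∧
      (∀ u ∈ Set.Icc s t, dist (x u) θ ≤ r1) ∧ dist (x t) θ < 1 / ((N : ℝ) + 1) := by
    intro N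
    obtain ⟨o, ho1, ho2⟩ := hfar ((N : ℝ) + 1)
    obtain ⟨m, hm1, hm2, hm3⟩ := ((hT.eventually_ge_atTop o).and
      ((hTx' r1 hr1p).and (hTx' (1 / ((N : ℝ) + 1)) (by positivity)))).exists
    set t := T m
    have hdc : Continuous fun u => dist (x u) θ := H.cont.dist continuous_const
    have hcomp : IsCompact (Set.Icc o t ∩ {u | r1 ≤ dist (x u) θ}) :=
      isCompact_Icc.inter_right (isClosed_le continuous_const hdc)
    obtain ⟨s, ⟨hs1, hs2⟩, hs3⟩ := hcomp.exists_isGreatest ⟨o, ⟨le_rfl, hm1⟩, ho2⟩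
    have hst : s ≤ t := hs1.2
    have hs2 : r1 ≤ dist (x s) θ := hs2
    have hlt : ∀ u ∈ Set.Icc s t, u ≠ s → dist (x u) θ < r1 := by
      intro u hu hne
      by_contra hge
      exact hne (le_antisymm (hs3 ⟨⟨hs1.1.trans hu.1, hu.2⟩, not_lt.1 hge⟩) hu.1)
    have hseq : dist (x s) θ = r1 := by
      obtain ⟨u, hu, hu2⟩ := intermediate_value_Icc' hst hdc.continuousOn (Set.mem_Icc.2 ⟨hm2.le, hs2⟩)
      by_cases hus : u = s
      · rw [← hus]; exact hu2
      · exact absurd hu2 (hlt u hu hus).ne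
    refine ⟨s, t, ho1.trans hs1.1, hst, hseq, fun u hu => ?_, hm3⟩
    by_cases hus : u = s
    · rw [hus, hseq]
    · exact (hlt u hu hus).le
  choose S T' hS1 hST hSd hSu hTd using hsel
  have hSt : Tendsto S atTop atTop := tendsto_atTop_mono (fun N => by linarith [hS1 N]) tendsto_natCast_atTop_atTop
  have hTt : Tendsto T' atTop atTop := tendsto_atTop_mono hST hSt
  have hTl : Tendsto (fun N => x (T' N)) atTop (nhds θ) := by
    rw [tendsto_iff_dist_tendsto_zero]
    exact squeeze_zero (fun _ => dist_nonneg) (fun N => (hTd N).le) tendsto_one_div_add_atTop_nhds_zero_nat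
  obtain ⟨θ', φ, hφ, hx⟩ := H.subseq S
  have hOm' : Om x θ' := ⟨fun N => S (φ N), hSt.comp hφ.tendsto_atTop, hx⟩
  have hOm : Om x θ := ⟨T, hT, hTx⟩
  have hdist : dist θ' θ = r1 := by
    refine tendsto_nhds_unique (hx.dist tendsto_const_nhds) ?_
    simp only [hSd]
    exact tendsto_const_nhds
  have hz' : ∀ j, θ' j = 0 → θ j = 0 := (hball (by rw [hdist]; exact hr1r)).2
  have hz : ∀ j, θ j = 0 → θ' j = 0 := hmin θ' hOm' hz'
  have hineq : ∀ N, ∑ j, (Real.log (θ j / xb j) - K j) *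
      (zz y y' k τ xb x (T' N) j - zz y y' k τ xb x (S N) j) ≤ 0 := by
    intro N
    refine H.z_weight _ (by have := hS1 N; have h0 : (0:ℝ) ≤ N := Nat.cast_nonneg N; linarith) (hST N) fun u hu => ?_
    exact (hball ((hSu N u hu).trans_lt hr1r)).1 (H.pos u)
  have hlim : ∑ j, (Real.log (θ j / xb j) - K j) * (FF y y' k τ xb θ j - FF y y' k τ xb θ' j) ≤ 0 := by
    refine le_of_tendsto' (x := atTop) (f := fun N => ∑ j, (Real.log (θ j / xb j) - K j) *
      (zz y y' k τ xb x (T' (φ N)) j - zz y y' k τ xb x (S (φ N)) j)) ?_ (fun N => hineq _)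
    refine tendsto_finsetSum _ fun j _ => Tendsto.const_mul _ (Tendsto.sub ?_ ?_)
    · exact H.z_lim (hTt.comp hφ.tendsto_atTop) (hTl.comp hφ.tendsto_atTop) j
    · exact H.z_lim (hSt.comp hφ.tendsto_atTop) hx j
  have hμ : 0 ≤ ∑ j, Real.log (θ j / xb j) * (FF y y' k τ xb θ' j - FF y y' k τ xb θ j) := by
    have : ∑ j, (Real.log (θ j / xb j) - K j) * (FF y y' k τ xb θ j - FF y y' k τ xb θ' j) =
        - ∑ j, Real.log (θ j / xb j) * (FF y y' k τ xb θ' j - FF y y' k τ xb θ j) := by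
      rw [← Finset.sum_neg_distrib]
      refine Finset.sum_congr rfl fun j _ => ?_
      by_cases hj : θ j = 0
      · rw [H.FF_zero hOm hj, H.FF_zero hOm' (hz j hj)]; ring
      · rw [hK0 j hj]; ring
    linarith
  have := H.L8 hOm hOm' hz hμ
  rw [this, dist_self] at hdist
  linarith

lemma Ctx.facet_end (H : Ctx y y' k τ τm xb x M) {θ : Fin n → ℝ} (h : Om x θ)
    (hx : Tendsto x atTop (nhds θ)) (j0 : Fin n) (hj0 : θ j0 = 0)
    (hnear : ∀ᶠ u in nhds θ, (∀ j, 0 < u j) → ∑ i, kap k xb y i * YY xb u (y i) *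
      (∑ j, (if j = j0 then (-1 : ℝ) else 0) * ((y' i j : ℝ) - y i j)) ≤ 0) : False := by
  obtain ⟨T0, hT0⟩ := eventually_atTop.1 (hx.eventually hnear)
  set s := max T0 1 with hs
  have hs0 : 0 < s := lt_max_of_lt_right one_pos
  have hmono : ∀ t, s ≤ t → zz y y' k τ xb x s j0 ≤ zz y y' k τ xb x t j0 := by
    intro t hst
    have := H.z_weight _ hs0 hst fun u hu => hT0 u ((le_max_left _ _).trans hu.1) (H.pos u)
    simp at this
    linarith
  obtain ⟨T, hT, hTx⟩ := h
  have hl := H.z_lim hT hTx j0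
  rw [H.FF_zero ⟨T, hT, hTx⟩ hj0] at hl
  have : zz y y' k τ xb x s j0 ≤ 0 := by
    refine ge_of_tendsto hl ?_
    filter_upwards [hT.eventually_ge_atTop s] with N hN
    exact hmono _ hN
  linarith [H.z_pos (y' := y') s j0]
end

section
variable {y y' : Fin r → Fin n → ℕ} {k τ : Fin r → ℝ} {τm : ℝ} {xb : Fin n → ℝ}
    {x : ℝ → Fin n → ℝ} {M : ℝ}

lemma log_cmp {a b c : ℝ} (hc : 0 < c) (ha : c / 2 ≤ a) (ha' : a ≤ 2 * c) (hb : c / 2 ≤ b) (hb' : b ≤ 2 * c) :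
    |Real.log a - Real.log b| ≤ 2 / c * |a - b| ∧ |a - b| ≤ 2 * c * |Real.log a - Real.log b| := by
  have key : ∀ a b : ℝ, c / 2 ≤ a → a ≤ 2 * c → c / 2 ≤ b → b ≤ 2 * c → b ≤ a →
      |Real.log a - Real.log b| ≤ 2 / c * |a - b| ∧ |a - b| ≤ 2 * c * |Real.log a - Real.log b| := by
    intro a b ha ha' hb hb' hab
    have hb0 : 0 < b := by linarith
    have ha0 : 0 < a := by linarith
    have h1 : 0 ≤ Real.log a - Real.log b := sub_nonneg.2 (Real.log_le_log hb0 hab)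
    rw [abs_of_nonneg h1, abs_of_nonneg (sub_nonneg.2 hab)]
    have h2 : Real.log a - Real.log b ≤ (a - b) / b := by
      have := Real.log_le_sub_one_of_pos (div_pos ha0 hb0)
      rw [Real.log_div ha0.ne' hb0.ne'] at this
      rw [sub_div, div_self hb0.ne']; exact this
    have h3 : (a - b) / a ≤ Real.log a - Real.log b := by
      have := Real.log_le_sub_one_of_pos (div_pos hb0 ha0)
      rw [Real.log_div hb0.ne' ha0.ne'] at this
      rw [sub_div, div_self ha0.ne']; linarith
    constructor
    · refine h2.trans ?_
      rw [div_mul_eq_mul_div, div_le_div_iff₀ hb0 hc]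
      nlinarith
    · rw [div_le_iff₀ ha0] at h3
      nlinarith
  rcases le_total b a with h | h
  · exact key a b ha ha' hb hb' h
  · have := key b a hb hb' ha ha' h
    rwa [abs_sub_comm (Real.log b), abs_sub_comm b] at this

lemma ff_le_mul {a b : ℝ} (ha : 0 < a) (hb : 0 < b) : ff a b ≤ (a - b) * (Real.log a - Real.log b) := by
  have := ff_nonneg hb.le ha
  unfold ff at *
  linarith

lemma fin_bound {ι : Type*} [Fintype ι] (f : ι → ℝ) : ∃ A : ℝ, 1 ≤ A ∧ ∀ i, f i ≤ A := by
  refine ⟨∑ i, |f i| + 1, ?_, fun i => ?_⟩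
  · have := Finset.sum_nonneg fun i (_ : i ∈ univ) => abs_nonneg (f i)
    linarith
  · have := Finset.single_le_sum (fun i (_ : i ∈ univ) => abs_nonneg (f i)) (mem_univ i)
    linarith [le_abs_self (f i)]

lemma Fl_mono {τ : Fin r → ℝ} {i : Fin r} (hτ : 0 ≤ τ i) (hx : Continuous x) {φ ψ : (Fin n → ℝ) → ℝ}
    (hφ : Continuous φ) (hψ : Continuous ψ) {t : ℝ} (h : ∀ s ∈ Set.Icc (t - τ i) t, φ (x s) ≤ ψ (x s)) :
    Fl τ x φ i t ≤ Fl τ x ψ i t :=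
  intervalIntegral.integral_mono_on (by linarith) ((hφ.comp hx).intervalIntegrable _ _)
    ((hψ.comp hx).intervalIntegrable _ _) h

lemma Fl_lin {τ : Fin r → ℝ} {i : Fin r} (hx : Continuous x) {φ ψ : (Fin n → ℝ) → ℝ}
    (hφ : Continuous φ) (hψ : Continuous ψ) (t a c : ℝ) :
    Fl τ x (fun u => φ u + a * ψ u + c) i t = Fl τ x φ i t + a * Fl τ x ψ i t + c * τ i := by
  have h1 := (hφ.comp hx).intervalIntegrable (μ := MeasureTheory.volume) (t - τ i) t
  have h2 := ((hψ.comp hx).const_mul a).intervalIntegrable (μ := MeasureTheory.volume) (t - τ i) t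
  unfold Fl
  simp only [Function.comp_def] at h1 h2
  rw [intervalIntegral.integral_add (h1.add h2) (by simp), intervalIntegral.integral_add h1 h2,
    intervalIntegral.integral_const_mul]
  simp
  ring

lemma continuous_ff (b : ℝ) : Continuous fun a => ff a b := by
  unfold ff
  exact ((Real.continuous_mul_log.sub (continuous_id.mul continuous_const)).sub continuous_id).add continuous_const

noncomputable def pf (θ : Fin n → ℝ) (j : Fin n) (a : ℝ) : ℝ := if θ j = 0 then 0 else ff a (θ j)

noncomputable def qf (xb θ : Fin n → ℝ) (η : Fin n → ℕ) (u : Fin n → ℝ) : ℝ :=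
  if YY xb θ η = 0 then 0 else ff (YY xb u η) (YY xb θ η)

noncomputable def iw (θ : Fin n → ℝ) (j : Fin n) : ℝ := if θ j = 0 then 1 else 0

noncomputable def ir (xb θ : Fin n → ℝ) (η : Fin n → ℕ) : ℝ := if YY xb θ η = 0 then 1 else 0

lemma continuous_qf (xb θ : Fin n → ℝ) (η) : Continuous (qf xb θ η) := by
  unfold qf
  split_ifs
  · exact continuous_const
  · exact (continuous_ff _).comp (continuous_YY xb η)

noncomputable def UU (y : Fin r → Fin n → ℕ) (k τ : Fin r → ℝ) (xb θ : Fin n → ℝ) (x : ℝ → Fin n → ℝ)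
    (t : ℝ) : ℝ :=
  ∑ j, pf θ j (x t j) + ∑ i, kap k xb y i * Fl τ x (qf xb θ (y i)) i t

noncomputable def LL (y y' : Fin r → Fin n → ℕ) (k τ : Fin r → ℝ) (xb θ : Fin n → ℝ) (x : ℝ → Fin n → ℝ)
    (t : ℝ) : ℝ := ∑ j, iw θ j * zz y y' k τ xb x t j

noncomputable def Lr (y : Fin r → Fin n → ℕ) (k τ : Fin r → ℝ) (xb θ : Fin n → ℝ) (x : ℝ → Fin n → ℝ)
    (t : ℝ) : ℝ := ∑ j, iw θ j * x t j +
      ∑ i, kap k xb y i * (ir xb θ (y i) * Fl τ x (fun u => YY xb u (y i)) i t)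

lemma iw_nonneg (θ : Fin n → ℝ) (j) : 0 ≤ iw θ j := by unfold iw; split_ifs <;> norm_num
lemma iw_le (θ : Fin n → ℝ) (j) : iw θ j ≤ 1 := by unfold iw; split_ifs <;> norm_num
lemma ir_nonneg (xb θ : Fin n → ℝ) (j) : 0 ≤ ir xb θ j := by unfold ir; split_ifs <;> norm_num

lemma Ctx.LL_eq (H : Ctx y y' k τ τm xb x M) {θ : Fin n → ℝ} (h : Om x θ) (t : ℝ) :
    LL y y' k τ xb θ x t = ∑ j, iw θ j * x t j +
      ∑ i, kap k xb y i * (ir xb θ (y i) * Fl τ x (fun u => YY xb u (y i)) i t) * ∑ j, iw θ j * (y' i j : ℝ) := by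
  unfold LL zz
  simp_rw [mul_add, Finset.sum_add_distrib, Finset.mul_sum]
  congr 1
  rw [Finset.sum_comm]
  refine Finset.sum_congr rfl fun i _ => Finset.sum_congr rfl fun j _ => ?_
  by_cases hi : YY xb θ (y i) = 0
  · simp [ir, hi]; ring
  · have : iw θ j * (y' i j : ℝ) = 0 := by
      rw [H.Om_eq h, YY_eq_zero H.xbpos] at hi
      push Not at hi
      unfold iw
      split_ifs with hj
      · simp [hi j hj]
      · simp
    rw [this]
    linear_combination (kap k xb y i * Fl τ x (fun u => YY xb u (y i)) i t) * this

lemma Ctx.Lr_le (H : Ctx y y' k τ τm xb x M) {θ : Fin n → ℝ} (h : Om x θ) (t : ℝ) :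
    Lr y k τ xb θ x t ≤ LL y y' k τ xb θ x t := by
  rw [H.LL_eq h, Lr]
  refine add_le_add le_rfl (Finset.sum_le_sum fun i _ => ?_)
  have h0 : 0 ≤ kap k xb y i * (ir xb θ (y i) * Fl τ x (fun u => YY xb u (y i)) i t) :=
    mul_nonneg (H.kp i).le (mul_nonneg (ir_nonneg _ _ _) (H.Fl_nonneg i t _))
  by_cases hi : YY xb θ (y i) = 0
  · have h1 : 1 ≤ ∑ j, iw θ j * (y' i j : ℝ) := by
      rw [H.Om_eq h, YY_eq_zero H.xbpos] at hi
      obtain ⟨j, h1, h2⟩ := hi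
      have h3 : (1:ℝ) ≤ iw θ j * (y' i j : ℝ) := by
        simp only [iw, h1, if_true, one_mul]
        exact_mod_cast Nat.one_le_iff_ne_zero.2 h2
      exact h3.trans (Finset.single_le_sum (f := fun j => iw θ j * (y' i j : ℝ))
        (fun j _ => mul_nonneg (iw_nonneg θ j) (Nat.cast_nonneg _)) (mem_univ j))
    nlinarith
  · simp [ir, hi]

lemma Ctx.LL_le (H : Ctx y y' k τ τm xb x M) {θ : Fin n → ℝ} (h : Om x θ) : ∃ c : ℝ, 0 < c ∧ ∀ t,
    LL y y' k τ xb θ x t ≤ c * Lr y k τ xb θ x t := by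
  obtain ⟨A, hA, hA'⟩ := fin_bound (fun i : Fin r => ∑ j, iw θ j * (y' i j : ℝ))
  refine ⟨A, by linarith, fun t => ?_⟩
  rw [H.LL_eq h, Lr, mul_add]
  refine add_le_add ?_ ?_
  · have : 0 ≤ ∑ j, iw θ j * x t j := Finset.sum_nonneg fun j _ => mul_nonneg (iw_nonneg θ j) (H.pos t j).le
    nlinarith
  · rw [Finset.mul_sum]
    refine Finset.sum_le_sum fun i _ => ?_
    have h0 : 0 ≤ kap k xb y i * (ir xb θ (y i) * Fl τ x (fun u => YY xb u (y i)) i t) :=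
      mul_nonneg (H.kp i).le (mul_nonneg (ir_nonneg _ _ _) (H.Fl_nonneg i t _))
    nlinarith [hA' i]

lemma Ctx.Lr_nonneg (H : Ctx y y' k τ τm xb x M) (θ : Fin n → ℝ) (t : ℝ) :
    0 ≤ Lr y k τ xb θ x t :=
  add_nonneg (Finset.sum_nonneg fun j _ => mul_nonneg (iw_nonneg θ j) (H.pos t j).le)
    (Finset.sum_nonneg fun i _ => mul_nonneg (H.kp i).le (mul_nonneg (ir_nonneg _ _ _) (H.Fl_nonneg i t _)))

lemma Ctx.qf_nonneg (H : Ctx y y' k τ τm xb x M) {θ : Fin n → ℝ} (h : Om x θ) (η) (s) :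
    0 ≤ qf xb θ η (x s) := by
  unfold qf
  split_ifs with h0
  · exact le_rfl
  · exact ff_nonneg (YY_pos H.xbpos (H.pos s) _).le
      (lt_of_le_of_ne (YY_nonneg H.xbpos (H.Om_nonneg h) _) (Ne.symm h0))

lemma Ctx.pf_nonneg (H : Ctx y y' k τ τm xb x M) {θ : Fin n → ℝ} (h : Om x θ) (j) (s) :
    0 ≤ pf θ j (x s j) := by
  unfold pf
  split_ifs with h0
  · exact le_rfl
  · exact ff_nonneg (H.pos s j).le (lt_of_le_of_ne (H.Om_nonneg h j) (Ne.symm h0))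

/-- eventually on windows -/
lemma Ctx.ev_win (H : Ctx y y' k τ τm xb x M) {θ : Fin n → ℝ} (hx : Tendsto x atTop (nhds θ))
    {P : (Fin n → ℝ) → Prop} (hP : ∀ᶠ u in nhds θ, (∀ j, 0 < u j) → P u) :
    ∀ᶠ t in atTop, ∀ s, t - τm ≤ s → P (x s) := by
  obtain ⟨T, hT⟩ := eventually_atTop.1 (hx.eventually hP)
  filter_upwards [eventually_ge_atTop (T + τm)] with t ht s hs
  exact hT s (by linarith) (H.pos s)

lemma Ctx.log_Yθ (H : Ctx y y' k τ τm xb x M) {θ : Fin n → ℝ} (h : Om x θ) {η : Fin n → ℕ}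
    (hi : YY xb θ η ≠ 0) :
    Real.log (YY xb θ η) = ∑ j, Real.log (θ j / xb j) * (η j : ℝ) := by
  rw [log_YY H.xbpos]
  intro j hj
  refine lt_of_le_of_ne (H.Om_nonneg h j) fun h0 => hi ?_
  rw [YY_eq_zero H.xbpos]
  exact ⟨j, h0.symm, hj⟩

/-- step (i) -/
lemma Ctx.stepI (H : Ctx y y' k τ τm xb x M) {θ : Fin n → ℝ} (h : Om x θ) (hx : Tendsto x atTop (nhds θ))
    {C0 : ℝ} (hC0 : 0 ≤ C0) (hμ : ∀ t > 0, ∑ j, Real.log (θ j / xb j) *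
      (zz y y' k τ xb x t j - FF y y' k τ xb θ j) ≤ C0 * LL y y' k τ xb θ x t) :
    ∀ᶠ t in atTop, LL y y' k τ xb θ x t ≤ UU y k τ xb θ x t := by
  obtain ⟨c, hc, hLc⟩ := H.LL_le h
  set B := (C0 + 1) * c with hB
  set μ : Fin n → ℝ := fun j => Real.log (θ j / xb j) with hμd
  have hj : ∀ j, ∀ᶠ u in nhds θ, (∀ j, 0 < u j) → xb j * gg (u j / xb j) - xb j * gg (θ j / xb j) ≤
      pf θ j (u j) + μ j * (u j - θ j) - B * (iw θ j * u j) := by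
    intro j
    by_cases hj : θ j = 0
    · have h1 := evj H.xbpos (H.Om_nonneg h) j (-1) (B - 1) (fun h => absurd hj h) (fun _ => Or.inl (by norm_num))
      filter_upwards [h1] with u hu hpos
      have h2 := hu (hpos j)
      have h3 : xb j * gg (u j / xb j) - xb j * gg (θ j / xb j) = u j * Real.log (u j / xb j) - u j := by
        have := (H.xbpos j).ne'
        simp only [gg, hj, zero_div, zero_mul]
        field_simp
        ring
      rw [h3]
      simp only [pf, hj, iw, if_true, μ, zero_div, Real.log_zero, zero_mul, one_mul, add_zero, zero_add]
      nlinarith [hpos j]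
    · refine Eventually.of_forall fun u hpos => le_of_eq ?_
      have h1 := (H.xbpos j)
      have h2 : 0 < θ j := lt_of_le_of_ne (H.Om_nonneg h j) (Ne.symm hj)
      simp only [pf, hj, iw, if_false, μ, gg, ff]
      rw [Real.log_div h2.ne' h1.ne', Real.log_div (hpos j).ne' h1.ne']
      field_simp
      ring
  have hi : ∀ i, ∀ᶠ u in nhds θ, (∀ j, 0 < u j) → gg (YY xb u (y i)) ≤
      qf xb θ (y i) u + (∑ j, μ j * y' i j - B * ir xb θ (y i)) * YY xb u (y i) +
        (gg (YY xb θ (y i)) - (∑ j, μ j * y' i j) * YY xb θ (y i)) := by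
    intro i
    by_cases hi : YY xb θ (y i) = 0
    · have h1 : ∀ᶠ u in nhds θ, YY xb u (y i) < Real.exp (∑ j, μ j * y' i j - B) :=
        ((continuous_YY xb (y i)).tendsto θ).eventually_lt_const (by rw [hi]; exact Real.exp_pos _)
      filter_upwards [h1] with u hu hpos
      have hY := YY_pos H.xbpos hpos (y i)
      have h2 : Real.log (YY xb u (y i)) ≤ ∑ j, μ j * y' i j - B := by
        have := Real.log_le_log hY hu.le
        rwa [Real.log_exp] at this
      simp only [qf, ir, hi, if_true, gg]
      nlinarith
    · refine Eventually.of_forall fun u hpos => le_of_eq ?_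
      have h2 : ∑ j, μ j * y' i j = Real.log (YY xb θ (y i)) := by
        rw [H.Om_eq h i, H.log_Yθ h (by rwa [← H.Om_eq h i])]
      simp only [qf, ir, hi, if_false, gg, ff, h2]
      ring
  have e1 := H.ev_win hx (P := fun u => ∀ j, xb j * gg (u j / xb j) - xb j * gg (θ j / xb j) ≤
      pf θ j (u j) + μ j * (u j - θ j) - B * (iw θ j * u j)) (by
        filter_upwards [eventually_all.2 hj] with u hu hp j using hu j hp)
  have e2 := H.ev_win hx (P := fun u => ∀ i, gg (YY xb u (y i)) ≤
      qf xb θ (y i) u + (∑ j, μ j * y' i j - B * ir xb θ (y i)) * YY xb u (y i) +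
        (gg (YY xb θ (y i)) - (∑ j, μ j * y' i j) * YY xb θ (y i))) (by
        filter_upwards [eventually_all.2 hi] with u hu hp j using hu j hp)
  obtain ⟨v, hv, hvle⟩ := H.V_lim
  filter_upwards [e1, e2, eventually_gt_atTop 0] with t h1 h2 ht
  have hV : 0 ≤ VV y k τ xb x t - Vst y k τ xb θ := by
    rw [H.Om_V h hv]; linarith [hvle t ht]
  have a1 : ∑ j, (xb j * gg (x t j / xb j) - xb j * gg (θ j / xb j)) ≤
      ∑ j, (pf θ j (x t j) + μ j * (x t j - θ j) - B * (iw θ j * x t j)) :=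
    Finset.sum_le_sum fun j _ => h1 t (by linarith [H.hτm0]) j
  have a2 : ∀ i, Fl τ x (fun u => gg (YY xb u (y i))) i t ≤ Fl τ x (qf xb θ (y i)) i t +
      (∑ j, μ j * y' i j - B * ir xb θ (y i)) * Fl τ x (fun u => YY xb u (y i)) i t +
      (gg (YY xb θ (y i)) - (∑ j, μ j * y' i j) * YY xb θ (y i)) * τ i := by
    intro i
    rw [← Fl_lin H.cont (continuous_qf _ _ _) (continuous_YY _ _)]
    refine Fl_mono (H.hτ i) H.cont (continuous_gg.comp (continuous_YY xb (y i))) ?_ fun s hs => ?_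
    · exact ((continuous_qf _ _ _).add (continuous_const.mul (continuous_YY _ _))).add continuous_const
    · exact h2 s (by linarith [hs.1, H.hτm i]) i
  have a3 : ∑ i, (kap k xb y i * Fl τ x (fun u => gg (YY xb u (y i))) i t -
      kap k xb y i * (τ i * gg (YY xb θ (y i)))) ≤ ∑ i, (kap k xb y i * Fl τ x (qf xb θ (y i)) i t
      + (∑ j, μ j * (kap k xb y i * (Fl τ x (fun u => YY xb u (y i)) i t - τ i * YY xb θ (y i)) * y' i j))
      - B * (kap k xb y i * (ir xb θ (y i) * Fl τ x (fun u => YY xb u (y i)) i t))) := by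
    refine Finset.sum_le_sum fun i _ => ?_
    have e : ∑ j, μ j * (kap k xb y i * (Fl τ x (fun u => YY xb u (y i)) i t - τ i * YY xb θ (y i)) * y' i j) =
      kap k xb y i * (Fl τ x (fun u => YY xb u (y i)) i t - τ i * YY xb θ (y i)) * ∑ j, μ j * y' i j := by
      rw [Finset.mul_sum]; exact Finset.sum_congr rfl fun j _ => by ring
    rw [e]
    have := mul_le_mul_of_nonneg_left (a2 i) (H.kp i).le
    linarith
  have a4 : ∑ j, μ j * (zz y y' k τ xb x t j - FF y y' k τ xb θ j) = ∑ j, μ j * (x t j - θ j) +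
      ∑ i, ∑ j, μ j * (kap k xb y i * (Fl τ x (fun u => YY xb u (y i)) i t - τ i * YY xb θ (y i)) * y' i j) := by
    rw [Finset.sum_comm (s := univ (α := Fin r)), ← Finset.sum_add_distrib]
    refine Finset.sum_congr rfl fun j _ => ?_
    rw [← Finset.mul_sum, ← mul_add]
    congr 1
    unfold zz FF
    rw [show ∀ p q u v : ℝ, (p + q - (u + v)) = (p - u) + (q - v) by intros; ring, ← Finset.sum_sub_distrib]
    congr 1
    exact Finset.sum_congr rfl fun i _ => by ring
  have a5 := hμ t ht
  have a6 := hLc t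
  simp only [Finset.sum_add_distrib, Finset.sum_sub_distrib] at a1 a3
  rw [← Finset.mul_sum (a := B)] at a1 a3
  unfold VV Vst at hV
  have a7 : (C0 + 1) * LL y y' k τ xb θ x t ≤ B * Lr y k τ xb θ x t := by
    rw [hB, mul_assoc]; exact mul_le_mul_of_nonneg_left a6 (by linarith)
  unfold Lr at a7
  unfold UU
  change ∑ j, μ j * (zz y y' k τ xb x t j - FF y y' k τ xb θ j) ≤ _ at a5
  linarith
end

section
variable {y y' : Fin r → Fin n → ℕ} {k τ : Fin r → ℝ} {τm : ℝ} {xb : Fin n → ℝ}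
    {x : ℝ → Fin n → ℝ} {M : ℝ}

noncomputable def mm (θ u : Fin n → ℝ) (j : Fin n) : ℝ := if θ j = 0 then 0 else Real.log (u j) - Real.log (θ j)

noncomputable def m1 (θ u : Fin n → ℝ) : ℝ := ∑ j, |mm θ u j|

lemma m1_nonneg (θ u : Fin n → ℝ) : 0 ≤ m1 θ u := Finset.sum_nonneg fun _ _ => abs_nonneg _

lemma Ctx.mm_dot (H : Ctx y y' k τ τm xb x M) {θ : Fin n → ℝ} (h : Om x θ) {η : Fin n → ℕ}
    (hi : YY xb θ η ≠ 0) (t : ℝ) :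
    ∑ j, mm θ (x t) j * (η j : ℝ) = Real.log (YY xb (x t) η) - Real.log (YY xb θ η) := by
  rw [H.log_Yθ h hi, log_YY H.xbpos _ (fun j _ => H.pos t j), ← Finset.sum_sub_distrib]
  refine Finset.sum_congr rfl fun j _ => ?_
  by_cases hj : θ j = 0
  · have : η j = 0 := by
      by_contra h0
      exact hi ((YY_eq_zero H.xbpos _).2 ⟨j, hj, h0⟩)
    simp [this]
  · rw [mm, if_neg hj, Real.log_div hj (H.xbpos j).ne', Real.log_div (H.pos t j).ne' (H.xbpos j).ne']
    ring

lemma dot_le (c m : Fin n → ℝ) {A : ℝ} (hA : ∀ j, |c j| ≤ A) : |∑ j, m j * c j| ≤ A * ∑ j, |m j| := by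
  refine (Finset.abs_sum_le_sum_abs _ _).trans ?_
  rw [Finset.mul_sum]
  refine Finset.sum_le_sum fun j _ => ?_
  rw [abs_mul, mul_comm]
  exact mul_le_mul_of_nonneg_right (hA j) (abs_nonneg _)

/-- data of constants and closeness at a time -/
structure Near (y y' : Fin r → Fin n → ℕ) (k τ : Fin r → ℝ) (xb θ : Fin n → ℝ)
    (x : ℝ → Fin n → ℝ) (A q t : ℝ) : Prop where
  A1 : 1 ≤ A
  q0 : 0 ≤ q
  hκ : ∀ i, kap k xb y i ≤ A
  hτ : ∀ i, τ i ≤ A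
  hy' : ∀ i j, (y' i j : ℝ) ≤ A
  hY1 : ∀ i, 2 / YY xb θ (y i) ≤ A
  hY2 : ∀ i, 2 * YY xb θ (y i) ≤ A
  hθ1 : ∀ j, 2 / θ j ≤ A
  hθ2 : ∀ j, 2 * θ j ≤ A
  nY : ∀ i, YY xb θ (y i) ≠ 0 → ∀ s ∈ Set.Icc (t - τ i) t,
    YY xb θ (y i) / 2 ≤ YY xb (x s) (y i) ∧ YY xb (x s) (y i) ≤ 2 * YY xb θ (y i)
  nY' : ∀ i, YY xb θ (y i) ≠ 0 →
    YY xb θ (y i) / 2 ≤ YY xb (x t) (y' i) ∧ YY xb (x t) (y' i) ≤ 2 * YY xb θ (y i)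
  nx : ∀ j, θ j ≠ 0 → θ j / 2 ≤ x t j ∧ x t j ≤ 2 * θ j
  hq : ∀ i, YY xb θ (y i) ≠ 0 → ∀ s ∈ Set.Icc (t - τ i) t,
    |YY xb (x s) (y i) - YY xb (x t) (y' i)| ≤ q

section
variable {θ : Fin n → ℝ} {A q t : ℝ}

lemma Near.dy' (N : Near y y' k τ xb θ x A q t) (i) (u : Fin n → ℝ) :
    |∑ j, mm θ u j * (y' i j : ℝ)| ≤ A * m1 θ u :=
  dot_le _ _ fun j => by rw [abs_of_nonneg (Nat.cast_nonneg _)]; exact N.hy' i j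

lemma Near.Yθ (H : Ctx y y' k τ τm xb x M) (h : Om x θ) (i) (hi : YY xb θ (y i) ≠ 0) : 0 < YY xb θ (y i) :=
  lt_of_le_of_ne (YY_nonneg H.xbpos (H.Om_nonneg h) _) (Ne.symm hi)

lemma Near.Ys (N : Near y y' k τ xb θ x A q t) (H : Ctx y y' k τ τm xb x M) (h : Om x θ)
    {i} (hi : YY xb θ (y i) ≠ 0) {s} (hs : s ∈ Set.Icc (t - τ i) t) :
    |YY xb (x s) (y i) - YY xb θ (y i)| ≤ q + A ^ 2 * m1 θ (x t) := by
  have hp := Near.Yθ H h i hi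
  have h1 := N.hq i hi s hs
  have h2 : |YY xb (x t) (y' i) - YY xb θ (y i)| ≤ A * (A * m1 θ (x t)) := by
    have h3 := (log_cmp hp (N.nY' i hi).1 (N.nY' i hi).2 (by linarith) (by linarith : YY xb θ (y i) ≤ _)).2
    have h4 := H.mm_dot h (η := y' i) (by rwa [← H.Om_eq h]) t
    rw [← H.Om_eq h i] at h4
    rw [← h4] at h3
    exact h3.trans (mul_le_mul (N.hY2 i) (N.dy' i _) (abs_nonneg _) (by linarith [N.A1]))
  have := abs_sub_le (YY xb (x s) (y i)) (YY xb (x t) (y' i)) (YY xb θ (y i))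
  nlinarith

lemma Near.qf_le (N : Near y y' k τ xb θ x A q t) (H : Ctx y y' k τ τm xb x M) (h : Om x θ)
    {i} (hi : YY xb θ (y i) ≠ 0) {s} (hs : s ∈ Set.Icc (t - τ i) t) :
    qf xb θ (y i) (x s) ≤ (∑ j, mm θ (x t) j * (y' i j : ℝ)) * (YY xb (x s) (y i) - YY xb θ (y i)) +
      (q + A ^ 2 * m1 θ (x t)) * (A * q) := by
  have hp := Near.Yθ H h i hi
  have hs0 : 0 < YY xb (x s) (y i) := YY_pos H.xbpos (H.pos s) _
  have h1 := N.Ys H h hi hs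
  have h4 := H.mm_dot h (η := y' i) (by rwa [← H.Om_eq h]) t
  rw [← H.Om_eq h i] at h4
  rw [h4, qf, if_neg hi]
  have h2 := ff_le_mul hs0 hp
  have h3 := (log_cmp hp (N.nY i hi s hs).1 (N.nY i hi s hs).2 (N.nY' i hi).1 (N.nY' i hi).2).1
  have h5 : |Real.log (YY xb (x s) (y i)) - Real.log (YY xb (x t) (y' i))| ≤ A * q :=
    h3.trans (mul_le_mul (N.hY1 i) (N.hq i hi s hs) (abs_nonneg _) (by linarith [N.A1]))
  have h6 : (YY xb (x s) (y i) - YY xb θ (y i)) * (Real.log (YY xb (x s) (y i)) - Real.log (YY xb (x t) (y' i)))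
      ≤ (q + A ^ 2 * m1 θ (x t)) * (A * q) := by
    refine (le_abs_self _).trans ?_
    rw [abs_mul]
    exact mul_le_mul h1 h5 (abs_nonneg _) ((abs_nonneg _).trans h1)
  linarith

lemma Fl_zero_lin {i : Fin r} (hx : Continuous x) {ψ : (Fin n → ℝ) → ℝ} (hψ : Continuous ψ) (t a c : ℝ) :
    Fl τ x (fun u => a * ψ u + c) i t = a * Fl τ x ψ i t + c * τ i := by
  have := Fl_lin (τ := τ) (i := i) hx (φ := fun _ => 0) continuous_const hψ t a c
  simpa [Fl] using this

lemma Near.Flq (N : Near y y' k τ xb θ x A q t) (H : Ctx y y' k τ τm xb x M) (h : Om x θ)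
    {i} (hi : YY xb θ (y i) ≠ 0) :
    Fl τ x (qf xb θ (y i)) i t ≤ (∑ j, mm θ (x t) j * (y' i j : ℝ)) *
      (Fl τ x (fun u => YY xb u (y i)) i t - τ i * YY xb θ (y i)) +
      (q + A ^ 2 * m1 θ (x t)) * (A * q) * τ i := by
  have := Fl_zero_lin (τ := τ) (i := i) H.cont (continuous_YY xb (y i)) t (∑ j, mm θ (x t) j * (y' i j : ℝ))
    ((q + A ^ 2 * m1 θ (x t)) * (A * q) - (∑ j, mm θ (x t) j * (y' i j : ℝ)) * YY xb θ (y i))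
  refine (Fl_mono (H.hτ i) H.cont (continuous_qf _ _ _) ((continuous_const.mul (continuous_YY xb (y i))).add
    continuous_const) (fun s hs => ?_)).trans (this.le.trans (le_of_eq (by ring)))
  have := N.qf_le H h hi hs
  simp only [Pi.add_apply, Pi.mul_apply]
  linarith

lemma Near.FlY (N : Near y y' k τ xb θ x A q t) (H : Ctx y y' k τ τm xb x M) (h : Om x θ)
    {i} (hi : YY xb θ (y i) ≠ 0) :
    |Fl τ x (fun u => YY xb u (y i)) i t - τ i * YY xb θ (y i)| ≤ (q + A ^ 2 * m1 θ (x t)) * τ i := by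
  set B := q + A ^ 2 * m1 θ (x t)
  have c1 := continuous_YY xb (y i)
  have e1 := Fl_zero_lin (τ := τ) (i := i) H.cont c1 t 0 (YY xb θ (y i) + B)
  have e2 := Fl_zero_lin (τ := τ) (i := i) H.cont c1 t 0 (YY xb θ (y i) - B)
  have i1 := Fl_mono (H.hτ i) H.cont c1 (ψ := fun u => 0 * YY xb u (y i) + (YY xb θ (y i) + B))
    ((continuous_const.mul c1).add continuous_const) (t := t) (fun s hs => by
      have := abs_le.1 (N.Ys H h hi hs); linarith [this.2])
  have i2 := Fl_mono (H.hτ i) H.cont (φ := fun u => 0 * YY xb u (y i) + (YY xb θ (y i) - B))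
    ((continuous_const.mul c1).add continuous_const) c1 (t := t) (fun s hs => by
      have := abs_le.1 (N.Ys H h hi hs); linarith [this.1])
  rw [e1] at i1
  rw [e2] at i2
  rw [abs_le]
  constructor <;> nlinarith

/-- Fl fluxes of touching reactions -/
lemma Near.Lr_ge (H : Ctx y y' k τ τm xb x M) (θ : Fin n → ℝ) (t : ℝ) :
    ∑ i, kap k xb y i * (ir xb θ (y i) * Fl τ x (fun u => YY xb u (y i)) i t) ≤ Lr y k τ xb θ x t := by
  unfold Lr
  have := Finset.sum_nonneg fun j (_ : j ∈ univ) => mul_nonneg (iw_nonneg θ j) (H.pos t j).le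
  linarith

lemma Near.U_le (N : Near y y' k τ xb θ x A q t) (H : Ctx y y' k τ τm xb x M) (h : Om x θ) :
    UU y k τ xb θ x t ≤ ∑ j, mm θ (x t) j * (zz y y' k τ xb x t j - FF y y' k τ xb θ j) +
      r * (A ^ 3 * ((q + A ^ 2 * m1 θ (x t)) * q)) + A * m1 θ (x t) * LL y y' k τ xb θ x t := by
  have hA : 0 < A := by linarith [N.A1]
  have hm := m1_nonneg θ (x t)
  have a4 : ∑ j, mm θ (x t) j * (zz y y' k τ xb x t j - FF y y' k τ xb θ j) =
      ∑ j, mm θ (x t) j * (x t j - θ j) +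
      ∑ i, kap k xb y i * ((∑ j, mm θ (x t) j * (y' i j : ℝ)) *
        (Fl τ x (fun u => YY xb u (y i)) i t - τ i * YY xb θ (y i))) := by
    have : ∀ i, kap k xb y i * ((∑ j, mm θ (x t) j * (y' i j : ℝ)) *
        (Fl τ x (fun u => YY xb u (y i)) i t - τ i * YY xb θ (y i))) = ∑ j, mm θ (x t) j *
        (kap k xb y i * (Fl τ x (fun u => YY xb u (y i)) i t - τ i * YY xb θ (y i)) * y' i j) := by
      intro i
      rw [Finset.sum_mul, Finset.mul_sum]; exact Finset.sum_congr rfl fun j _ => by ring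
    simp_rw [this]
    rw [Finset.sum_comm (s := univ (α := Fin r)), ← Finset.sum_add_distrib]
    refine Finset.sum_congr rfl fun j _ => ?_
    rw [← Finset.mul_sum, ← mul_add]
    congr 1
    unfold zz FF
    rw [show ∀ p q u v : ℝ, (p + q - (u + v)) = (p - u) + (q - v) by intros; ring, ← Finset.sum_sub_distrib]
    congr 1
    exact Finset.sum_congr rfl fun i _ => by ring
  have b1 : ∑ j, pf θ j (x t j) ≤ ∑ j, mm θ (x t) j * (x t j - θ j) := by
    refine Finset.sum_le_sum fun j _ => ?_
    unfold pf mm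
    split_ifs with hj
    · simp
    · have := ff_le_mul (H.pos t j) (lt_of_le_of_ne (H.Om_nonneg h j) (Ne.symm hj))
      linarith
  have b2 : ∑ i, kap k xb y i * Fl τ x (qf xb θ (y i)) i t ≤ ∑ i, (kap k xb y i * ((∑ j, mm θ (x t) j * (y' i j : ℝ)) *
        (Fl τ x (fun u => YY xb u (y i)) i t - τ i * YY xb θ (y i))) + A ^ 3 * ((q + A ^ 2 * m1 θ (x t)) * q)
        + A * m1 θ (x t) * (kap k xb y i * (ir xb θ (y i) * Fl τ x (fun u => YY xb u (y i)) i t))) := by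
    refine Finset.sum_le_sum fun i _ => ?_
    have hκ := H.kp i
    have hQ : 0 ≤ (q + A ^ 2 * m1 θ (x t)) * q :=
      mul_nonneg (add_nonneg N.q0 (by positivity)) N.q0
    by_cases hi : YY xb θ (y i) = 0
    · have h1 := (abs_le.1 (N.dy' i (x t))).1
      have h2 : 0 ≤ kap k xb y i * Fl τ x (fun u => YY xb u (y i)) i t := mul_nonneg hκ.le (H.Fl_nonneg i t _)
      have h3 : Fl τ x (qf xb θ (y i)) i t = 0 := by simp [Fl, qf, hi]
      have h4 : 0 ≤ A ^ 3 * ((q + A ^ 2 * m1 θ (x t)) * q) := by positivity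
      simp only [h3, hi, ir, if_true]
      nlinarith
    · have h1 := N.Flq H h hi
      have h2 : kap k xb y i * ((q + A ^ 2 * m1 θ (x t)) * (A * q) * τ i) ≤ A ^ 3 * ((q + A ^ 2 * m1 θ (x t)) * q) := by
        have : kap k xb y i * τ i ≤ A * A := mul_le_mul (N.hκ i) (N.hτ i) (H.hτ i) hA.le
        calc _ = (kap k xb y i * τ i) * (A * ((q + A ^ 2 * m1 θ (x t)) * q)) := by ring
          _ ≤ (A * A) * (A * ((q + A ^ 2 * m1 θ (x t)) * q)) := mul_le_mul_of_nonneg_right this (by positivity)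
          _ = _ := by ring
      have h3 := mul_le_mul_of_nonneg_left h1 hκ.le
      simp only [ir, hi, if_false]
      linarith
  rw [Finset.sum_add_distrib, Finset.sum_add_distrib, ← Finset.mul_sum (a := A * m1 θ (x t))] at b2
  simp only [Finset.sum_const, Finset.card_univ, Fintype.card_fin, nsmul_eq_mul] at b2
  have b3 := mul_le_mul_of_nonneg_left ((Near.Lr_ge H θ t).trans (H.Lr_le h t)) (mul_nonneg hA.le hm)
  unfold UU
  linarith

/-- size of ζ -/
lemma Near.N1 (N : Near y y' k τ xb θ x A q t) (H : Ctx y y' k τ τm xb x M) (h : Om x θ) :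
    ∑ j, |zz y y' k τ xb x t j - FF y y' k τ xb θ j| ≤
      LL y y' k τ xb θ x t + A * m1 θ (x t) + n * (r * (A ^ 3 * (q + A ^ 2 * m1 θ (x t))) +
        A * LL y y' k τ xb θ x t) := by
  have hA : 0 < A := by linarith [N.A1]
  have hm := m1_nonneg θ (x t)
  have hLr := Near.Lr_ge (y' := y') H θ t
  have key : ∀ j, |zz y y' k τ xb x t j - FF y y' k τ xb θ j| ≤
      iw θ j * zz y y' k τ xb x t j + A * |mm θ (x t) j| + (r * (A ^ 3 * (q + A ^ 2 * m1 θ (x t))) +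
        A * LL y y' k τ xb θ x t) := by
    intro j
    have hQ : 0 ≤ q + A ^ 2 * m1 θ (x t) := add_nonneg N.q0 (by positivity)
    have hL0 : 0 ≤ LL y y' k τ xb θ x t := (H.Lr_nonneg θ t).trans (H.Lr_le h t)
    by_cases hj : θ j = 0
    · rw [H.FF_zero h hj, sub_zero, abs_of_pos (H.z_pos t j)]
      simp only [iw, hj, if_true]
      have : 0 ≤ A * |mm θ (x t) j| := by positivity
      have : 0 ≤ r * (A ^ 3 * (q + A ^ 2 * m1 θ (x t))) + A * LL y y' k τ xb θ x t := by positivity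
      linarith
    · have e : zz y y' k τ xb x t j - FF y y' k τ xb θ j = (x t j - θ j) + ∑ i, kap k xb y i *
          (Fl τ x (fun u => YY xb u (y i)) i t - τ i * YY xb θ (y i)) * y' i j := by
        unfold zz FF
        rw [show ∀ p q u v : ℝ, (p + q - (u + v)) = (p - u) + (q - v) by intros; ring, ← Finset.sum_sub_distrib]
        congr 1
        exact Finset.sum_congr rfl fun i _ => by ring
      have hp : 0 < θ j := lt_of_le_of_ne (H.Om_nonneg h j) (Ne.symm hj)
      have h1 : |x t j - θ j| ≤ A * |mm θ (x t) j| := by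
        have := (log_cmp hp (N.nx j hj).1 (N.nx j hj).2 (by linarith) (by linarith : θ j ≤ _)).2
        rw [mm, if_neg hj]
        exact this.trans (mul_le_mul_of_nonneg_right (N.hθ2 j) (abs_nonneg _))
      have h2 : |∑ i, kap k xb y i *
          (Fl τ x (fun u => YY xb u (y i)) i t - τ i * YY xb θ (y i)) * y' i j| ≤
          ∑ i, (A ^ 3 * (q + A ^ 2 * m1 θ (x t)) + A * (kap k xb y i * (ir xb θ (y i) * Fl τ x (fun u => YY xb u (y i)) i t))) := by
        refine (Finset.abs_sum_le_sum_abs _ _).trans (Finset.sum_le_sum fun i _ => ?_)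
        rw [abs_mul, abs_mul, abs_of_pos (H.kp i), abs_of_nonneg (Nat.cast_nonneg (α := ℝ) (y' i j))]
        by_cases hi : YY xb θ (y i) = 0
        · simp only [hi, ir, if_true, mul_zero, sub_zero, one_mul]
          rw [abs_of_nonneg (H.Fl_nonneg i t _)]
          have h3 := mul_le_mul_of_nonneg_left (N.hy' i j) (mul_nonneg (H.kp i).le (H.Fl_nonneg i t (y i)))
          have : 0 ≤ A ^ 3 * (q + A ^ 2 * m1 θ (x t)) := by positivity
          linarith
        · simp only [hi, ir, if_false, mul_zero, zero_mul, add_zero]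
          calc _ ≤ (A * ((q + A ^ 2 * m1 θ (x t)) * A)) * A := by
                refine mul_le_mul (mul_le_mul (N.hκ i) ((N.FlY H h hi).trans ?_) (abs_nonneg _) hA.le) (N.hy' i j)
                  (Nat.cast_nonneg _) (by positivity)
                exact mul_le_mul_of_nonneg_left (N.hτ i) hQ
            _ = _ := by ring
      rw [Finset.sum_add_distrib, ← Finset.mul_sum (a := A)] at h2
      simp only [Finset.sum_const, Finset.card_univ, Fintype.card_fin, nsmul_eq_mul] at h2
      have h3 := mul_le_mul_of_nonneg_left (hLr.trans (H.Lr_le h t)) hA.le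
      rw [e]
      simp only [iw, hj, if_false, zero_mul, zero_add]
      have := abs_add_le (x t j - θ j) (∑ i, kap k xb y i *
          (Fl τ x (fun u => YY xb u (y i)) i t - τ i * YY xb θ (y i)) * y' i j)
      linarith
  refine (Finset.sum_le_sum fun j _ => key j).trans (le_of_eq ?_)
  rw [Finset.sum_add_distrib, Finset.sum_add_distrib, ← Finset.mul_sum]
  simp only [Finset.sum_const, Finset.card_univ, Fintype.card_fin, nsmul_eq_mul]
  rfl

lemma Near.m1_sq (N : Near y y' k τ xb θ x A q t) (H : Ctx y y' k τ τm xb x M) (h : Om x θ) :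
    m1 θ (x t) ^ 2 ≤ n * (4 * A ^ 3) * UU y k τ xb θ x t := by
  have hA : 0 < A := by linarith [N.A1]
  have h1 : ∀ j, |mm θ (x t) j| ^ 2 ≤ 4 * A ^ 3 * pf θ j (x t j) := by
    intro j
    by_cases hj : θ j = 0
    · simp [mm, pf, hj]
    · have hp : 0 < θ j := lt_of_le_of_ne (H.Om_nonneg h j) (Ne.symm hj)
      have hc := (log_cmp hp (N.nx j hj).1 (N.nx j hj).2 (by linarith) (by linarith : θ j ≤ _)).1
      rw [mm, if_neg hj, pf, if_neg hj]
      have h2 : |Real.log (x t j) - Real.log (θ j)| ≤ A * |x t j - θ j| :=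
        hc.trans (mul_le_mul_of_nonneg_right (N.hθ1 j) (abs_nonneg _))
      have h3 := ff_sq (B := A) (H.pos t j).le hp ((N.nx j hj).2.trans (N.hθ2 j)) (by linarith [N.hθ2 j])
      calc _ ≤ (A * |x t j - θ j|) ^ 2 := pow_le_pow_left₀ (abs_nonneg _) h2 2
        _ = A ^ 2 * (x t j - θ j) ^ 2 := by rw [mul_pow, sq_abs]
        _ ≤ A ^ 2 * (4 * A * ff (x t j) (θ j)) := mul_le_mul_of_nonneg_left h3 (by positivity)
        _ = _ := by ring
  have h2 : m1 θ (x t) ^ 2 ≤ n * ∑ j, |mm θ (x t) j| ^ 2 := by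
    have := sq_sum_le_card_mul_sum_sq (s := (univ : Finset (Fin n))) (f := fun j => |mm θ (x t) j|)
    simpa [m1] using this
  have h3 : ∑ j, |mm θ (x t) j| ^ 2 ≤ 4 * A ^ 3 * ∑ j, pf θ j (x t j) := by
    rw [Finset.mul_sum]; exact Finset.sum_le_sum fun j _ => h1 j
  have h4 : 0 ≤ ∑ i, kap k xb y i * Fl τ x (qf xb θ (y i)) i t :=
    Finset.sum_nonneg fun i _ => mul_nonneg (H.kp i).le
      (intervalIntegral.integral_nonneg (by linarith [H.hτ i]) fun s _ => H.qf_nonneg h _ s)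
  calc _ ≤ n * ∑ j, |mm θ (x t) j| ^ 2 := h2
    _ ≤ n * (4 * A ^ 3 * UU y k τ xb θ x t) := by
      refine mul_le_mul_of_nonneg_left (h3.trans ?_) (Nat.cast_nonneg _)
      unfold UU
      exact mul_le_mul_of_nonneg_left (by linarith) (by positivity)
    _ = _ := by ring

end
end

section
variable {y y' : Fin r → Fin n → ℕ} {k τ : Fin r → ℝ} {τm : ℝ} {xb : Fin n → ℝ}
    {x : ℝ → Fin n → ℝ} {M : ℝ}

/-- a quantitative decomposition property of the stoichiometric space -/
def LinDec (y y' : Fin r → Fin n → ℕ) (xb θ : Fin n → ℝ) (C : ℝ) : Prop :=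
  ∀ v ∈ stoichOn y y' Finset.univ, ∃ (a : Fin r → ℝ) (b : Fin n → ℝ),
    (∀ j, v j = ∑ i, a i * ((y' i j : ℝ) - y i j) + b j) ∧ (∀ i, YY xb θ (y i) = 0 → a i = 0) ∧
    (∀ i, |a i| ≤ C * ∑ j, |v j|) ∧ ∑ j, |b j| ≤ C * ∑ j, iw θ j * |v j|

section
variable {θ : Fin n → ℝ} {A q t C : ℝ}

lemma Ctx.iw_zeta (H : Ctx y y' k τ τm xb x M) (h : Om x θ) (t : ℝ) :
    ∑ j, iw θ j * |zz y y' k τ xb x t j - FF y y' k τ xb θ j| = LL y y' k τ xb θ x t := by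
  unfold LL
  refine Finset.sum_congr rfl fun j _ => ?_
  by_cases hj : θ j = 0
  · rw [H.FF_zero h hj, sub_zero, abs_of_pos (H.z_pos t j)]
  · simp [iw, hj]

lemma abs_dot_le (m b : Fin n → ℝ) : |∑ j, m j * b j| ≤ (∑ j, |m j|) * ∑ j, |b j| := by
  refine (Finset.abs_sum_le_sum_abs _ _).trans ?_
  rw [Finset.sum_mul]
  refine Finset.sum_le_sum fun j _ => ?_
  rw [abs_mul]
  exact mul_le_mul_of_nonneg_left (Finset.single_le_sum (f := fun j => |b j|) (fun _ _ => abs_nonneg _) (mem_univ j))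
    (abs_nonneg _)

lemma dot_split (m v b : Fin n → ℝ) (a : Fin r → ℝ)
    (hv : ∀ j, v j = ∑ i, a i * ((y' i j : ℝ) - y i j) + b j) :
    ∑ j, m j * v j = ∑ i, a i * ∑ j, m j * ((y' i j : ℝ) - y i j) + ∑ j, m j * b j := by
  simp_rw [hv, mul_add, Finset.sum_add_distrib, Finset.mul_sum]
  congr 1
  rw [Finset.sum_comm]
  exact Finset.sum_congr rfl fun i _ => Finset.sum_congr rfl fun j _ => by ring

lemma Ctx.hmu (H : Ctx y y' k τ τm xb x M) (h : Om x θ) (hC : 0 ≤ C) (hl : LinDec y y' xb θ C) : 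
    ∃ C0, 0 ≤ C0 ∧ ∀ t > 0, ∑ j, Real.log (θ j / xb j) *
      (zz y y' k τ xb x t j - FF y y' k τ xb θ j) ≤ C0 * LL y y' k τ xb θ x t := by
  refine ⟨(∑ j, |Real.log (θ j / xb j)|) * C, mul_nonneg (Finset.sum_nonneg fun _ _ => abs_nonneg _) hC, ?_⟩
  intro t ht
  obtain ⟨a, b, hv, ha, -, hb⟩ := hl _ (H.z_FF_mem h ht)
  rw [H.iw_zeta h] at hb
  rw [dot_split _ _ b a hv]
  have h1 : ∀ i, a i * ∑ j, Real.log (θ j / xb j) * ((y' i j : ℝ) - y i j) = 0 := by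
    intro i
    by_cases hi : YY xb θ (y i) = 0
    · rw [ha i hi, zero_mul]
    · rw [H.mu_orth h, mul_zero]
      rw [YY_eq_zero H.xbpos] at hi
      push Not at hi
      exact hi
  rw [Finset.sum_eq_zero fun i _ => h1 i, zero_add]
  refine (le_abs_self _).trans ((abs_dot_le _ _).trans ?_)
  rw [mul_assoc]
  exact mul_le_mul_of_nonneg_left hb (Finset.sum_nonneg fun _ _ => abs_nonneg _)

lemma Near.U_bound (N : Near y y' k τ xb θ x A q t) (H : Ctx y y' k τ τm xb x M) (h : Om x θ) (ht : 0 < t)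
    (hC : 0 ≤ C) (hl : LinDec y y' xb θ C) :
    UU y k τ xb θ x t ≤ (r * C * A * (1 + A + n * (r * A ^ 5 + A)) + r * A ^ 5 + C + A) *
      ((m1 θ (x t) + q + LL y y' k τ xb θ x t) * q + m1 θ (x t) * LL y y' k τ xb θ x t) := by
  have hA1 := N.A1
  have hA : 0 < A := by linarith [N.A1]
  have hq0 := N.q0
  have hm := m1_nonneg θ (x t)
  have hL0 : 0 ≤ LL y y' k τ xb θ x t := (H.Lr_nonneg θ t).trans (H.Lr_le h t)
  have hU := N.U_le H h
  have hN := N.N1 H h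
  obtain ⟨a, b, hv, ha, ha', hb⟩ := hl _ (H.z_FF_mem h ht)
  rw [H.iw_zeta h] at hb
  rw [dot_split _ _ b a hv] at hU
  set L := LL y y' k τ xb θ x t
  set m := m1 θ (x t)
  set S := ∑ j, |zz y y' k τ xb x t j - FF y y' k τ xb θ j| with hS
  set G := 1 + A + n * (r * A ^ 5 + A) with hG
  have hS0 : 0 ≤ S := Finset.sum_nonneg fun _ _ => abs_nonneg _
  have h1 : ∑ i, a i * ∑ j, mm θ (x t) j * ((y' i j : ℝ) - y i j) ≤ ∑ i : Fin r, C * S * (A * q) := by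
    refine Finset.sum_le_sum fun i _ => ?_
    by_cases hi : YY xb θ (y i) = 0
    · rw [ha i hi, zero_mul]; positivity
    · have hp := Near.Yθ H h i hi
      have hs : t ∈ Set.Icc (t - τ i) t := ⟨by linarith [H.hτ i], le_rfl⟩
      have e : ∑ j, mm θ (x t) j * ((y' i j : ℝ) - y i j) =
          Real.log (YY xb (x t) (y' i)) - Real.log (YY xb (x t) (y i)) := by
        have e1 := H.mm_dot h (η := y' i) (by rwa [← H.Om_eq h]) t
        have e2 := H.mm_dot h hi t
        rw [← H.Om_eq h i] at e1
        simp_rw [mul_sub, Finset.sum_sub_distrib]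
        linarith
      refine (le_abs_self _).trans ?_
      rw [abs_mul, e, abs_sub_comm]
      refine mul_le_mul (ha' i) ?_ (abs_nonneg _) (by positivity)
      have h3 := (log_cmp hp (N.nY i hi t hs).1 (N.nY i hi t hs).2 (N.nY' i hi).1 (N.nY' i hi).2).1
      exact h3.trans (mul_le_mul (N.hY1 i) (N.hq i hi t hs) (abs_nonneg _) hA.le)
  have h2 : ∑ j, mm θ (x t) j * b j ≤ m * (C * L) :=
    (le_abs_self _).trans ((abs_dot_le _ _).trans (mul_le_mul_of_nonneg_left hb hm))
  simp only [Finset.sum_const, Finset.card_univ, Fintype.card_fin, nsmul_eq_mul] at h1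
  have hA35 : A ^ 3 ≤ A ^ 5 := pow_le_pow_right₀ hA1 (by norm_num)
  have hA3 : A ^ 3 * (q + A ^ 2 * m) ≤ A ^ 5 * (q + m) := by
    have := mul_le_mul_of_nonneg_right hA35 hq0
    nlinarith
  have hn : (0:ℝ) ≤ n := Nat.cast_nonneg _
  have hr : (0:ℝ) ≤ r := Nat.cast_nonneg _
  have hSG : S ≤ G * (m + q + L) := by
    have g1 : (n:ℝ) * (r * (A ^ 3 * (q + A ^ 2 * m)) + A * L) ≤ n * ((r * A ^ 5 + A) * (m + q + L)) := by
      refine mul_le_mul_of_nonneg_left ?_ hn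
      have g2 := mul_le_mul_of_nonneg_left hA3 hr
      have g3 : 0 ≤ r * A ^ 5 * L := by positivity
      have g4 : 0 ≤ A * (m + q) := by positivity
      nlinarith
    have g5 : L + A * m ≤ (1 + A) * (m + q + L) := by
      have g4 : 0 ≤ A * (q + L) := by positivity
      nlinarith
    rw [hG]
    linarith
  have h3 : (r:ℝ) * (C * S * (A * q)) ≤ r * C * A * G * ((m + q + L) * q) := by
    have : 0 ≤ (r:ℝ) * C * A * q := by positivity
    have := mul_le_mul_of_nonneg_left hSG this
    linarith
  have hmL : 0 ≤ m * L := by positivity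
  have h4 : (r:ℝ) * (A ^ 3 * ((q + A ^ 2 * m) * q)) ≤ r * A ^ 5 * ((m + q + L) * q) := by
    have g1 := mul_le_mul_of_nonneg_left hA3 (mul_nonneg hr hq0)
    have g2 : 0 ≤ r * A ^ 5 * (L * q) := by positivity
    linarith
  have hZ : 0 ≤ (m + q + L) * q := by positivity
  have hGp : 0 ≤ G := by positivity
  have h5 : 0 ≤ (C + A) * ((m + q + L) * q) := by positivity
  have h6 : 0 ≤ (r * C * A * G + r * A ^ 5) * (m * L) := by positivity
  linarith

/-- elementary combination -/
lemma quad_end {U L m q E C2 : ℝ} (hLU : L ≤ U) (hm : 0 ≤ m) (hq : 0 ≤ q) (hL : 0 ≤ L)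
    (hE : 0 < E) (hC2 : 0 < C2) (hU : U ≤ C2 * ((m + q + L) * q + m * L)) (hmE : m ^ 2 ≤ E * U)
    (hq4 : C2 * q ≤ 1 / 4) (hm4 : C2 * m ≤ 1 / 4) : L ≤ 4 * (C2 + C2 ^ 2 * E) * q ^ 2 := by
  have h1 : C2 * q * L ≤ 1 / 4 * L := mul_le_mul_of_nonneg_right hq4 hL
  have h2 : C2 * m * L ≤ 1 / 4 * L := mul_le_mul_of_nonneg_right hm4 hL
  have h3 : U ≤ 2 * C2 * m * q + 2 * C2 * q ^ 2 := by nlinarith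
  have h4 : 2 * C2 * m * q ≤ U / 2 + 2 * C2 ^ 2 * E * q ^ 2 := by
    have h5 : 0 ≤ (m - 2 * C2 * E * q) ^ 2 := sq_nonneg _
    have h6 : 0 ≤ E * U - 4 * E * C2 * m * q + 4 * C2 ^ 2 * E ^ 2 * q ^ 2 := by nlinarith
    have h7 : 0 ≤ E * (U - 4 * C2 * m * q + 4 * C2 ^ 2 * E * q ^ 2) := by nlinarith
    have h8 := nonneg_of_mul_nonneg_right h7 hE
    linarith
  nlinarith

lemma Ctx.LL_lim (H : Ctx y y' k τ τm xb x M) (h : Om x θ) (hx : Tendsto x atTop (nhds θ)) {ε : ℝ} (hε : 0 < ε) :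
    ∀ᶠ t in atTop, LL y y' k τ xb θ x t < ε := by
  have : Tendsto (fun t => LL y y' k τ xb θ x t) atTop (nhds 0) := by
    rw [tendsto_iff_seq_tendsto]
    intro T hT
    have h1 : Tendsto (fun N => ∑ j, iw θ j * zz y y' k τ xb x (T N) j) atTop
        (nhds (∑ j, iw θ j * FF y y' k τ xb θ j)) :=
      tendsto_finsetSum _ fun j _ => (H.z_lim hT (hx.comp hT) j).const_mul _
    have h2 : ∑ j, iw θ j * FF y y' k τ xb θ j = 0 := by
      refine Finset.sum_eq_zero fun j _ => ?_
      by_cases hj : θ j = 0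
      · rw [H.FF_zero h hj, mul_zero]
      · simp [iw, hj]
    rw [h2] at h1
    exact h1
  exact this.eventually_lt_const hε

set_option maxHeartbeats 1000000 in
lemma Ctx.stepII (H : Ctx y y' k τ τm xb x M) (h : Om x θ) (hx : Tendsto x atTop (nhds θ))
    (hC : 0 ≤ C) (hl : LinDec y y' xb θ C) : ∃ C3, 0 < C3 ∧ ∀ᶠ t in atTop, ∀ q, 0 ≤ q →
    (∀ i, YY xb θ (y i) ≠ 0 → ∀ s ∈ Set.Icc (t - τ i) t, |YY xb (x s) (y i) - YY xb (x t) (y' i)| ≤ q) →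
    LL y y' k τ xb θ x t ≤ C3 * q ^ 2 := by
  obtain ⟨C0, hC0, hmu⟩ := H.hmu h hC hl
  have hI := H.stepI h hx hC0 hmu
  obtain ⟨A1, h1, h1'⟩ := fin_bound (fun i => kap k xb y i)
  obtain ⟨A2, h2, h2'⟩ := fin_bound τ
  obtain ⟨A3, h3, h3'⟩ := fin_bound (fun p : Fin r × Fin n => (y' p.1 p.2 : ℝ))
  obtain ⟨A4, h4, h4'⟩ := fin_bound (fun i => 2 / YY xb θ (y i))
  obtain ⟨A5, h5, h5'⟩ := fin_bound (fun i => 2 * YY xb θ (y i))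
  obtain ⟨A6, h6, h6'⟩ := fin_bound (fun j => 2 / θ j)
  obtain ⟨A7, h7, h7'⟩ := fin_bound (fun j => 2 * θ j)
  set A := A1 + A2 + A3 + A4 + A5 + A6 + A7 with hA
  have hA1 : 1 ≤ A := by linarith
  set C2 := r * C * A * (1 + A + n * (r * A ^ 5 + A)) + r * A ^ 5 + C + A with hC2
  have hC2p : 0 < C2 := by
    have : 0 < A := by linarith
    positivity
  set E := n * (4 * A ^ 3) + 1 with hE
  have hEp : 0 < E := by
    have : 0 < A := by linarith
    positivity
  have hA0 : 0 < A := by linarith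
  set ε := 1 / (4 * C2) with hε
  have hεp : 0 < ε := by positivity
  clear_value C2 E ε A
  refine ⟨4 * (C2 + C2 ^ 2 * E) + 1 / ε ^ 2, by positivity, ?_⟩
  have e1 := H.ev_win hx (P := fun u => ∀ i, YY xb θ (y i) ≠ 0 → 
    (YY xb θ (y i) / 2 ≤ YY xb u (y i) ∧ YY xb u (y i) ≤ 2 * YY xb θ (y i)) ∧
    (YY xb θ (y i) / 2 ≤ YY xb u (y' i) ∧ YY xb u (y' i) ≤ 2 * YY xb θ (y i))) (by
      have : ∀ i, ∀ᶠ u in nhds θ, YY xb θ (y i) ≠ 0 → 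
        (YY xb θ (y i) / 2 ≤ YY xb u (y i) ∧ YY xb u (y i) ≤ 2 * YY xb θ (y i)) ∧
        (YY xb θ (y i) / 2 ≤ YY xb u (y' i) ∧ YY xb u (y' i) ≤ 2 * YY xb θ (y i)) := by
        intro i
        by_cases hi : YY xb θ (y i) = 0
        · simp [hi]
        have hp := Near.Yθ H h i hi
        have c1 := (continuous_YY xb (y i)).tendsto θ
        have c2 := (continuous_YY xb (y' i)).tendsto θ
        rw [← H.Om_eq h i] at c2
        filter_upwards [c1.eventually_const_le (by linarith : YY xb θ (y i) / 2 < _),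
          c1.eventually_le_const (by linarith : _ < 2 * YY xb θ (y i)),
          c2.eventually_const_le (by linarith : YY xb θ (y i) / 2 < _),
          c2.eventually_le_const (by linarith : _ < 2 * YY xb θ (y i))] with u a b c d _
        exact ⟨⟨a, b⟩, c, d⟩
      filter_upwards [eventually_all.2 this] with u hu _ i hi using hu i hi)
  have e2 : ∀ᶠ t in atTop, ∀ j, θ j ≠ 0 → θ j / 2 ≤ x t j ∧ x t j ≤ 2 * θ j := by
    refine eventually_all.2 fun j => ?_
    by_cases hj : θ j = 0
    · simp [hj]
    have hp : 0 < θ j := lt_of_le_of_ne (H.Om_nonneg h j) (Ne.symm hj)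
    have c1 := tendsto_pi_nhds.1 hx j
    filter_upwards [c1.eventually_const_le (by linarith : θ j / 2 < _),
          c1.eventually_le_const (by linarith : _ < 2 * θ j)] with t a b _ using ⟨a, b⟩
  have e3 : ∀ᶠ t in atTop, m1 θ (x t) < ε := by
    have : Tendsto (fun t => m1 θ (x t)) atTop (nhds (∑ j : Fin n, 0)) := by
      refine tendsto_finsetSum _ fun j _ => ?_
      by_cases hj : θ j = 0
      · simp [mm, hj]
      · have c1 := ((tendsto_pi_nhds.1 hx j).log hj).sub_const (Real.log (θ j))
        simp only [mm, hj, if_false]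
        simpa using c1.abs
    simp only [Finset.sum_const_zero] at this
    exact this.eventually_lt_const hεp
  filter_upwards [e1, e2, e3, hI, H.LL_lim h hx one_pos, eventually_gt_atTop 0] with t b1 b2 b3 b4 b5 ht q hq0 hq
  have hL0 : 0 ≤ LL y y' k τ xb θ x t := (H.Lr_nonneg θ t).trans (H.Lr_le h t)
  have hk0 : 0 ≤ 4 * (C2 + C2 ^ 2 * E) := by positivity
  rcases le_or_gt q ε with hqe | hqe
  · have N : Near y y' k τ xb θ x A q t := by
      refine ⟨hA1, hq0, fun i => ?_, fun i => ?_, fun i j => ?_, fun i => ?_, fun i => ?_, fun j => ?_, fun j => ?_,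
        fun i hi s hs => ?_, fun i hi => ?_, b2, hq⟩
      · linarith [h1' i]
      · linarith [h2' i]
      · linarith [h3' (i, j)]
      · linarith [h4' i]
      · linarith [h5' i]
      · linarith [h6' j]
      · linarith [h7' j]
      · exact (b1 s (by linarith [hs.1, H.hτm i]) i hi).1
      · exact (b1 t (by linarith [H.hτm0]) i hi).2
    have hu := N.U_bound H h ht hC hl
    rw [← hC2] at hu
    have hms := N.m1_sq H h
    have hU0 : 0 ≤ UU y k τ xb θ x t := hL0.trans b4
    have hc4 : C2 * ε = 1 / 4 := by rw [hε]; field_simp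
    have := quad_end b4 (m1_nonneg _ _) hq0 hL0 hEp hC2p hu (by rw [hE]; linarith)
      (by rw [← hc4]; exact mul_le_mul_of_nonneg_left hqe hC2p.le)
      (by rw [← hc4]; exact mul_le_mul_of_nonneg_left b3.le hC2p.le)
    have : 0 ≤ 1 / ε ^ 2 * q ^ 2 := by positivity
    linarith
  · have h8 : 1 ≤ 1 / ε ^ 2 * q ^ 2 := by
      rw [div_mul_eq_mul_div, one_mul, one_le_div (by positivity)]
      exact pow_le_pow_left₀ hεp.le hqe.le 2
    have : 0 ≤ 4 * (C2 + C2 ^ 2 * E) * q ^ 2 := by positivity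
    linarith
end
end

section
variable {y y' : Fin r → Fin n → ℕ} {k τ : Fin r → ℝ} {τm : ℝ} {xb : Fin n → ℝ}
    {x : ℝ → Fin n → ℝ} {M : ℝ}

lemma Ctx.Y_lip (H : Ctx y y' k τ τm xb x M) (η : Fin n → ℕ) : ∃ K : ℝ, 0 ≤ K ∧ ∀ s t,
    (YY xb (x s) η - YY xb (x t) η) ^ 2 ≤ K * ∑ j, (x s j - x t j) ^ 2 := by
  have hcd : ContDiff ℝ 1 (fun u : Fin n → ℝ => YY xb u η) := by
    unfold YY mono
    refine contDiff_prod fun j _ => ?_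
    exact ((contDiff_apply ℝ ℝ j).div_const _).pow _
  obtain ⟨K, hK⟩ := (hcd.locallyLipschitz.locallyLipschitzOn (s := Set.Icc 0 (fun _ => M))).exists_lipschitzOnWith_of_compact
    isCompact_Icc
  refine ⟨(K:ℝ) ^ 2, sq_nonneg _, fun s t => ?_⟩
  have hm : ∀ t, x t ∈ Set.Icc (0 : Fin n → ℝ) (fun _ => M) := fun t =>
    ⟨fun j => (H.pos t j).le, fun j => H.bdd t j⟩
  have h1 := hK.dist_le_mul _ (hm s) _ (hm t)
  rw [Real.dist_eq] at h1
  have h2 : dist (x s) (x t) ≤ √(∑ j, (x s j - x t j) ^ 2) := by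
    refine (dist_pi_le_iff (Real.sqrt_nonneg _)).2 fun j => ?_
    rw [Real.dist_eq]
    refine Real.abs_le_sqrt ?_
    exact Finset.single_le_sum (f := fun j => (x s j - x t j) ^ 2) (fun _ _ => sq_nonneg _) (mem_univ j)
  have h3 : |YY xb (x s) η - YY xb (x t) η| ≤ K * √(∑ j, (x s j - x t j) ^ 2) :=
    h1.trans (mul_le_mul_of_nonneg_left h2 K.2)
  calc _ = |YY xb (x s) η - YY xb (x t) η| ^ 2 := (sq_abs _).symm
    _ ≤ (K * √(∑ j, (x s j - x t j) ^ 2)) ^ 2 := pow_le_pow_left₀ (abs_nonneg _) h3 2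
    _ = _ := by rw [mul_pow, Real.sq_sqrt (Finset.sum_nonneg fun _ _ => sq_nonneg _)]

lemma Ctx.e_bound (H : Ctx y y' k τ τm xb x M) : ∃ A : ℝ, 0 < A ∧ ∀ t > τm, ∀ i, ∀ s ∈ Set.Icc (t - τ i) t,
    (YY xb (x s) (y i) - YY xb (x t) (y' i)) ^ 2 ≤
      A * (DD y y' k τ xb x t + VV y k τ xb x (t - τm) - VV y k τ xb x t) := by
  obtain ⟨A, hA, hd⟩ := H.delta_sq
  obtain ⟨B, hB, hi⟩ := H.incr
  choose K hK0 hK using fun i => H.Y_lip (y i)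
  obtain ⟨K1, hK1, hK1'⟩ := fin_bound K
  refine ⟨2 * A + 2 * (K1 * (n * (B * τm))), ?_, ?_⟩
  · have := H.hτm0
    positivity
  intro t ht i s hs
  have hτi := H.hτm i
  have h1 := hd t i
  have h2 := hK i s (t - τ i)
  have h3 : ∑ j, (x s j - x (t - τ i) j) ^ 2 ≤ ∑ j : Fin n, B * τm * (VV y k τ xb x (t - τm) - VV y k τ xb x t) := by
    refine Finset.sum_le_sum fun j _ => (hi (t - τ i) s (by linarith) hs.1 j).trans ?_
    have a1 := H.V_anti (s := t - τm) (t := t - τ i) (by linarith) (by linarith)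
    have a2 := H.V_anti (s := s) (t := t) (by linarith [hs.1]) hs.2
    have a3 := H.V_anti (s := t - τ i) (t := s) (by linarith [hs.1]) hs.1
    refine mul_le_mul (mul_le_mul_of_nonneg_left (by linarith [hs.2]) hB.le) (by linarith) (by linarith)
      (mul_nonneg hB.le H.hτm0)
  simp only [Finset.sum_const, Finset.card_univ, Fintype.card_fin, nsmul_eq_mul] at h3
  have hΔ : 0 ≤ VV y k τ xb x (t - τm) - VV y k τ xb x t := by
    linarith [H.V_anti (s := t - τm) (t := t) (by linarith) (by linarith [H.hτm0])]
  have h4 : K i * ∑ j, (x s j - x (t - τ i) j) ^ 2 ≤ K1 * (n * (B * τm * (VV y k τ xb x (t - τm) - VV y k τ xb x t))) :=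
    mul_le_mul (hK1' i) h3 (Finset.sum_nonneg fun _ _ => sq_nonneg _) (by linarith)
  have hD := H.DD_nonneg t
  have h5 : 0 ≤ A * (VV y k τ xb x (t - τm) - VV y k τ xb x t) := by positivity
  have h6 : 0 ≤ K1 * (n * (B * τm)) * DD y y' k τ xb x t := by
    have := H.hτm0
    positivity
  nlinarith [sq_nonneg ((YY xb (x s) (y i) - YY xb (x (t - τ i)) (y i)) -
    (YY xb (x (t - τ i)) (y i) - YY xb (x t) (y' i)))]

lemma Ctx.Y_bdd1 (H : Ctx y y' k τ τm xb x M) (η : Fin n → ℕ) : ∃ B : ℝ, 0 ≤ B ∧ ∀ t, YY xb (x t) η ≤ B := by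
  refine ⟨∏ j, (M / xb j) ^ η j, Finset.prod_nonneg fun j _ => pow_nonneg (div_pos (H.M_nonneg j) (H.xbpos j)).le _,
    fun t => ?_⟩
  unfold YY mono
  refine Finset.prod_le_prod (fun j _ => pow_nonneg (div_pos (H.pos t j) (H.xbpos j)).le _) fun j _ => ?_
  exact pow_le_pow_left₀ (div_pos (H.pos t j) (H.xbpos j)).le
      (div_le_div_of_nonneg_right (H.bdd t j) (H.xbpos j).le) _

lemma YY_add (xb u : Fin n → ℝ) (η η' : Fin n → ℕ) : YY xb u (η + η') = YY xb u η * YY xb u η' := by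
  unfold YY mono
  rw [← Finset.prod_mul_distrib]
  exact Finset.prod_congr rfl fun j _ => by simp [pow_add]

lemma YY_single (xb u : Fin n → ℝ) (j : Fin n) : YY xb u (Pi.single j 1) = u j / xb j := by
  unfold YY mono
  rw [Finset.prod_eq_single j]
  · simp
  · intro b _ hb; simp [Pi.single_apply, hb]
  · simp

lemma iw_mul_nat (θ : Fin n → ℝ) (η : Fin n → ℕ) : ∑ j, iw θ j * (η j : ℝ) = ((∑ j ∈ univ.filter (fun j => θ j = 0), η j : ℕ) : ℝ) := by
  rw [Finset.sum_filter]
  push_cast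
  refine Finset.sum_congr rfl fun j _ => ?_
  unfold iw
  split_ifs <;> simp

/-- two factors can be extracted -/
lemma extract2 (W : Finset (Fin n)) (η : Fin n → ℕ) (h : 2 ≤ ∑ j ∈ W, η j) :
    ∃ j ∈ W, ∃ j' ∈ W, ∃ η'' : Fin n → ℕ, η = Pi.single j 1 + Pi.single j' 1 + η'' := by
  have one : ∀ η : Fin n → ℕ, 1 ≤ ∑ j ∈ W, η j → ∃ j ∈ W, ∃ η'' : Fin n → ℕ, η = Pi.single j 1 + η'' := by
    intro η h
    obtain ⟨j, hj, h0⟩ := Finset.exists_ne_zero_of_sum_ne_zero (by omega : ∑ j ∈ W, η j ≠ 0)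
    refine ⟨j, hj, η - Pi.single j 1, ?_⟩
    funext a
    by_cases ha : a = j
    · subst ha; simp; omega
    · simp [Pi.single_apply, ha]
  obtain ⟨j, hj, η1, h1⟩ := one η (by omega)
  have h2 : ∑ a ∈ W, η a = 1 + ∑ a ∈ W, η1 a := by
    rw [h1]
    simp [Finset.sum_add_distrib, Pi.single_apply, hj]
  obtain ⟨j', hj', η2, h3⟩ := one η1 (by omega)
  exact ⟨j, hj, j', hj', η2, by rw [h1, h3, add_assoc]⟩

section
variable {θ : Fin n → ℝ} {C : ℝ}

lemma Ctx.x_le_LL (H : Ctx y y' k τ τm xb x M) (t : ℝ) {j : Fin n} (hj : θ j = 0) :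
    x t j ≤ LL y y' k τ xb θ x t := by
  refine (H.z_ge t j).trans ?_
  have := Finset.single_le_sum (f := fun j => iw θ j * zz y y' k τ xb x t j)
    (fun j _ => mul_nonneg (iw_nonneg θ j) (H.z_pos t j).le) (mem_univ j)
  simpa [iw, hj, LL] using this

lemma Ctx.rate_ge (H : Ctx y y' k τ τm xb x M) (h : Om x θ) (i) : ∃ C : ℝ, 0 ≤ C ∧ ∀ t,
    -(C * LL y y' k τ xb θ x t ^ 2) ≤ kap k xb y i * YY xb (x t) (y i) * ∑ j, iw θ j * ((y' i j : ℝ) - y i j) := by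
  have e : ∑ j, iw θ j * ((y' i j : ℝ) - y i j) = ((∑ j ∈ univ.filter (fun j => θ j = 0), y' i j : ℕ) : ℝ)
      - ((∑ j ∈ univ.filter (fun j => θ j = 0), y i j : ℕ) : ℝ) := by
    rw [← iw_mul_nat, ← iw_mul_nat, ← Finset.sum_sub_distrib]
    exact Finset.sum_congr rfl fun j _ => by ring
  by_cases hge : 0 ≤ ∑ j, iw θ j * ((y' i j : ℝ) - y i j)
  · refine ⟨0, le_rfl, fun t => ?_⟩
    have := mul_nonneg (mul_nonneg (H.kp i).le (YY_pos H.xbpos (H.pos t) (y i)).le) hge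
    linarith
  · have hlt : (∑ j ∈ univ.filter (fun j => θ j = 0), y' i j) < ∑ j ∈ univ.filter (fun j => θ j = 0), y i j := by
      rw [e] at hge
      push Not at hge
      have := sub_neg.1 hge
      exact_mod_cast this
    have h1 : 1 ≤ ∑ j ∈ univ.filter (fun j => θ j = 0), y' i j := by
      obtain ⟨j, hj, hj'⟩ := Finset.exists_ne_zero_of_sum_ne_zero (by omega : ∑ j ∈ univ.filter (fun j => θ j = 0), y i j ≠ 0)
      obtain ⟨j2, hj2, hj2'⟩ := (H.touch h i).1 ⟨j, (mem_filter.1 hj).2, hj'⟩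
      have := Finset.single_le_sum (s := univ.filter (fun j => θ j = 0)) (f := fun j => y' i j) (fun _ _ => Nat.zero_le _)
        (mem_filter.2 ⟨mem_univ j2, hj2⟩)
      omega
    obtain ⟨j, hj, j', hj', η, hη⟩ := extract2 (univ.filter (fun j => θ j = 0)) (y i) (by omega)
    obtain ⟨B, hB, hB'⟩ := H.Y_bdd1 η
    set σ := ∑ j, iw θ j * ((y' i j : ℝ) - y i j) with hσ
    have hσ0 : 0 ≤ -σ := by linarith
    have hκ := H.kp i
    have hb1 := H.xbpos j
    have hb2 := H.xbpos j'
    refine ⟨kap k xb y i * (B / (xb j * xb j')) * (-σ), by positivity, fun t => ?_⟩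
    have h2 : YY xb (x t) (y i) ≤ B / (xb j * xb j') * LL y y' k τ xb θ x t ^ 2 := by
      rw [hη, YY_add, YY_add, YY_single, YY_single]
      have g1 := H.x_le_LL (y := y) (y' := y') t (mem_filter.1 hj).2
      have g2 := H.x_le_LL (y := y) (y' := y') t (mem_filter.1 hj').2
      have g3 := H.pos t j
      have g4 := H.pos t j'
      calc _ ≤ (LL y y' k τ xb θ x t / xb j * (LL y y' k τ xb θ x t / xb j')) * B := by
            refine mul_le_mul (mul_le_mul (div_le_div_of_nonneg_right g1 hb1.le) (div_le_div_of_nonneg_right g2 hb2.le)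
              (by positivity) ?_) (hB' t) (YY_pos H.xbpos (H.pos t) _).le ?_
            · exact div_nonneg (g3.le.trans g1) hb1.le
            · exact mul_nonneg (div_nonneg (g3.le.trans g1) hb1.le) (div_nonneg (g4.le.trans g2) hb2.le)
        _ = _ := by field_simp
    have h3 := mul_le_mul_of_nonneg_left h2 (mul_nonneg hκ.le hσ0)
    nlinarith

lemma Ctx.LL_deriv (H : Ctx y y' k τ τm xb x M) {t : ℝ} (ht : 0 < t) :
    HasDerivAt (LL y y' k τ xb θ x)
      (∑ i, kap k xb y i * YY xb (x t) (y i) * ∑ j, iw θ j * ((y' i j : ℝ) - y i j)) t := by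
  have := HasDerivAt.fun_sum (u := univ) fun j _ => (H.z_deriv ht j).const_mul (iw θ j)
  refine this.congr_deriv ?_
  simp_rw [Finset.mul_sum]
  rw [Finset.sum_comm]
  exact Finset.sum_congr rfl fun i _ => Finset.sum_congr rfl fun j _ => by ring

lemma Ctx.caseV (H : Ctx y y' k τ τm xb x M) (h : Om x θ) (hx : Tendsto x atTop (nhds θ))
    {j0 : Fin n} (hj0 : θ j0 = 0) (hC : 0 ≤ C) (hl : LinDec y y' xb θ C) : False := by
  obtain ⟨C3, hC3, hII⟩ := H.stepII h hx hC hl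
  obtain ⟨A, hA, hAe⟩ := H.e_bound
  choose D hD hD' using H.rate_ge (θ := θ) h
  have hDs : 0 ≤ ∑ i, D i := Finset.sum_nonneg fun i _ => hD i
  have hLp : ∀ t, 0 < LL y y' k τ xb θ x t := fun t => (H.pos t j0).trans_le (H.x_le_LL t hj0)
  set V := VV y k τ xb x with hV
  set K := (∑ i, D i) * (C3 * A) with hK
  have hK0 : 0 ≤ K := by positivity
  set I : ℝ → ℝ := Fl (r := 1) (n := 1) (fun _ => τm) (fun t _ => V t) (fun u => u 0) 0 with hI
  have hId : ∀ t, HasDerivAt I (V t - V (t - τm)) t := fun t =>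
    Fl_hasDerivAt (continuous_pi fun _ => H.V_cont) (continuous_apply 0) (fun _ => τm) 0 t
  have hI0 : ∀ t, 0 ≤ I t := fun t =>
    intervalIntegral.integral_nonneg (by linarith [H.hτm0]) fun s _ => H.V_nonneg s
  set G : ℝ → ℝ := fun t => Real.log (LL y y' k τ xb θ x t) + K * (-V t - I t) with hG
  have hGd : ∀ t > 0, HasDerivAt G ((∑ i, kap k xb y i * YY xb (x t) (y i) * ∑ j, iw θ j * ((y' i j : ℝ) - y i j)) /
      LL y y' k τ xb θ x t + K * (-(-(DD y y' k τ xb x t)) - (V t - V (t - τm)))) t := fun t ht =>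
    ((H.LL_deriv ht).log (hLp t).ne').add (((H.V_deriv ht).neg.sub (hId t)).const_mul K)
  obtain ⟨T0, hT0⟩ := eventually_atTop.1 (hII.and (eventually_gt_atTop τm))
  have hmono : MonotoneOn G (Set.Ici T0) := by
    have hpos : ∀ t ∈ Set.Ici T0, 0 < t := fun t ht => H.hτm0.trans_lt (hT0 t ht).2
    refine monotoneOn_of_deriv_nonneg (convex_Ici T0)
      (fun t ht => (hGd t (hpos t ht)).continuousAt.continuousWithinAt)
      (fun t ht => (hGd t (hpos t (interior_subset ht))).differentiableAt.differentiableWithinAt) fun t ht => ?_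
    have htT := interior_subset ht
    rw [(hGd t (hpos t htT)).deriv]
    obtain ⟨h1, h2⟩ := hT0 t htT
    set e := DD y y' k τ xb x t + V (t - τm) - V t with he
    have he0 : 0 ≤ e := by
      have a1 := H.V_anti (s := t - τm) (t := t) (by linarith) (by linarith [H.hτm0])
      have a2 := H.DD_nonneg t
      rw [he]; linarith
    have h3 := h1 (√(A * e)) (Real.sqrt_nonneg _) (fun i _ s hs => Real.abs_le_sqrt (hAe t h2 i s hs))
    rw [Real.sq_sqrt (by positivity)] at h3
    have h4 : -((∑ i, D i) * LL y y' k τ xb θ x t ^ 2) ≤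
        ∑ i, kap k xb y i * YY xb (x t) (y i) * ∑ j, iw θ j * ((y' i j : ℝ) - y i j) := by
      rw [Finset.sum_mul, ← Finset.sum_neg_distrib]
      exact Finset.sum_le_sum fun i _ => hD' i t
    have h5 : -((∑ i, D i) * LL y y' k τ xb θ x t) ≤ (∑ i, kap k xb y i * YY xb (x t) (y i) *
        ∑ j, iw θ j * ((y' i j : ℝ) - y i j)) / LL y y' k τ xb θ x t := by
      rw [le_div_iff₀ (hLp t)]
      linarith
    have h6 := mul_le_mul_of_nonneg_left h3 hDs
    have h7 : (∑ i, D i) * (C3 * (A * e)) = K * e := by rw [hK]; ring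
    have h8 : K * (-(-(DD y y' k τ xb x t)) - (V t - V (t - τm))) = K * e := by rw [he]; ring
    linarith
  obtain ⟨t, ht1, ht2⟩ := ((H.LL_lim h hx (Real.exp_pos (G T0))).and (eventually_ge_atTop T0)).exists
  have h1 := hmono (Set.mem_Ici.2 le_rfl) (Set.mem_Ici.2 ht2) ht2
  have h2 : Real.log (LL y y' k τ xb θ x t) < G T0 := by
    rw [← Real.log_exp (G T0)]
    exact Real.log_lt_log (hLp t) ht1
  have h3 : G t = Real.log (LL y y' k τ xb θ x t) + K * (-V t - I t) := rfl
  have h4 : 0 ≤ K * (V t + I t) := mul_nonneg hK0 (add_nonneg (H.V_nonneg t) (hI0 t))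
  linarith
end
end

section
variable {y y' : Fin r → Fin n → ℕ} {k τ : Fin r → ℝ} {τm : ℝ} {xb : Fin n → ℝ} {x : ℝ → Fin n → ℝ} {M : ℝ}
variable {l : ℕ} {Sp : Fin l → Set (Fin n)} {grp : Fin r → Fin l} {θ : Fin n → ℝ}

lemma exists_quasi {E F : Type*} [AddCommGroup E] [Module ℝ E] [AddCommGroup F] [Module ℝ F]
    (f : E →ₗ[ℝ] F) : ∃ g : F →ₗ[ℝ] E, ∀ x, f (g (f x)) = f x := by
  obtain ⟨s, hs⟩ := f.rangeRestrict.exists_rightInverse_of_surjective f.range_rangeRestrict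
  obtain ⟨g, hg⟩ := s.exists_extend
  refine ⟨g, fun x => ?_⟩
  have h1 : g (f x) = s (f.rangeRestrict x) := by
    rw [← hg]; rfl
  have h2 := LinearMap.congr_fun hs (f.rangeRestrict x)
  rw [h1]
  exact congrArg Subtype.val h2

lemma lin_bound {m : ℕ} (L : (Fin n → ℝ) →ₗ[ℝ] (Fin m → ℝ)) :
    ∃ C : ℝ, 0 ≤ C ∧ ∀ u i, |L u i| ≤ C * ∑ j, |u j| := by
  obtain ⟨C, hC1, hC⟩ := fin_bound (fun q : Fin n × Fin m => |L (Pi.single q.1 1) q.2|)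
  refine ⟨C, by linarith, fun u i => ?_⟩
  have h : L u i = ∑ j, u j * L (Pi.single j 1) i := by
    conv_lhs => rw [LinearMap.pi_apply_eq_sum_univ L u]
    simp only [Finset.sum_apply, Pi.smul_apply, smul_eq_mul]
    refine Finset.sum_congr rfl fun j _ => ?_
    have e : (fun q => if j = q then (1:ℝ) else 0) = Pi.single j 1 := by
      ext q; simp [Pi.single_apply, eq_comm]
    rw [← e]
  rw [h, Finset.mul_sum]
  refine (Finset.abs_sum_le_sum_abs _ _).trans (Finset.sum_le_sum fun j _ => ?_)
  rw [abs_mul, mul_comm]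
  exact mul_le_mul_of_nonneg_right (hC (j, i)) (abs_nonneg _)

lemma LinDec_of (hV : ∀ v ∈ stoichOn y y' univ, (∀ j, θ j = 0 → v j = 0) →
      v ∈ stoichOn y y' (univ.filter fun i => YY xb θ (y i) ≠ 0)) :
    ∃ C : ℝ, 0 ≤ C ∧ LinDec y y' xb θ C := by
  classical
  set V := stoichOn y y' univ
  let pr : (Fin n → ℝ) →ₗ[ℝ] (Fin n → ℝ) := LinearMap.pi fun j => (iw θ j) • LinearMap.proj j
  have hpr : ∀ u j, pr u j = iw θ j * u j := fun u j => by simp [pr]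
  obtain ⟨g, hg⟩ := exists_quasi (pr.comp V.subtype)
  let G : (Fin n → ℝ) →ₗ[ℝ] (Fin n → ℝ) := V.subtype.comp g
  let T : (Fin r → ℝ) →ₗ[ℝ] (Fin n → ℝ) := LinearMap.pi fun j =>
    ∑ i, (if YY xb θ (y i) ≠ 0 then ((y' i j : ℝ) - y i j) else 0) • LinearMap.proj i
  have hT : ∀ a j, T a j = ∑ i, (if YY xb θ (y i) ≠ 0 then a i else 0) * ((y' i j : ℝ) - y i j) := by
    intro a j
    simp only [T, LinearMap.pi_apply, LinearMap.sum_apply, LinearMap.smul_apply, LinearMap.proj_apply, smul_eq_mul]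
    refine Finset.sum_congr rfl fun i _ => ?_
    split_ifs <;> ring
  obtain ⟨h, hh⟩ := exists_quasi T
  obtain ⟨C1, hC1, h1⟩ := lin_bound G
  obtain ⟨C2, hC2, h2⟩ := lin_bound h
  have hrange : ∀ v ∈ stoichOn y y' (univ.filter fun i => YY xb θ (y i) ≠ 0), v ∈ LinearMap.range T := by
    intro v hv
    refine (Submodule.span_le.2 ?_) hv
    rintro _ ⟨i, hi, rfl⟩
    refine ⟨Pi.single i 1, ?_⟩
    ext j
    rw [hT, Finset.sum_eq_single i]
    · simp only [mem_filter, mem_univ, true_and] at hi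
      simp [hi]
    · intro b _ hb; simp [Pi.single_eq_of_ne hb]
    · simp
  have hA : (0:ℝ) ≤ n * C1 := by positivity
  refine ⟨n * C1 + C2 * (1 + n * C1), by positivity, ?_⟩
  intro v hv
  have hb : ∑ j, |G (pr v) j| ≤ n * C1 * ∑ j, iw θ j * |v j| := by
    have : ∀ j ∈ (univ : Finset (Fin n)), |G (pr v) j| ≤ C1 * ∑ j, iw θ j * |v j| := by
      intro j _
      refine (h1 _ j).trans_eq ?_
      congr 1
      refine Finset.sum_congr rfl fun j _ => ?_
      rw [hpr, abs_mul, abs_of_nonneg (iw_nonneg θ j)]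
    refine (Finset.sum_le_sum this).trans_eq ?_
    simp; ring
  have hiw : ∑ j, iw θ j * |v j| ≤ ∑ j, |v j| := Finset.sum_le_sum fun j _ =>
    mul_le_of_le_one_left (abs_nonneg _) (iw_le θ j)
  have hiw0 : 0 ≤ ∑ j, iw θ j * |v j| := Finset.sum_nonneg fun j _ => mul_nonneg (iw_nonneg θ j) (abs_nonneg _)
  have hd : v - G (pr v) ∈ LinearMap.range T := by
    apply hrange
    apply hV
    · exact V.sub_mem hv (g (pr v)).2
    · intro j hj
      have := congrFun (hg ⟨v, hv⟩) j
      simp only [LinearMap.comp_apply, Submodule.subtype_apply, hpr] at this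
      simp only [iw, hj, if_true, one_mul] at this
      simp only [Pi.sub_apply]
      simp only [G, LinearMap.comp_apply, Submodule.subtype_apply]
      rw [this]; ring
  obtain ⟨a0, ha0⟩ := hd
  refine ⟨fun i => if YY xb θ (y i) ≠ 0 then h (v - G (pr v)) i else 0, G (pr v), ?_, ?_, ?_, ?_⟩
  · intro j
    rw [← hT, ← ha0, hh, ha0]; simp
  · intro i hi; simp [hi]
  · intro i
    have h3 : |h (v - G (pr v)) i| ≤ C2 * (1 + n * C1) * ∑ j, |v j| := by
      refine (h2 _ i).trans ?_
      rw [mul_assoc]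
      refine mul_le_mul_of_nonneg_left ?_ hC2
      calc ∑ j, |(v - G (pr v)) j| ≤ ∑ j, (|v j| + |G (pr v) j|) :=
            Finset.sum_le_sum fun j _ => abs_sub _ _
        _ = ∑ j, |v j| + ∑ j, |G (pr v) j| := Finset.sum_add_distrib
        _ ≤ (1 + n * C1) * ∑ j, |v j| := by
          have := mul_le_mul_of_nonneg_left hiw hA
          linarith
    have h4 : 0 ≤ ∑ j, |v j| := Finset.sum_nonneg fun _ _ => abs_nonneg _
    have h5 : C2 * (1 + n * C1) * ∑ j, |v j| ≤ (n * C1 + C2 * (1 + n * C1)) * ∑ j, |v j| := by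
      have := mul_nonneg hA h4
      linarith
    dsimp only
    split_ifs
    · exact h3.trans h5
    · rw [abs_zero]; positivity
  · refine hb.trans ?_
    have : 0 ≤ C2 * (1 + n * C1) * ∑ j, iw θ j * |v j| := by positivity
    linarith

lemma stoich_decomp (v) (hv : v ∈ stoichOn y y' univ) :
    ∃ f : Fin l → Fin n → ℝ, (∀ p, f p ∈ stoichOn y y' (Rgrp grp p)) ∧ v = ∑ p, f p := by
  classical
  induction hv using Submodule.span_induction with
  | mem v hv =>
    obtain ⟨i, _, rfl⟩ := hv
    refine ⟨Pi.single (grp i) (fun j => (y' i j : ℝ) - y i j), fun p => ?_, ?_⟩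
    · by_cases hp : p = grp i
      · subst hp; rw [Pi.single_eq_same]; exact mem_stoich _ (by simp [Rgrp])
      · rw [Pi.single_eq_of_ne hp]; exact Submodule.zero_mem _
    · simp
  | zero => exact ⟨0, fun p => Submodule.zero_mem _, by simp⟩
  | add u v _ _ hu hv =>
    obtain ⟨f, hf, rfl⟩ := hu
    obtain ⟨g, hg, rfl⟩ := hv
    exact ⟨f + g, fun p => Submodule.add_mem _ (hf p) (hg p), by simp [Finset.sum_add_distrib]⟩
  | smul a v _ hv =>
    obtain ⟨f, hf, rfl⟩ := hv
    exact ⟨a • f, fun p => Submodule.smul_mem _ _ (hf p), by simp [Finset.smul_sum]⟩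

lemma stoich_off (hcomb : IsCombination y y' Sp grp) {p v} (hv : v ∈ stoichOn y y' (Rgrp grp p)) {j}
    (hj : j ∉ Sp p) : v j = 0 := by
  have := sum_stoich_zero (R := Rgrp grp p) (c := Pi.single j 1) (y := y) (y' := y') ?_ hv
  · simpa [Pi.single_apply] using this
  · intro i hi
    simp only [Rgrp, mem_filter, mem_univ, true_and] at hi
    subst hi
    have h1 : y i j = 0 := by
      by_contra h; exact hj (hcomb.2 i j (Or.inl h))
    have h2 : y' i j = 0 := by
      by_contra h; exact hj (hcomb.2 i j (Or.inr h))
    simp [Pi.single_apply, h1, h2]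
end

section
variable {y y' : Fin r → Fin n → ℕ} {k τ : Fin r → ℝ} {τm : ℝ} {xb : Fin n → ℝ} {x : ℝ → Fin n → ℝ} {M : ℝ}
variable {l : ℕ} {Sp : Fin l → Set (Fin n)} {grp : Fin r → Fin l} {θ : Fin n → ℝ}

lemma grp_eq (hcomb : IsCombination y y' Sp grp)
    (hdis : ∀ j, θ j = 0 → ∀ p q, j ∈ Sp p → j ∈ Sp q → p = q) {i j p} (hj : θ j = 0) (hp : j ∈ Sp p)
    (h : y i j ≠ 0 ∨ y' i j ≠ 0) : grp i = p := hdis j hj _ _ (hcomb.2 i j h) hp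

lemma Ctx.touchp (H : Ctx y y' k τ τm xb x M) (h : Om x θ) (hcomb : IsCombination y y' Sp grp)
    (hdis : ∀ j, θ j = 0 → ∀ p q, j ∈ Sp p → j ∈ Sp q → p = q) (p i) :
    (∃ j, (θ j = 0 ∧ j ∈ Sp p) ∧ y i j ≠ 0) ↔ ∃ j, (θ j = 0 ∧ j ∈ Sp p) ∧ y' i j ≠ 0 := by
  constructor
  · rintro ⟨j, ⟨hj, hp⟩, hy⟩
    have hg := grp_eq hcomb hdis hj hp (Or.inl hy)
    obtain ⟨j', hj', hy'⟩ := (H.touch h i).1 ⟨j, hj, hy⟩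
    exact ⟨j', ⟨hj', hg ▸ hcomb.2 i j' (Or.inr hy')⟩, hy'⟩
  · rintro ⟨j, ⟨hj, hp⟩, hy⟩
    have hg := grp_eq hcomb hdis hj hp (Or.inr hy)
    obtain ⟨j', hj', hy'⟩ := (H.touch h i).2 ⟨j, hj, hy⟩
    exact ⟨j', ⟨hj', hg ▸ hcomb.2 i j' (Or.inl hy')⟩, hy'⟩

/-- the local multiplier for one subnetwork -/
def GoodK (y y' : Fin r → Fin n → ℕ) (k : Fin r → ℝ) (xb θ : Fin n → ℝ) (Sp : Fin l → Set (Fin n))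
    (grp : Fin r → Fin l) (p : Fin l) (K : Fin n → ℝ) : Prop :=
  (∀ j, ¬ (θ j = 0 ∧ j ∈ Sp p) → K j = 0) ∧ ∀ᶠ u in nhds θ, (∀ j, 0 < u j) →
    ∑ i ∈ Rgrp grp p, kap k xb y i * YY xb u (y i) *
      (∑ j, (Real.log (θ j / xb j) - K j) * ((y' i j : ℝ) - y i j)) ≤ 0

lemma Ctx.goodK_empty (H : Ctx y y' k τ τm xb x M) (h : Om x θ) (hcomb : IsCombination y y' Sp grp) {p}
    (he : ∀ j, θ j = 0 → j ∉ Sp p) : GoodK y y' k xb θ Sp grp p 0 := by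
  refine ⟨fun _ _ => rfl, Eventually.of_forall fun u _ => le_of_eq (Finset.sum_eq_zero fun i hi => ?_)⟩
  simp only [Rgrp, mem_filter, mem_univ, true_and] at hi
  have := H.mu_orth h (i := i) (fun j hj => by
    by_contra hy; exact he j hj (hi ▸ hcomb.2 i j (Or.inl hy)))
  simp [this]

lemma vertex_alpha (V : Submodule ℝ (Fin n → ℝ)) (W : Set (Fin n)) (hv : VertexType V W) (μ : Fin n → ℝ) :
    ∃ α : Fin n → ℝ, (∀ j, j ∉ W → α j = 0) ∧ ∀ v ∈ V, ∑ j, (μ j - α j) * v j = 0 := by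
  classical
  let pr : (Fin n → ℝ) →ₗ[ℝ] (Fin n → ℝ) := LinearMap.pi fun j => (if j ∈ W then (1:ℝ) else 0) • LinearMap.proj j
  have hpr : ∀ u j, pr u j = if j ∈ W then u j else 0 := fun u j => by
    by_cases h : j ∈ W <;> simp [pr, h]
  obtain ⟨g, hg⟩ := exists_quasi (pr.comp V.subtype)
  let L : (Fin n → ℝ) →ₗ[ℝ] ℝ := ∑ j, μ j • LinearMap.proj j
  have hL : ∀ u, L u = ∑ j, μ j * u j := fun u => by simp [L]
  let F : (Fin n → ℝ) →ₗ[ℝ] ℝ := (L.comp V.subtype).comp g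
  refine ⟨fun j => if j ∈ W then F (Pi.single j 1) else 0, fun j hj => by simp [hj], fun v hv' => ?_⟩
  have h1 : (g (pr v) : Fin n → ℝ) = v := by
    rw [← sub_eq_zero]
    apply hv
    · exact V.sub_mem (g (pr v)).2 hv'
    · intro j hj
      have := congrFun (hg ⟨v, hv'⟩) j
      simp only [LinearMap.comp_apply, Submodule.subtype_apply, hpr, hj, if_true] at this
      rw [Pi.sub_apply, this, sub_self]
  have h2 : F (pr v) = ∑ j, μ j * v j := by
    change L (g (pr v) : Fin n → ℝ) = _
    rw [h1, hL]
  have h3 : F (pr v) = ∑ j, (if j ∈ W then F (Pi.single j 1) else 0) * v j := by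
    conv_lhs => rw [LinearMap.pi_apply_eq_sum_univ F (pr v)]
    refine Finset.sum_congr rfl fun j _ => ?_
    have e : (fun q => if j = q then (1:ℝ) else 0) = Pi.single j 1 := by
      ext q; simp [Pi.single_apply, eq_comm]
    rw [e, hpr, smul_eq_mul]
    split_ifs <;> ring
  simp only [sub_mul, Finset.sum_sub_distrib]
  rw [← h2, ← h3, sub_self]

lemma goodK_vertex {p} (hv : VertexType (stoichOn y y' (Rgrp grp p)) {j | θ j = 0 ∧ j ∈ Sp p}) :
    ∃ K, GoodK y y' k xb θ Sp grp p K := by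
  obtain ⟨α, h1, h2⟩ := vertex_alpha _ _ hv (fun j => Real.log (θ j / xb j))
  refine ⟨α, h1, Eventually.of_forall fun u _ => le_of_eq (Finset.sum_eq_zero fun i hi => ?_)⟩
  have := h2 _ (mem_stoich (y := y) (y' := y') _ hi)
  rw [this, mul_zero]

/-- facet data for one subnetwork -/
def FacetDat (y y' : Fin r → Fin n → ℕ) (θ : Fin n → ℝ) (Sp : Fin l → Set (Fin n))
    (grp : Fin r → Fin l) (p : Fin l) (j0 : Fin n) : Prop :=
  (θ j0 = 0 ∧ j0 ∈ Sp p) ∧ ∃ ρ : Fin n → ℝ, (∀ j, (θ j = 0 ∧ j ∈ Sp p) → 0 < ρ j) ∧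
    ∀ v ∈ stoichOn y y' (Rgrp grp p), ∀ j, (θ j = 0 ∧ j ∈ Sp p) → v j = v j0 * ρ j

lemma Ctx.facet_near (H : Ctx y y' k τ τm xb x M) (h : Om x θ) (hcomb : IsCombination y y' Sp grp)
    (hdis : ∀ j, θ j = 0 → ∀ p q, j ∈ Sp p → j ∈ Sp q → p = q) {p j0} (hf : FacetDat y y' θ Sp grp p j0)
    (R : Finset (Fin r)) (hR : ∀ i, i ∈ R ↔ ∃ j, (θ j = 0 ∧ j ∈ Sp p) ∧ y i j ≠ 0)
    (c : Fin n → ℝ)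
    (hc : ∀ i i', (0 < (y i' j0 : ℝ) - y i j0 → ∑ j, c j * ((y i' j : ℝ) - y i j) ≤ 0) ∧
      ((y i' j0 : ℝ) - y i j0 = 0 → 0 < ∑ j, c j * ((y i' j : ℝ) - y i j) →
        0 < ∑ j, Real.log (θ j / xb j) * ((y i' j : ℝ) - y i j))) :
    ∀ᶠ u in nhds θ, (∀ j, 0 < u j) → ∑ i ∈ R, kap k xb y i * YY xb u (y i) *
      (∑ j, c j * ((y' i j : ℝ) - y i j)) ≤ 0 := by
  obtain ⟨hj0, ρ, hρ, hv⟩ := hf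
  refine H.nearLe R (fun η => ∃ j, (θ j = 0 ∧ j ∈ Sp p) ∧ η j ≠ 0) hR
    (fun i => (hR i).trans (H.touchp h hcomb hdis p i)) (stoichOn y y' (Rgrp grp p)) ?_ c ?_
  · intro i hi
    obtain ⟨j, ⟨hj, hp⟩, hy⟩ := (hR i).1 hi
    apply mem_stoich
    simp only [Rgrp, mem_filter, mem_univ, true_and]
    exact grp_eq hcomb hdis hj hp (Or.inl hy)
  · intro i _ i' _ hmem hpos
    have hval := hv _ hmem
    have hval' : ∀ j, θ j = 0 → j ∉ Sp p → (y i' j : ℝ) - y i j = 0 := fun j _ hj =>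
      stoich_off hcomb hmem hj
    have hle : (y i' j0 : ℝ) - y i j0 ≤ 0 := by
      by_contra hlt
      exact absurd ((hc i i').1 (not_le.1 hlt)) (not_le.2 hpos)
    refine ev_mono H.xbpos (H.Om_nonneg h) _ _ ?_ ?_
    · intro j hj
      by_cases hp : j ∈ Sp p
      · have := hval j ⟨hj, hp⟩
        rw [this]
        exact mul_nonpos_of_nonpos_of_nonneg hle (hρ j ⟨hj, hp⟩).le
      · exact (hval' j hj hp).le
    · rcases hle.lt_or_eq with hlt | heq
      · exact Or.inl ⟨j0, hj0.1, hlt⟩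
      · exact Or.inr ((hc i i').2 heq hpos)

lemma Ctx.goodK_facet (H : Ctx y y' k τ τm xb x M) (h : Om x θ) (hcomb : IsCombination y y' Sp grp)
    (hdis : ∀ j, θ j = 0 → ∀ p q, j ∈ Sp p → j ∈ Sp q → p = q) {p j0} (hf : FacetDat y y' θ Sp grp p j0) :
    ∃ K, GoodK y y' k xb θ Sp grp p K := by
  classical
  obtain ⟨A, _, hA⟩ := fin_bound (fun q : Fin r × Fin r =>
    (∑ j, Real.log (θ j / xb j) * ((y q.2 j : ℝ) - y q.1 j)) / ((y q.2 j0 : ℝ) - y q.1 j0))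
  have hs : ∀ v : Fin n → ℝ, ∑ j, (Real.log (θ j / xb j) - (Pi.single j0 A : Fin n → ℝ) j) * v j
      = ∑ j, Real.log (θ j / xb j) * v j - A * v j0 := by
    intro v
    simp only [sub_mul, Finset.sum_sub_distrib]
    congr 1
    simp [Pi.single_apply]
  have hnear := H.facet_near h hcomb hdis hf
    (univ.filter fun i => ∃ j, (θ j = 0 ∧ j ∈ Sp p) ∧ y i j ≠ 0) (by simp)
    (fun j => Real.log (θ j / xb j) - (Pi.single j0 A : Fin n → ℝ) j) (by
      intro i i'
      constructor
      · intro hpos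
        have := hA (i, i')
        rw [div_le_iff₀ hpos] at this
        rw [hs (fun j => (y i' j : ℝ) - y i j)]
        linarith
      · intro h0 hpos
        rw [hs (fun j => (y i' j : ℝ) - y i j), h0] at hpos
        simpa using hpos)
  refine ⟨Pi.single j0 A, ?_, ?_⟩
  · intro j hj
    rw [Pi.single_eq_of_ne]
    rintro rfl
    exact hj hf.1
  · filter_upwards [hnear] with u hu hpos
    refine le_trans (le_of_eq ?_) (hu hpos)
    symm
    apply Finset.sum_subset
    · intro i hi
      simp only [mem_filter, mem_univ, true_and] at hi
      obtain ⟨j, ⟨hj, hp⟩, hy⟩ := hi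
      simp only [Rgrp, mem_filter, mem_univ, true_and]
      exact grp_eq hcomb hdis hj hp (Or.inl hy)
    · intro i hi hni
      simp only [Rgrp, mem_filter, mem_univ, true_and] at hi hni
      have hni' : ¬ _ := fun hh => hni ((H.touchp h hcomb hdis p i).2 hh)
      push Not at hni hni'
      have hm := H.mu_orth h (i := i) (fun j hj => by
        by_contra hy
        exact hy (hni j ⟨hj, hi ▸ hcomb.2 i j (Or.inl hy)⟩))
      rw [hs (fun j => (y' i j : ℝ) - y i j), hm, hni j0 hf.1, hni' j0 hf.1]
      simp

lemma Ctx.facet_false (H : Ctx y y' k τ τm xb x M) (h : Om x θ) (hcomb : IsCombination y y' Sp grp)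
    (hdis : ∀ j, θ j = 0 → ∀ p q, j ∈ Sp p → j ∈ Sp q → p = q) {p j0} (hf : FacetDat y y' θ Sp grp p j0)
    (hx : Tendsto x atTop (nhds θ)) : False := by
  classical
  have hs : ∀ v : Fin n → ℝ, ∑ j, (if j = j0 then (-1:ℝ) else 0) * v j = - v j0 := by
    intro v; simp
  have hnear := H.facet_near h hcomb hdis hf
    (univ.filter fun i => ∃ j, (θ j = 0 ∧ j ∈ Sp p) ∧ y i j ≠ 0) (by simp)
    (fun j => if j = j0 then (-1:ℝ) else 0) (by
      intro i i'
      constructor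
      · intro hpos
        rw [hs (fun j => (y i' j : ℝ) - y i j)]
        linarith
      · intro h0 hpos
        rw [hs (fun j => (y i' j : ℝ) - y i j), h0] at hpos
        simp at hpos)
  refine H.facet_end h hx j0 hf.1.1 ?_
  filter_upwards [hnear] with u hu hpos
  refine le_trans (le_of_eq ?_) (hu hpos)
  symm
  apply Finset.sum_subset (Finset.subset_univ _)
  intro i hi hni
  simp only [mem_filter, mem_univ, true_and] at hni
  have hni' : ¬ _ := fun hh => hni ((H.touchp h hcomb hdis p i).2 hh)
  push Not at hni hni'
  rw [hs (fun j => (y' i j : ℝ) - y i j), hni j0 hf.1, hni' j0 hf.1]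
  simp

lemma Ctx.conv (H : Ctx y y' k τ τm xb x M) (h : Om x θ) (hcomb : IsCombination y y' Sp grp)
    (hdis : ∀ j, θ j = 0 → ∀ p q, j ∈ Sp p → j ∈ Sp q → p = q)
    (hmin : ∀ θ', Om x θ' → (∀ j, θ' j = 0 → θ j = 0) → ∀ j, θ j = 0 → θ' j = 0)
    (hK : ∀ p, ∃ K, GoodK y y' k xb θ Sp grp p K) : Tendsto x atTop (nhds θ) := by
  classical
  choose K hK0 hK1 using hK
  refine H.stable h hmin (fun j => ∑ p, K p j) ?_ ?_
  · intro j hj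
    exact Finset.sum_eq_zero fun p _ => hK0 p j fun hh => hj hh.1
  · have := Filter.eventually_all.2 hK1
    filter_upwards [this] with u hu hpos
    have e : ∀ i, ∑ j, (Real.log (θ j / xb j) - ∑ p, K p j) * ((y' i j : ℝ) - y i j)
        = ∑ j, (Real.log (θ j / xb j) - K (grp i) j) * ((y' i j : ℝ) - y i j) := by
      intro i
      refine Finset.sum_congr rfl fun j _ => ?_
      by_cases hy : y i j ≠ 0 ∨ y' i j ≠ 0
      · congr 2
        refine Finset.sum_eq_single _ (fun q _ hq => hK0 q j ?_) (by simp)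
        rintro ⟨h1, h2⟩
        exact hq (grp_eq hcomb hdis h1 h2 hy).symm
      · push Not at hy
        simp [hy.1, hy.2]
    rw [← Finset.sum_fiberwise (s := univ) (g := grp)]
    refine Finset.sum_nonpos fun p _ => le_trans (le_of_eq ?_) (hu p hpos)
    refine Finset.sum_congr rfl fun i hi => ?_
    simp only [Rgrp, mem_filter, mem_univ, true_and] at hi
    rw [e, hi]
end

section
variable {y y' : Fin r → Fin n → ℕ} {k τ : Fin r → ℝ} {τm : ℝ} {xb : Fin n → ℝ} {x : ℝ → Fin n → ℝ} {M : ℝ}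
variable {l : ℕ} {Sp : Fin l → Set (Fin n)} {grp : Fin r → Fin l} {θ : Fin n → ℝ}

lemma facet_lin (V : Submodule ℝ (Fin n → ℝ)) (W : Set (Fin n)) (h2 : Module.finrank ℝ V = 2)
    (hf : FacetType V W) (hv : ¬ VertexType V W) : 
    ∃ v0 : Fin n → ℝ, ∀ v ∈ V, ∃ b : ℝ, ∀ j ∈ W, v j = b * v0 j := by
  unfold FacetType at hf
  rw [h2] at hf
  set f := LinearMap.funLeft ℝ ℝ (Subtype.val : {j : Fin n // j ∉ W} → Fin n)
  have hrk := LinearMap.finrank_range_add_finrank_ker (f.domRestrict V)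
  rw [LinearMap.range_domRestrict, hf, h2] at hrk
  have hker : LinearMap.ker (f.domRestrict V) ≠ ⊥ := by
    intro hb
    rw [hb, finrank_bot] at hrk
    omega
  obtain ⟨⟨v0, hv0⟩, hv0k, hv0n⟩ := (Submodule.ne_bot_iff _).1 hker
  have hv0z : ∀ j, j ∉ W → v0 j = 0 := fun j hj => congrFun hv0k ⟨j, hj⟩
  have hv0n' : v0 ≠ 0 := fun hh => hv0n (Subtype.ext hh)
  unfold VertexType at hv
  push Not at hv
  obtain ⟨u0, hu0, hu0z, hu0n⟩ := hv
  have hli : LinearIndependent ℝ ![(⟨u0, hu0⟩ : V), ⟨v0, hv0⟩] := by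
    rw [LinearIndependent.pair_iff]
    intro s t hst
    have hst' : ∀ j, s * u0 j + t * v0 j = 0 := fun j => congrFun (congrArg Subtype.val hst) j
    have hs : s = 0 := by
      by_contra hs
      apply hu0n
      ext j
      by_cases hj : j ∈ W
      · exact hu0z j hj
      · have := hst' j
        rw [hv0z j hj] at this
        simpa [hs] using this
    refine ⟨hs, ?_⟩
    by_contra ht
    apply hv0n'
    ext j
    have := hst' j
    rw [hs] at this
    simpa [ht] using this
  have htop := hli.span_eq_top_of_card_eq_finrank' (by simp [h2])
  refine ⟨v0, fun v hv => ?_⟩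
  have hmem : (⟨v, hv⟩ : V) ∈ Submodule.span ℝ (Set.range ![(⟨u0, hu0⟩ : V), ⟨v0, hv0⟩]) := by
    rw [htop]; trivial
  rw [Matrix.range_cons, Matrix.range_cons, Matrix.range_empty, Set.union_empty, Set.singleton_union,
    Submodule.mem_span_pair] at hmem
  obtain ⟨a, b, hab⟩ := hmem
  refine ⟨b, fun j hj => ?_⟩
  have := congrFun (congrArg Subtype.val hab) j
  simp only [Submodule.coe_add, Submodule.coe_smul, Pi.add_apply, Pi.smul_apply, smul_eq_mul] at this
  rw [← this, hu0z j hj]; ring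

lemma Ctx.facetDat (H : Ctx y y' k τ τm xb x M) (h : Om x θ) (hcomb : IsCombination y y' Sp grp)
    (hdis : ∀ j, θ j = 0 → ∀ p q, j ∈ Sp p → j ∈ Sp q → p = q) {p j0} (hj0 : θ j0 = 0 ∧ j0 ∈ Sp p)
    (h2 : Module.finrank ℝ (stoichOn y y' (Rgrp grp p)) = 2)
    (hf : FacetType (stoichOn y y' (Rgrp grp p)) {j | θ j = 0 ∧ j ∈ Sp p})
    (hv : ¬ VertexType (stoichOn y y' (Rgrp grp p)) {j | θ j = 0 ∧ j ∈ Sp p}) :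
    FacetDat y y' θ Sp grp p j0 := by
  obtain ⟨v0, hv0⟩ := facet_lin _ _ h2 hf hv
  obtain ⟨f, hf1, hf2⟩ := stoich_decomp (l := l) (grp := grp) _ (H.z_FF_mem h (t := 1) one_pos)
  have hw : ∀ j, (θ j = 0 ∧ j ∈ Sp p) → 0 < f p j := by
    intro j hj
    have e := congrFun hf2 j
    rw [H.FF_zero h hj.1, sub_zero, Finset.sum_apply, Finset.sum_eq_single p] at e
    · rw [← e]; exact H.z_pos 1 j
    · intro q _ hq
      exact stoich_off hcomb (hf1 q) fun hjq => hq (hdis j hj.1 _ _ hjq hj.2)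
    · simp
  obtain ⟨b', hb'⟩ := hv0 _ (hf1 p)
  refine ⟨hj0, fun j => f p j / f p j0, fun j hj => div_pos (hw j hj) (hw j0 hj0), ?_⟩
  intro v hv j hj
  obtain ⟨b, hb⟩ := hv0 v hv
  have h0 := hw j0 hj0
  rw [← mul_div_assoc, eq_div_iff h0.ne', hb j hj, hb j0 hj0, hb' j hj, hb' j0 hj0]
  ring

lemma Ctx.main (H : Ctx y y' k τ τm xb x M) (hcomb : IsCombination y y' Sp grp)
    (h2d : ∀ p, Module.finrank ℝ (stoichOn y y' (Rgrp grp p)) = 2)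
    (hcase : ∀ W : Set (Fin n), Semilocking y y' Finset.univ W →
      ((∃ p, Semilocking y y' (Rgrp grp p) (W ∩ Sp p) ∧
          FacetType (stoichOn y y' (Rgrp grp p)) (W ∩ Sp p)) ∨
        (∀ p, Semilocking y y' (Rgrp grp p) (W ∩ Sp p) ∧
          VertexType (stoichOn y y' (Rgrp grp p)) (W ∩ Sp p))) ∧
      W ∩ interSpecies Sp = ∅) (θ0 : Fin n → ℝ) (h0 : Om x θ0) (j : Fin n) : 0 < θ0 j := by
  classical
  by_contra hneg
  have hz0 : θ0 j = 0 := le_antisymm (not_lt.1 hneg) (H.Om_nonneg h0 j)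
  have hall : ∀ θ, Om x θ → ∃ j, θ j = 0 := by
    intro θ hθ
    by_contra hh
    push Not at hh
    have := H.pos_unique hθ h0 (fun j => lt_of_le_of_ne (H.Om_nonneg hθ j) (hh j).symm)
    exact hh j (this ▸ hz0)
  let P : ℕ → Prop := fun m => ∃ θ, Om x θ ∧ (univ.filter fun j => θ j = 0).card = m
  have hP : ∃ m, P m := ⟨_, θ0, h0, rfl⟩
  obtain ⟨θ, h, hcard⟩ := Nat.find_spec hP
  have hmin : ∀ θ', Om x θ' → (∀ j, θ' j = 0 → θ j = 0) → ∀ j, θ j = 0 → θ' j = 0 := by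
    intro θ' h' hsub j hj
    have hle := Nat.find_min' hP (⟨θ', h', rfl⟩ : P _)
    rw [← hcard] at hle
    have := Finset.eq_of_subset_of_card_le (s := univ.filter fun j => θ' j = 0)
      (t := univ.filter fun j => θ j = 0) (fun j hj => by
        simp only [mem_filter, mem_univ, true_and] at hj ⊢; exact hsub j hj) hle
    have hm : j ∈ univ.filter fun j => θ' j = 0 := by rw [this]; simp [hj]
    simpa using hm
  obtain ⟨j1, hj1⟩ := hall θ h
  have hdis : ∀ j, θ j = 0 → ∀ p q, j ∈ Sp p → j ∈ Sp q → p = q := by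
    have hs : Semilocking y y' univ {j | θ j = 0} := ⟨⟨j1, hj1⟩, fun i _ hi => (H.touch h i).2 hi⟩
    have := (hcase _ hs).2
    intro j hj p q hp hq
    by_contra hne
    have : j ∈ ({j | θ j = 0} ∩ interSpecies Sp : Set (Fin n)) := ⟨hj, p, q, hne, hp, hq⟩
    simp_all
  have hclass : ∀ p, (∀ j, θ j = 0 → j ∉ Sp p) ∨
      VertexType (stoichOn y y' (Rgrp grp p)) {j | θ j = 0 ∧ j ∈ Sp p} ∨
      ∃ j0, FacetDat y y' θ Sp grp p j0 := by
    intro p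
    by_cases he : ∀ j, θ j = 0 → j ∉ Sp p
    · exact Or.inl he
    right
    by_cases hv : VertexType (stoichOn y y' (Rgrp grp p)) {j | θ j = 0 ∧ j ∈ Sp p}
    · exact Or.inl hv
    right
    push Not at he
    obtain ⟨j0, hj0⟩ := he
    have hs : Semilocking y y' univ {j | θ j = 0 ∧ j ∈ Sp p} :=
      ⟨⟨j0, hj0⟩, fun i _ hi => (H.touchp h hcomb hdis p i).2 hi⟩
    have hpp : {j | θ j = 0 ∧ j ∈ Sp p} ∩ Sp p = {j | θ j = 0 ∧ j ∈ Sp p} := by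
      ext j; simp
    refine ⟨j0, H.facetDat h hcomb hdis hj0 (h2d p) ?_ hv⟩
    rcases (hcase _ hs).1 with ⟨q, ⟨⟨j2, hj2⟩, _⟩, hq2⟩ | hc
    · have hqp : q = p := hdis j2 hj2.1.1 _ _ hj2.2 hj2.1.2
      subst hqp
      rwa [hpp] at hq2
    · have := (hc p).2
      rw [hpp] at this
      exact absurd this hv
  have hx : Tendsto x atTop (nhds θ) := by
    refine H.conv h hcomb hdis hmin fun p => ?_
    rcases hclass p with he | hv | ⟨j0, hf⟩
    · exact ⟨0, H.goodK_empty h hcomb he⟩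
    · exact goodK_vertex hv
    · exact H.goodK_facet h hcomb hdis hf
  by_cases hfac : ∃ p j0, FacetDat y y' θ Sp grp p j0
  · obtain ⟨p, j0, hf⟩ := hfac
    exact H.facet_false h hcomb hdis hf hx
  have hcl : ∀ p, (∀ j, θ j = 0 → j ∉ Sp p) ∨
      VertexType (stoichOn y y' (Rgrp grp p)) {j | θ j = 0 ∧ j ∈ Sp p} := by
    intro p
    rcases hclass p with he | hv | ⟨j0, hf⟩
    · exact Or.inl he
    · exact Or.inr hv
    · exact absurd ⟨p, j0, hf⟩ hfac
  obtain ⟨C, hC, hl⟩ := LinDec_of (y := y) (y' := y') (xb := xb) (θ := θ) (by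
    intro v hv hvz
    obtain ⟨f, hf1, hf2⟩ := stoich_decomp (l := l) (grp := grp) _ hv
    rw [hf2]
    refine Submodule.sum_mem _ fun p _ => ?_
    rcases hcl p with he | hvt
    · refine (Submodule.span_mono ?_) (hf1 p)
      rintro _ ⟨i, hi, rfl⟩
      refine ⟨i, ?_, rfl⟩
      simp only [Rgrp, mem_filter, mem_univ, true_and] at hi ⊢
      rw [Ne, YY_eq_zero H.xbpos]
      rintro ⟨j, hj, hy⟩
      exact he j hj (hi ▸ hcomb.2 i j (Or.inl hy))
    · rw [hvt _ (hf1 p)]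
      · exact Submodule.zero_mem _
      · rintro j ⟨hj, hp⟩
        have e := congrFun hf2 j
        rw [hvz j hj, Finset.sum_apply, Finset.sum_eq_single p] at e
        · exact e.symm
        · intro q _ hq
          exact stoich_off hcomb (hf1 q) fun hjq => hq (hdis j hj _ _ hjq hp)
        · simp)
  exact H.caseV h hx hj1 hC hl
end

section
variable {y y' : Fin r → Fin n → ℕ} {k τ : Fin r → ℝ} {τm : ℝ} {xb : Fin n → ℝ} {x : ℝ → Fin n → ℝ} {M : ℝ}

lemma mono_factor (η : Fin n → ℕ) (j : Fin n) (hj : η j ≠ 0) (M : ℝ) (hM : 0 ≤ M) :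
    ∃ C : ℝ, 0 ≤ C ∧ ∀ u : Fin n → ℝ, (∀ j, 0 ≤ u j) → (∀ j, u j ≤ M) → mono u η ≤ C * u j := by
  classical
  refine ⟨∏ i, M ^ ((η - Pi.single j 1 : Fin n → ℕ) i), by positivity, fun u h0 h1 => ?_⟩
  have hη : η = (η - Pi.single j 1) + Pi.single j 1 := by
    ext i
    by_cases hi : i = j
    · subst hi; simp; omega
    · simp [Pi.single_eq_of_ne hi]
  have e : mono u η = mono u (η - Pi.single j 1) * u j := by
    conv_lhs => rw [hη]
    simp only [mono, Pi.add_apply, pow_add, Finset.prod_mul_distrib]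
    congr 1
    rw [Finset.prod_eq_single j]
    · simp
    · intro b _ hb; simp [Pi.single_eq_of_ne hb]
    · simp
  rw [e]
  refine mul_le_mul_of_nonneg_right ?_ (h0 j)
  exact Finset.prod_le_prod (fun i _ => pow_nonneg (h0 i) _) fun i _ => pow_le_pow_left₀ (h0 i) (h1 i) _

lemma sol_pos (hk : ∀ i, 0 < k i) (hτm : ∀ i, τ i ≤ τm) (hτm0 : 0 ≤ τm)
    (hx : IsSolution y y' k τ τm x) (hp : PosInit τm x) (hM : ∀ t ∈ Set.Ici (-τm), ‖x t‖ ≤ M)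
    (t : ℝ) (ht : -τm ≤ t) (j : Fin n) : 0 < x t j := by
  obtain ⟨hnn, hc, hd⟩ := hx
  rcases le_or_gt t 0 with h | h
  · exact hp t ⟨ht, h⟩ j
  have hM0 : 0 ≤ M := (norm_nonneg _).trans (hM t ht)
  have hxM : ∀ s, -τm ≤ s → ∀ j, x s j ≤ M := fun s hs j =>
    (le_abs_self _).trans ((norm_le_pi_norm (x s) j).trans (hM s hs))
  have hCi : ∀ i, ∃ C : ℝ, 0 ≤ C ∧ ∀ u : Fin n → ℝ, (∀ j, 0 ≤ u j) → (∀ j, u j ≤ M) →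
      mono u (y i) * (y i j : ℝ) ≤ C * u j := by
    intro i
    by_cases hj : y i j = 0
    · exact ⟨0, le_rfl, fun u _ _ => by simp [hj]⟩
    · obtain ⟨C, hC, h1⟩ := mono_factor (y i) j hj M hM0
      refine ⟨C * (y i j : ℝ), by positivity, fun u h0 h2 => ?_⟩
      have := mul_le_mul_of_nonneg_right (h1 u h0 h2) (Nat.cast_nonneg (α := ℝ) (y i j))
      linarith
  choose C hC hCu using hCi
  set L := ∑ i, k i * C i with hL
  have hder : ∀ s > 0, HasDerivAt (fun s => x s j * Real.exp (L * s))
      ((∑ i, k i * (mono (x (s - τ i)) (y i) * (y' i j : ℝ) - mono (x s) (y i) * (y i j : ℝ)))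
        * Real.exp (L * s) + x s j * (Real.exp (L * s) * L)) s := by
    intro s hs
    have h1 := hasDerivAt_pi.1 (hd s hs) j
    have h2 : HasDerivAt (fun s => Real.exp (L * s)) (Real.exp (L * s) * L) s := by
      have := ((hasDerivAt_id s).const_mul L).exp
      simpa using this
    exact h1.mul h2
  have hmono : MonotoneOn (fun s => x s j * Real.exp (L * s)) (Set.Ici 0) := by
    refine monotoneOn_of_deriv_nonneg (convex_Ici 0) ?_ ?_ ?_
    · have : ContinuousOn (fun s => x s j) (Set.Ici 0) :=
        (continuousOn_pi.1 hc j).mono (Set.Ici_subset_Ici.2 (by linarith))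
      exact this.mul (by fun_prop)
    · intro s hs
      rw [interior_Ici] at hs
      exact (hder s hs).differentiableAt.differentiableWithinAt
    · intro s hs
      rw [interior_Ici] at hs
      have hs' : 0 < s := hs
      rw [(hder s hs).deriv]
      have hlow : -(L * x s j) ≤ ∑ i, k i * (mono (x (s - τ i)) (y i) * (y' i j : ℝ)
          - mono (x s) (y i) * (y i j : ℝ)) := by
        rw [hL, Finset.sum_mul, ← Finset.sum_neg_distrib]
        refine Finset.sum_le_sum fun i _ => ?_
        have h1 := hCu i (x s) (hnn s (by simp; linarith)) (hxM s (by linarith))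
        have h2 : 0 ≤ mono (x (s - τ i)) (y i) * (y' i j : ℝ) :=
          mul_nonneg (mono_nonneg (hnn _ (by have := hτm i; simp; linarith)) _) (Nat.cast_nonneg _)
        have h3 := mul_le_mul_of_nonneg_left (show -(C i * x s j) ≤ mono (x (s - τ i)) (y i) * (y' i j : ℝ)
          - mono (x s) (y i) * (y i j : ℝ) by linarith) (hk i).le
        linarith
      have := mul_le_mul_of_nonneg_right hlow (Real.exp_pos (L * s)).le
      linarith
  have h1 := hmono (Set.mem_Ici.2 le_rfl) (Set.mem_Ici.2 h.le) h.le
  have h2 := hp 0 ⟨by linarith, le_rfl⟩ j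
  simp only [mul_zero, Real.exp_zero, mul_one] at h1
  exact pos_of_mul_pos_left (h2.trans_le h1) (Real.exp_pos _).le

lemma mkCtx (hk : ∀ i, 0 < k i) (hτ : ∀ i, 0 ≤ τ i) (hτm : ∀ i, τ i ≤ τm) (hτm0 : 0 ≤ τm)
    (hCB : ComplexBalancedOn y y' k Finset.univ)
    (hx : IsSolution y y' k τ τm x) (hp : PosInit τm x) (hM : ∀ t ∈ Set.Ici (-τm), ‖x t‖ ≤ M) :
    ∃ xb, Ctx y y' k τ τm xb (fun t => x (max t (-τm))) M := by
  obtain ⟨xb, hxb, hb⟩ := hCB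
  refine ⟨xb, ?_⟩
  have hpos := sol_pos hk hτm hτm0 hx hp hM
  obtain ⟨hnn, hc, hd⟩ := hx
  exact {
    hk := hk, hτ := hτ, hτm := hτm, hτm0 := hτm0, xbpos := hxb
    bal := fun φ => bal_of_CB hb φ
    cont := by
      rw [← continuousOn_univ]
      exact hc.comp (by fun_prop) (fun t _ => le_max_right t (-τm))
    pos := fun t j => hpos _ (le_max_right _ _) j
    bdd := fun t j => (le_abs_self _).trans ((norm_le_pi_norm (x _) j).trans (hM _ (le_max_right t (-τm))))
    der := by
      intro t ht j
      have h1 := hasDerivAt_pi.1 (hd t ht) j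
      have e : (fun s => x (max s (-τm)) j) =ᶠ[nhds t] fun s => x s j := by
        filter_upwards [lt_mem_nhds ht] with s hs
        rw [max_eq_left (by linarith)]
      have h2 := h1.congr_of_eventuallyEq e
      have e3 : ∀ i, max (t - τ i) (-τm) = t - τ i := fun i =>
        max_eq_left (by have := hτm i; linarith)
      have e4 : max t (-τm) = t := max_eq_left (by linarith)
      simp only [e3, e4]
      exact h2 }
end

theorem stmt6 {n r l : ℕ} (y y' : Fin r → Fin n → ℕ)
    (k τ : Fin r → ℝ) (τm : ℝ)
    (hk : ∀ i, 0 < k i) (hτ : ∀ i, 0 ≤ τ i) (hτm : ∀ i, τ i ≤ τm) (hτm0 : 0 ≤ τm)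
    (hCB : ComplexBalancedOn y y' k Finset.univ)
    (Sp : Fin l → Set (Fin n)) (grp : Fin r → Fin l)
    (hcomb : IsCombination y y' Sp grp)
    (hsubCB : ∀ p, ComplexBalancedOn y y' k (Rgrp grp p))
    (h2d : ∀ p, Module.finrank ℝ (stoichOn y y' (Rgrp grp p)) = 2)
    (hcase : ∀ W : Set (Fin n), Semilocking y y' Finset.univ W →
      ((∃ p, Semilocking y y' (Rgrp grp p) (W ∩ Sp p) ∧
          FacetType (stoichOn y y' (Rgrp grp p)) (W ∩ Sp p)) ∨
        (∀ p, Semilocking y y' (Rgrp grp p) (W ∩ Sp p) ∧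
          VertexType (stoichOn y y' (Rgrp grp p)) (W ∩ Sp p))) ∧
      W ∩ interSpecies Sp = ∅) :
    Persistent y y' k τ τm := by
  intro x hx hp hB j
  obtain ⟨M, hM⟩ := hB
  obtain ⟨xb, H⟩ := mkCtx hk hτ hτm hτm0 hCB hx hp hM
  obtain ⟨c, hc, hev⟩ := H.pos_end (fun θ h j => H.main hcomb h2d hcase θ h j) j
  have hev' : ∀ᶠ t in atTop, c ≤ x t j := by
    filter_upwards [hev, eventually_ge_atTop (-τm)] with t h1 h2
    rwa [max_eq_left h2] at h1
  refine lt_of_lt_of_le hc (le_liminf_of_le ?_ hev')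
  refine IsBoundedUnder.isCoboundedUnder_ge ⟨M, ?_⟩
  rw [eventually_map]
  filter_upwards [eventually_ge_atTop (-τm)] with t h2
  exact (le_abs_self _).trans ((norm_le_pi_norm (x t) j).trans (hM t h2))
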